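/- arXiv:1704.06576 — 7 statements merged into one kernel-verified Lean document; each statement's English description precedes it below -/
import Mathlib

section
/- Let Q = [−1,1]ⁿ ⊆ ℝⁿ and let f : ℝⁿ → Q be the nearest-point projection onto Q, given coordinatewise by f(x)•e_j = min(1, max(−1, x•e_j)) for j = 1,…,n, where e_1,…,e_n is the standard basis. Let s : ℝ → ℝ be of class C^∞ with Dⁱs(−1) = 0 and Dⁱs(1) = 0 for every integer i ≥ 1, and define h : ℝⁿ → ℝⁿ by h(x) = Σ_{j=1}ⁿ s(x•e_j) e_j. Then g = h ∘ f is of class C^∞ and for every integer i ≥ 1 the i-th derivative satisfies Dⁱg(x) = (Dⁱh)(f(x)) for all x ∈ ℝⁿ. -/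
open Metric Set

noncomputable section

lemma abs_clamp_sub_clamp_le (a b x y : ℝ) :
    |min b (max a x) - min b (max a y)| ≤ |x - y| := by
  calc |min b (max a x) - min b (max a y)| ≤ |max a x - max a y| := by
        simpa using abs_min_sub_min_le_max b (max a x) b (max a y)
    _ ≤ |x - y| := by simpa using abs_max_sub_max_le_max a x a y

lemma continuous_clamp (a b : ℝ) : Continuous fun t : ℝ => min b (max a t) := by
  fun_prop

/-- Precomposing with the clamp onto `[a, b]` preserves differentiability when the derivative
vanishes at both end points. -/
lemma HasDerivAt.comp_clamp {a b : ℝ} (hab : a ≤ b) {u u' : ℝ → ℝ}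
    (hu : ∀ t, HasDerivAt u (u' t) t) (ha : u' a = 0) (hb : u' b = 0) (t : ℝ) :
    HasDerivAt (fun t => u (min b (max a t))) (u' (min b (max a t))) t := by
  by_cases ht : a < t ∧ t < b
  · have key : ∀ y ∈ Ioo a b, min b (max a y) = y := fun y hy => by
      rw [max_eq_right hy.1.le, min_eq_right hy.2.le]
    rw [key t ht]
    refine (hu t).congr_of_eventuallyEq ?_
    filter_upwards [isOpen_Ioo.mem_nhds ht] with y hy
    rw [key y hy]
  · have hend : u' (min b (max a t)) = 0 := by
      by_cases h1 : a < t
      · have h2 : b ≤ t := not_lt.1 fun h => ht ⟨h1, h⟩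
        rw [min_eq_left (h2.trans (le_max_right _ _)), hb]
      · rw [max_eq_left (not_lt.1 h1), min_eq_right hab, ha]
    have h0 := hu (min b (max a t))
    rw [hend] at h0 ⊢
    rw [hasDerivAt_iff_isLittleO] at h0 ⊢
    simp only [smul_zero, sub_zero] at h0 ⊢
    refine (h0.comp_tendsto ((continuous_clamp a b).tendsto t)).trans_isBigO ?_
    exact Asymptotics.isBigO_of_le _ fun y => abs_clamp_sub_clamp_le a b y t

lemma iteratedDeriv_comp_clamp {a b : ℝ} (hab : a ≤ b) {s : ℝ → ℝ}
    (hs : ContDiff ℝ (⊤ : ℕ∞) s) (ha : ∀ i : ℕ, 1 ≤ i → iteratedDeriv i s a = 0)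
    (hb : ∀ i : ℕ, 1 ≤ i → iteratedDeriv i s b = 0) (i : ℕ) :
    (iteratedDeriv i fun t => s (min b (max a t))) =
        (fun t => iteratedDeriv i s (min b (max a t))) ∧
      Differentiable ℝ (iteratedDeriv i fun t => s (min b (max a t))) := by
  have hd : ∀ i t, HasDerivAt (fun t => iteratedDeriv i s (min b (max a t)))
      (iteratedDeriv (i + 1) s (min b (max a t))) t := fun i =>
    HasDerivAt.comp_clamp hab
      (fun t => by
        rw [iteratedDeriv_succ]
        exact ((hs.differentiable_iteratedDeriv i (by exact_mod_cast ENat.natCast_lt_top i)) t).hasDerivAt)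
      (ha _ (by omega)) (hb _ (by omega))
  have he : (iteratedDeriv i fun t => s (min b (max a t))) =
      fun t => iteratedDeriv i s (min b (max a t)) := by
    induction i with
    | zero => simp
    | succ i ih =>
      rw [iteratedDeriv_succ, ih]
      exact funext fun t => (hd i t).deriv
  exact ⟨he, he ▸ fun t => (hd i t).differentiableAt⟩

lemma contDiff_coordinatewise {n : ℕ} {s : ℝ → ℝ} (hs : ContDiff ℝ (⊤ : ℕ∞) s)
    {h : EuclideanSpace ℝ (Fin n) → EuclideanSpace ℝ (Fin n)} (hh : ∀ x j, h x j = s (x j)) :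
    ContDiff ℝ (⊤ : ℕ∞) h := by
  rw [contDiff_euclidean]
  intro j
  simp only [hh]
  exact hs.comp (EuclideanSpace.proj (𝕜 := ℝ) j).contDiff

lemma iteratedFDeriv_coordinatewise_apply {n : ℕ} {s : ℝ → ℝ} (hs : ContDiff ℝ (⊤ : ℕ∞) s)
    {h : EuclideanSpace ℝ (Fin n) → EuclideanSpace ℝ (Fin n)} (hh : ∀ x j, h x j = s (x j))
    (i : ℕ) (x : EuclideanSpace ℝ (Fin n)) (m : Fin i → EuclideanSpace ℝ (Fin n)) (j : Fin n) :
    iteratedFDeriv ℝ i h x m j = (∏ k, m k j) * iteratedDeriv i s (x j) := by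
  have hi : (i : WithTop ℕ∞) ≤ ((⊤ : ℕ∞) : WithTop ℕ∞) := by exact_mod_cast le_top
  let L : EuclideanSpace ℝ (Fin n) →L[ℝ] ℝ := EuclideanSpace.proj j
  have hc : L ∘ h = s ∘ L := funext fun x => hh x j
  have h1 := L.iteratedFDeriv_comp_left (contDiff_coordinatewise hs hh).contDiffAt hi (x := x)
  rw [hc, L.iteratedFDeriv_comp_right hs x hi] at h1
  have h2 := congrArg (fun T => T m) h1
  simp only [ContinuousMultilinearMap.compContinuousLinearMap_apply,
    iteratedFDeriv_apply_eq_iteratedDeriv_mul_prod, smul_eq_mul] at h2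
  exact h2.symm

theorem smooth_retraction_onto_cube_smoothness (n : ℕ) (hn : 0 < n)
    (f : EuclideanSpace ℝ (Fin n) → EuclideanSpace ℝ (Fin n))
    (hf : ∀ (x : EuclideanSpace ℝ (Fin n)) (j : Fin n), f x j = min 1 (max (-1) (x j)))
    (s : ℝ → ℝ) (hs : ContDiff ℝ (⊤ : ℕ∞) s)
    (hs1 : ∀ i : ℕ, 1 ≤ i → iteratedDeriv i s (-1) = 0 ∧ iteratedDeriv i s 1 = 0)
    (h : EuclideanSpace ℝ (Fin n) → EuclideanSpace ℝ (Fin n))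
    (hh : ∀ (x : EuclideanSpace ℝ (Fin n)) (j : Fin n), h x j = s (x j)) :
    ContDiff ℝ (⊤ : ℕ∞) (h ∘ f) ∧
    ∀ i : ℕ, 1 ≤ i → ∀ x : EuclideanSpace ℝ (Fin n),
      iteratedFDeriv ℝ i (h ∘ f) x = iteratedFDeriv ℝ i h (f x) := by
  have hclamp := iteratedDeriv_comp_clamp (by norm_num : (-1 : ℝ) ≤ 1) hs
    (fun i hi => (hs1 i hi).1) (fun i hi => (hs1 i hi).2)
  have hsc : ContDiff ℝ (⊤ : ℕ∞) fun t => s (min 1 (max (-1) t)) :=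
    contDiff_of_differentiable_iteratedDeriv fun i _ => (hclamp i).2
  have hg : ∀ x j, (h ∘ f) x j = (fun t => s (min 1 (max (-1) t))) (x j) := fun x j => by
    simp only [Function.comp_apply, hh, hf]
  refine ⟨contDiff_coordinatewise hsc hg, fun i _ x => ?_⟩
  ext m j
  rw [iteratedFDeriv_coordinatewise_apply hsc hg, iteratedFDeriv_coordinatewise_apply hs hh,
    (hclamp i).1, hf]
end
end

section
/- Let Q = [−1,1]ⁿ ⊆ ℝⁿ, let f : ℝⁿ → Q be the nearest-point projection onto Q given coordinatewise by f(x)•e_j = min(1, max(−1, x•e_j)), let ε ∈ (0,1), and let s : ℝ → ℝ be of class C^∞ with Dⁱs(−1) = 0 = Dⁱs(1) for all i ≥ 1, satisfying 0 ≤ s′(t) ≤ 1+ε and |s(t) − t| ≤ ε for all t ∈ ℝ and s′(t) > 0 for t ∈ ℝ∖{−1,1}. Define h(x) = Σ_{j=1}ⁿ s(x•e_j) e_j and g = h ∘ f. Then: |g(x) − x| ≤ (1+√n)·ε for every x with dist(x,Q) ≤ ε; g is Lipschitz with Lipschitz constant at most 1+ε; g − id_{ℝⁿ} is Lipschitz with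 Lipschitz constant at most 1; and for every compact set K ⊆ Int Q, the restriction of g − id_{ℝⁿ} to K has Lipschitz constant strictly less than 1. -/
open Metric Set

noncomputable section

theorem EuclideanSpace.norm_le_mul_norm_of_forall_abs_le {ι : Type*} [Fintype ι]
    {c : ℝ} (hc : 0 ≤ c) (v w : EuclideanSpace ℝ ι) (hvw : ∀ j, |v j| ≤ c * |w j|) :
    ‖v‖ ≤ c * ‖w‖ := by
  rw [EuclideanSpace.norm_eq, EuclideanSpace.norm_eq]
  apply Real.sqrt_le_iff.2
  refine ⟨by positivity, ?_⟩
  rw [mul_pow, Real.sq_sqrt (by positivity), Finset.mul_sum]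
  refine Finset.sum_le_sum fun j _ => ?_
  rw [← mul_pow]
  exact pow_le_pow_left₀ (norm_nonneg _) (hvw j) 2

theorem EuclideanSpace.norm_le_sqrt_card_mul_of_forall_abs_le {n : ℕ}
    {c : ℝ} (hc : 0 ≤ c) (v : EuclideanSpace ℝ (Fin n)) (hv : ∀ j, |v j| ≤ c) :
    ‖v‖ ≤ Real.sqrt n * c := by
  rw [EuclideanSpace.norm_eq]
  apply Real.sqrt_le_iff.2
  refine ⟨by positivity, ?_⟩
  rw [mul_pow, Real.sq_sqrt (by positivity)]
  calc ∑ j, ‖v j‖ ^ 2 ≤ ∑ _j : Fin n, c ^ 2 :=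
        Finset.sum_le_sum fun j _ => pow_le_pow_left₀ (norm_nonneg _) (hv j) 2
    _ = n * c ^ 2 := by simp

theorem EuclideanSpace.norm_ofLp_lt_one_of_mem_interior_cube {ι : Type*} [Fintype ι]
    {x : EuclideanSpace ℝ ι}
    (hx : x ∈ interior {x : EuclideanSpace ℝ ι | ∀ j, |x j| ≤ 1}) :
    ‖WithLp.ofLp x‖ < 1 := by
  have hcube : {x : EuclideanSpace ℝ ι | ∀ j, |x j| ≤ 1} =
      (EuclideanSpace.equiv ι ℝ).toHomeomorph ⁻¹' Metric.closedBall 0 1 := by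
    ext y
    simp [pi_norm_le_iff_of_nonneg]
  rw [hcube, ← Homeomorph.preimage_interior, interior_closedBall _ one_ne_zero] at hx
  exact mem_ball_zero_iff.1 hx

/-- A compact subset of the open cube lies in a strictly smaller concentric cube. -/
theorem EuclideanSpace.exists_forall_abs_le_of_isCompact_subset_interior_cube
    {ι : Type*} [Fintype ι] {K : Set (EuclideanSpace ℝ ι)} (hK : IsCompact K)
    (hsub : K ⊆ interior {x : EuclideanSpace ℝ ι | ∀ j, |x j| ≤ 1}) :
    ∃ r : ℝ, 0 ≤ r ∧ r < 1 ∧ ∀ x ∈ K, ∀ j, |x j| ≤ r := by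
  rcases K.eq_empty_or_nonempty with rfl | hne
  · exact ⟨0, le_rfl, one_pos, by simp⟩
  · obtain ⟨x₀, hx₀, hmax⟩ := hK.exists_isMaxOn hne
      (f := fun x : EuclideanSpace ℝ ι => ‖WithLp.ofLp x‖) (by fun_prop)
    exact ⟨‖WithLp.ofLp x₀‖, norm_nonneg _,
      norm_ofLp_lt_one_of_mem_interior_cube (hsub hx₀),
      fun x hx j => (norm_le_pi_norm (WithLp.ofLp x) j).trans (hmax hx)⟩

theorem abs_clamp_sub_le_of_abs_le_one {t u : ℝ} (hu : |u| ≤ 1) :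
    |min 1 (max (-1) t) - t| ≤ |t - u| := by
  obtain ⟨h₁, h₂⟩ := abs_le.1 hu
  grind

theorem clamp_eq_self_of_abs_le_one {t : ℝ} (ht : |t| ≤ 1) : min 1 (max (-1) t) = t := by
  obtain ⟨h₁, h₂⟩ := abs_le.1 ht
  rw [max_eq_right h₁, min_eq_right h₂]

theorem clamp_sub_clamp_mem_Icc {t u : ℝ} (htu : t ≤ u) :
    min 1 (max (-1) u) - min 1 (max (-1) t) ∈ Set.Icc 0 (u - t) := by
  constructor <;> grind

section ClampComposition

variable {s : ℝ → ℝ} {ε : ℝ}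

theorem comp_clamp_sub_mem_Icc (hd : Differentiable ℝ s) (hε : 0 ≤ ε)
    (h₀ : ∀ t, 0 ≤ deriv s t) (h₁ : ∀ t, deriv s t ≤ 1 + ε) {t u : ℝ} (htu : t ≤ u) :
    s (min 1 (max (-1) u)) - s (min 1 (max (-1) t)) ∈ Set.Icc 0 ((1 + ε) * (u - t)) := by
  obtain ⟨hc₀, hc₁⟩ := clamp_sub_clamp_mem_Icc htu
  have hc := sub_nonneg.1 hc₀
  exact ⟨sub_nonneg.2 (monotone_of_deriv_nonneg hd h₀ hc),
    (image_sub_le_mul_sub_of_deriv_le hd h₁ hc).trans (by gcongr)⟩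

theorem abs_comp_clamp_sub_le (hd : Differentiable ℝ s) (hε : 0 ≤ ε)
    (h₀ : ∀ t, 0 ≤ deriv s t) (h₁ : ∀ t, deriv s t ≤ 1 + ε) (t u : ℝ) :
    |s (min 1 (max (-1) t)) - s (min 1 (max (-1) u))| ≤ (1 + ε) * |t - u| := by
  wlog htu : t ≤ u generalizing t u
  · rw [abs_sub_comm, abs_sub_comm t]
    exact this u t (le_of_not_ge htu)
  obtain ⟨ha, hb⟩ := comp_clamp_sub_mem_Icc hd hε h₀ h₁ htu
  rwa [abs_sub_comm, abs_sub_comm t, abs_of_nonneg ha, abs_of_nonneg (sub_nonneg.2 htu)]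

theorem abs_comp_clamp_sub_id_sub_le (hd : Differentiable ℝ s) (hε : 0 ≤ ε) (hε1 : ε ≤ 1)
    (h₀ : ∀ t, 0 ≤ deriv s t) (h₁ : ∀ t, deriv s t ≤ 1 + ε) (t u : ℝ) :
    |(s (min 1 (max (-1) t)) - t) - (s (min 1 (max (-1) u)) - u)| ≤ |t - u| := by
  wlog htu : t ≤ u generalizing t u
  · rw [abs_sub_comm, abs_sub_comm t]
    exact this u t (le_of_not_ge htu)
  obtain ⟨ha, hb⟩ := comp_clamp_sub_mem_Icc hd hε h₀ h₁ htu
  rw [abs_sub_comm t, abs_of_nonneg (sub_nonneg.2 htu), abs_le]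
  constructor <;> nlinarith [mul_le_mul_of_nonneg_right hε1 (sub_nonneg.2 htu)]

end ClampComposition

/-- If `0 < s' ≤ 1 + ε` with `ε < 1` on `[-r, r]`, then `s - id` is a strict contraction there. -/
theorem exists_lt_one_forall_abs_sub_id_sub_le {s : ℝ → ℝ} {ε r : ℝ} (hs : ContDiff ℝ 1 s)
    (hε : 0 ≤ ε) (hε1 : ε < 1) (hr : 0 ≤ r) (h₀ : ∀ t, |t| ≤ r → 0 < deriv s t)
    (h₁ : ∀ t, deriv s t ≤ 1 + ε) :
    ∃ c : ℝ, 0 ≤ c ∧ c < 1 ∧ ∀ t u : ℝ, |t| ≤ r → |u| ≤ r →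
      |(s t - t) - (s u - u)| ≤ c * |t - u| := by
  have hd : Differentiable ℝ s := hs.differentiable one_ne_zero
  obtain ⟨t₀, ht₀, hmin⟩ := (isCompact_Icc (a := -r) (b := r)).exists_isMinOn
    ⟨0, by simpa using hr⟩ (hs.continuous_deriv le_rfl).continuousOn
  have hpos := h₀ t₀ (abs_le.2 ht₀)
  refine ⟨max ε (1 - deriv s t₀), le_max_of_le_left hε, max_lt hε1 (by linarith), ?_⟩
  intro t u ht hu
  have hder : ∀ x, HasDerivAt (fun y => s y - y) (deriv s x - 1) x := fun x =>
    (hd x).hasDerivAt.sub (hasDerivAt_id x)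
  refine (convex_Icc (-r) r).norm_image_sub_le_of_norm_hasDerivWithin_le
    (fun x _ => (hder x).hasDerivWithinAt) (fun x hx => ?_) (abs_le.1 hu) (abs_le.1 ht)
  have hx' : deriv s t₀ ≤ deriv s x := hmin hx
  rw [Real.norm_eq_abs, abs_le]
  constructor
  · linarith [le_max_right ε (1 - deriv s t₀)]
  · linarith [le_max_left ε (1 - deriv s t₀), h₁ x]

theorem smooth_retraction_onto_cube_estimates (n : ℕ) (hn : 0 < n)
    (Q : Set (EuclideanSpace ℝ (Fin n)))
    (hQ : Q = {x : EuclideanSpace ℝ (Fin n) | ∀ j : Fin n, |x j| ≤ 1})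
    (f : EuclideanSpace ℝ (Fin n) → EuclideanSpace ℝ (Fin n))
    (hf : ∀ (x : EuclideanSpace ℝ (Fin n)) (j : Fin n), f x j = min 1 (max (-1) (x j)))
    (ε : ℝ) (hε0 : 0 < ε) (hε1 : ε < 1)
    (s : ℝ → ℝ) (hs : ContDiff ℝ (⊤ : ℕ∞) s)
    (hs1 : ∀ i : ℕ, 1 ≤ i → iteratedDeriv i s (-1) = 0 ∧ iteratedDeriv i s 1 = 0)
    (hs2 : ∀ t : ℝ, 0 ≤ deriv s t ∧ deriv s t ≤ 1 + ε ∧ |s t - t| ≤ ε)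
    (hs3 : ∀ t : ℝ, t ≠ -1 → t ≠ 1 → 0 < deriv s t)
    (h : EuclideanSpace ℝ (Fin n) → EuclideanSpace ℝ (Fin n))
    (hh : ∀ (x : EuclideanSpace ℝ (Fin n)) (j : Fin n), h x j = s (x j))
    (g : EuclideanSpace ℝ (Fin n) → EuclideanSpace ℝ (Fin n)) (hg : g = h ∘ f) :
    (∀ x : EuclideanSpace ℝ (Fin n), Metric.infDist x Q ≤ ε →
      ‖g x - x‖ ≤ (1 + Real.sqrt n) * ε) ∧
    (∀ x y : EuclideanSpace ℝ (Fin n), ‖g x - g y‖ ≤ (1 + ε) * ‖x - y‖) ∧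
    (∀ x y : EuclideanSpace ℝ (Fin n), ‖(g x - x) - (g y - y)‖ ≤ ‖x - y‖) ∧
    (∀ K : Set (EuclideanSpace ℝ (Fin n)), K ⊆ interior Q → IsCompact K →
      ∃ c : ℝ, 0 ≤ c ∧ c < 1 ∧ ∀ x ∈ K, ∀ y ∈ K,
        ‖(g x - x) - (g y - y)‖ ≤ c * ‖x - y‖) := by
  have hd : Differentiable ℝ s := hs.differentiable (by simp)
  have h₀ : ∀ t, 0 ≤ deriv s t := fun t => (hs2 t).1
  have h₁ : ∀ t, deriv s t ≤ 1 + ε := fun t => (hs2 t).2.1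
  have hgx : ∀ x j, g x j = s (min 1 (max (-1) (x j))) := fun x j => by
    rw [hg, Function.comp_apply, hh, hf]
  refine ⟨fun x hx => ?_, fun x y => ?_, fun x y => ?_, fun K hKQ hK => ?_⟩
  · have hdist : ‖f x - x‖ ≤ ε := by
      refine le_trans ((Metric.le_infDist ⟨0, by simp [hQ]⟩).2 fun y hy => ?_) hx
      rw [hQ] at hy
      rw [dist_eq_norm, ← one_mul ‖x - y‖]
      refine EuclideanSpace.norm_le_mul_norm_of_forall_abs_le zero_le_one _ _ fun j => ?_
      simpa [hf] using abs_clamp_sub_le_of_abs_le_one (t := x j) (hy j)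
    have hmove : ‖g x - f x‖ ≤ Real.sqrt n * ε := by
      refine EuclideanSpace.norm_le_sqrt_card_mul_of_forall_abs_le hε0.le _ fun j => ?_
      simpa [hgx, hf] using (hs2 (min 1 (max (-1) (x j)))).2.2
    linarith [norm_sub_le_norm_sub_add_norm_sub (g x) (f x) x]
  · refine EuclideanSpace.norm_le_mul_norm_of_forall_abs_le (by linarith) _ _ fun j => ?_
    simpa [hgx] using abs_comp_clamp_sub_le hd hε0.le h₀ h₁ (x j) (y j)
  · rw [← one_mul ‖x - y‖]
    refine EuclideanSpace.norm_le_mul_norm_of_forall_abs_le zero_le_one _ _ fun j => ?_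
    simpa [hgx] using abs_comp_clamp_sub_id_sub_le hd hε0.le hε1.le h₀ h₁ (x j) (y j)
  · rw [hQ] at hKQ
    obtain ⟨r, hr0, hr1, hr⟩ :=
      EuclideanSpace.exists_forall_abs_le_of_isCompact_subset_interior_cube hK hKQ
    obtain ⟨c, hc0, hc1, hc⟩ := exists_lt_one_forall_abs_sub_id_sub_le
      (hs.of_le (by exact_mod_cast le_top)) hε0.le hε1 hr0
      (fun t ht => hs3 t (by rintro rfl; norm_num at ht; linarith)
        (by rintro rfl; norm_num at ht; linarith)) h₁
    refine ⟨c, hc0, hc1, fun x hx y hy => ?_⟩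
    refine EuclideanSpace.norm_le_mul_norm_of_forall_abs_le hc0 _ _ fun j => ?_
    have hxj := hr x hx j
    have hyj := hr y hy j
    simpa [hgx, clamp_eq_self_of_abs_le_one (hxj.trans hr1.le),
      clamp_eq_self_of_abs_le_one (hyj.trans hr1.le)] using hc (x j) (y j) hxj hyj
end
end

section
/- Let n ≥ 1 and ε ∈ (0,1), and set Q = [−1,1]ⁿ ⊆ ℝⁿ and Γ = 16√n. There exists a map l : ℝⁿ → ℝⁿ of class C^∞ such that: (a) l(x) = x for every x with dist(x,Q) > ε; (b) l maps the set {x ∈ ℝⁿ : dist(x,Q) ≤ ε/Γ} into Q; (c) the restriction of l to Int Q is a diffeomorphism of Int Q onto Int Q, and for every compact K ⊆ Int Q the restriction of l − id_{ℝⁿ} to K has Lipschitz constant strictly less than 1; (d) the restriction of l − id_{ℝⁿ} to Q has Lipschitz constant at most 1 and the restriction of l to Q has Lipschitz constant at most 1+ε; (e) l is Lipschitz with Lipschitz constant strictly less than Γ; (f) |l(x) − x| ≤ ε for every x ∈ ℝⁿ; (g) dist(l(x),Q) ≤ dist(x,Q) for every x ∈ ℝⁿ. -/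
open Metric Set

noncomputable section

theorem exists_smooth_clamp {η : ℝ} (hη : 0 < η) :
    ∃ f : ℝ → ℝ, ContDiff ℝ (⊤ : ℕ∞) f ∧ (∀ t, 1 ≤ t → f t = 1) ∧ (∀ t, t ≤ -1 → f t = -1) ∧
      (∀ t, |t| < 1 → 0 < deriv f t) ∧
      (∀ s t, s ≤ t → 0 ≤ f t - f s ∧ f t - f s ≤ (1 + η) * (t - s)) ∧
      (∀ r, r < 1 → ∃ m, 0 < m ∧ m ≤ 1 ∧
        ∀ s t, s ≤ t → |s| ≤ r → |t| ≤ r → m * (t - s) ≤ f t - f s) := by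
  obtain ⟨M, hM1, hM⟩ : ∃ M : ℝ, 1 < M ∧ (M - 1) * (1 + η) = M :=
    ⟨1 + 1 / η, by simp [hη], by field_simp; ring⟩
  have hM0 : 0 < M := by linarith
  set σ : ℝ → ℝ := fun t => Real.smoothTransition (M * (1 - t ^ 2))
  have hσs : ContDiff ℝ (⊤ : ℕ∞) σ :=
    Real.smoothTransition.contDiff.comp (by fun_prop)
  have hσc : Continuous σ := hσs.continuous
  have hσi (a b : ℝ) : IntervalIntegrable σ MeasureTheory.volume a b := hσc.intervalIntegrable a b
  have hσ0 (t) : 0 ≤ σ t := Real.smoothTransition.nonneg _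
  have hσ1 (t) : σ t ≤ 1 := Real.smoothTransition.le_one _
  have hσz (t : ℝ) (ht : 1 ≤ t ^ 2) : σ t = 0 :=
    Real.smoothTransition.zero_of_nonpos (by nlinarith)
  have hσpos (t : ℝ) (ht : |t| < 1) : 0 < σ t :=
    Real.smoothTransition.pos_of_pos (mul_pos hM0 (by
      have := (sq_lt_one_iff_abs_lt_one t).2 ht
      linarith))
  set I := ∫ t in (-1 : ℝ)..1, σ t
  set a := 1 - 1 / M with ha
  have hMinv : M * (1 / M) = 1 := by field_simp
  have hMinv0 : 0 < 1 / M := by positivity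
  have hMinv1 : 1 / M < 1 := by rw [div_lt_one hM0]; exact hM1
  have hIle : I ≤ 2 := by
    have := intervalIntegral.integral_mono_on (a := -1) (b := 1) (by norm_num) (hσi _ _)
      (intervalIntegrable_const (c := (1 : ℝ))) (fun t _ => hσ1 t)
    simp at this
    linarith
  have hIge : 2 * a ≤ I := by
    have h1 : ∫ t in (-a)..a, σ t = ∫ t in (-a)..a, (1 : ℝ) := by
      refine intervalIntegral.integral_congr fun t ht => ?_
      rw [uIcc_of_le (by linarith)] at ht
      refine Real.smoothTransition.one_of_one_le ?_
      have h2 : t ^ 2 ≤ a ^ 2 := sq_le_sq' ht.1 ht.2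
      have h3 : 1 / M ≤ 1 - t ^ 2 := by nlinarith
      nlinarith
    have h2 := intervalIntegral.integral_mono_interval (f := σ) (a := -a) (b := a) (c := -1)
      (d := 1) (μ := MeasureTheory.volume)
      (by linarith) (by linarith) (by linarith) (Filter.Eventually.of_forall hσ0) (hσi _ _)
    rw [h1] at h2
    simp at h2
    linarith
  have hI0 : 0 < I := by linarith
  set c := 2 / I with hc
  have hcI : c * I = 2 := by rw [hc]; field_simp
  have hc1 : 1 ≤ c := by rw [hc, one_le_div hI0]; exact hIle
  have hc2 : c ≤ 1 + η := by
    rw [hc, div_le_iff₀ hI0]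
    have h1 : (1 + η) * a = 1 := by
      rw [ha, ← hM]
      have : M - 1 ≠ 0 := by linarith
      field_simp
      nlinarith
    nlinarith
  have hderiv (t) : HasDerivAt (fun t => -1 + c * ∫ u in (-1 : ℝ)..t, σ u) (c * σ t) t :=
    ((hσc.integral_hasStrictDerivAt (-1) t).hasDerivAt.const_mul c).const_add (-1)
  have hsub (s t : ℝ) : (-1 + c * ∫ u in (-1 : ℝ)..t, σ u) - (-1 + c * ∫ u in (-1 : ℝ)..s, σ u)
      = c * ∫ u in s..t, σ u := by
    rw [← intervalIntegral.integral_add_adjacent_intervals (hσi (-1) s) (hσi s t)]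
    ring
  have hzero {s t : ℝ} (h : ∀ u ∈ uIcc s t, 1 ≤ u ^ 2) : ∫ u in s..t, σ u = 0 := by
    rw [intervalIntegral.integral_congr (g := fun _ => 0) fun u hu => hσz u (h u hu)]
    simp
  refine ⟨fun t => -1 + c * ∫ u in (-1 : ℝ)..t, σ u, ?_, ?_, ?_, ?_, ?_, ?_⟩
  · rw [contDiff_infty_iff_deriv]
    refine ⟨fun t => (hderiv t).differentiableAt, ?_⟩
    rw [funext fun t => (hderiv t).deriv]
    exact contDiff_const.mul hσs
  · intro t ht
    have h1 : ∫ u in (1 : ℝ)..t, σ u = 0 := hzero fun u hu => by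
      rw [uIcc_of_le ht] at hu
      nlinarith [hu.1]
    have := hsub 1 t
    rw [h1] at this
    change -1 + c * _ = _
    linarith
  · intro t ht
    have h1 : ∫ u in (-1 : ℝ)..t, σ u = 0 := hzero fun u hu => by
      rw [uIcc_of_ge ht] at hu
      nlinarith [hu.2]
    simp [h1]
  · intro t ht
    rw [(hderiv t).deriv]
    exact mul_pos (by linarith) (hσpos t ht)
  · intro s t hst
    simp only [hsub]
    have h1 := intervalIntegral.integral_nonneg (μ := MeasureTheory.volume) hst fun u _ => hσ0 u
    have h2 := intervalIntegral.integral_mono_on hst (hσi _ _)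
      (intervalIntegrable_const (c := (1 : ℝ))) (fun t _ => hσ1 t)
    simp at h2
    constructor
    · positivity
    · exact mul_le_mul hc2 h2 h1 (by linarith)
  · intro r hr
    rcases lt_or_ge r 0 with hr0 | hr0
    · exact ⟨1, one_pos, le_rfl, fun s t _ hs => by linarith [abs_nonneg s]⟩
    refine ⟨σ r, hσpos r (by rwa [abs_of_nonneg hr0]), hσ1 r, fun s t hst hs ht => ?_⟩
    simp only [hsub]
    have h2 := intervalIntegral.integral_mono_on hst
      (intervalIntegrable_const (c := σ r)) (hσi _ _) (fun u hu => by
        refine Real.smoothTransition.monotone ?_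
        have : u ^ 2 ≤ r ^ 2 := sq_le_sq' (by linarith [hu.1, (abs_le.1 hs).1])
          (by linarith [hu.2, (abs_le.1 ht).2])
        nlinarith)
    simp at h2
    have h1 := intervalIntegral.integral_nonneg (μ := MeasureTheory.volume) hst fun u _ => hσ0 u
    nlinarith

theorem exists_contDiffOn_inverse {f : ℝ → ℝ} (hf : ContDiff ℝ (⊤ : ℕ∞) f)
    (h1 : f 1 = 1) (h2 : f (-1) = -1)
    (hd : ∀ t, |t| < 1 → 0 < deriv f t) :
    ∃ g : ℝ → ℝ, ContDiffOn ℝ (⊤ : ℕ∞) g (Ioo (-1) 1) ∧ MapsTo f (Ioo (-1) 1) (Ioo (-1) 1) ∧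
      MapsTo g (Ioo (-1) 1) (Ioo (-1) 1) ∧ InvOn g f (Ioo (-1) 1) (Ioo (-1) 1) := by
  have hstrict : StrictMonoOn f (Icc (-1) 1) :=
    strictMonoOn_of_deriv_pos (convex_Icc _ _) hf.continuous.continuousOn fun t ht => by
      rw [interior_Icc] at ht
      exact hd t (abs_lt.2 ht)
  have hmaps : MapsTo f (Ioo (-1) 1) (Ioo (-1) 1) := fun t ht => by
    constructor
    · have := hstrict (by simp) (Ioo_subset_Icc_self ht) ht.1
      rwa [h2] at this
    · have := hstrict (Ioo_subset_Icc_self ht) (by simp) ht.2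
      rwa [h1] at this
  have hinj : InjOn f (Ioo (-1) 1) := hstrict.injOn.mono Ioo_subset_Icc_self
  have hsurj : SurjOn f (Ioo (-1) 1) (Ioo (-1) 1) := fun y hy => by
    have := intermediate_value_Ioo (by norm_num : (-1 : ℝ) ≤ 1) hf.continuous.continuousOn
    rw [h1, h2] at this
    exact this hy
  have hinv := (BijOn.mk hmaps hinj hsurj).invOn_invFunOn
  have hgm := hsurj.mapsTo_invFunOn
  refine ⟨Function.invFunOn f (Ioo (-1) 1), fun y hy => ?_, hmaps, hgm, hinv⟩
  refine ContDiffAt.contDiffWithinAt ?_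
  set g := Function.invFunOn f (Ioo (-1) 1)
  have hx := hgm hy
  have hfx : f (g y) = y := hinv.2 hy
  set x := g y
  have hne : deriv f x ≠ 0 := (hd x (abs_lt.2 hx)).ne'
  have hf' := hf.contDiffAt (x := x)
  have hdx : HasFDerivAt f ((ContinuousLinearEquiv.unitsEquivAut ℝ (Units.mk0 _ hne) : ℝ ≃L[ℝ] ℝ) :
      ℝ →L[ℝ] ℝ) x := by
    have h : ((ContinuousLinearEquiv.unitsEquivAut ℝ (Units.mk0 _ hne) : ℝ ≃L[ℝ] ℝ) : ℝ →L[ℝ] ℝ)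
        = ContinuousLinearMap.toSpanSingleton ℝ (deriv f x) := by
      ext; simp
    rw [h]
    exact (hf'.differentiableAt (by simp)).hasDerivAt.hasFDerivAt
  have hloc := hf'.to_localInverse hdx (by simp)
  rw [hfx] at hloc
  have hstr := hf'.hasStrictFDerivAt' hdx (by simp)
  refine hloc.congr_of_eventuallyEq ?_
  have e1 := hstr.eventually_right_inverse
  have e2 := hstr.localInverse_continuousAt.eventually_mem
    (s := Ioo (-1) 1) (by rw [hstr.localInverse_apply_image]; exact Ioo_mem_nhds hx.1 hx.2)
  rw [hfx] at e1 e2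
  filter_upwards [e1, e2] with z hz1 hz2
  have := hinv.1 hz2
  rw [hz1] at this
  exact this

theorem exists_smooth_lipschitz_cutoff {n : ℕ} {Q : Set (EuclideanSpace ℝ (Fin n))}
    {a b r : ℝ} (hr : 0 < r) (hab : a + r < b - r) :
    ∃ φ : EuclideanSpace ℝ (Fin n) → ℝ, ContDiff ℝ (⊤ : ℕ∞) φ ∧
      (∀ x, 0 ≤ φ x ∧ φ x ≤ 1) ∧ (∀ x, infDist x Q ≤ a → φ x = 1) ∧
      (∀ x, b ≤ infDist x Q → φ x = 0) ∧
      ∀ x y, |φ x - φ y| ≤ 1 / (b - a - 2 * r) * ‖x - y‖ := by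
  set L := 1 / (b - a - 2 * r) with hL
  have hpos : 0 < b - a - 2 * r := by linarith
  have hL0 : 0 < L := by positivity
  set u : EuclideanSpace ℝ (Fin n) → ℝ :=
    fun x => max 0 (min 1 (L * (b - r - infDist x Q))) with hu
  have hu0 (x) : 0 ≤ u x := le_max_left _ _
  have hu1 (x) : u x ≤ 1 := max_le zero_le_one (min_le_left _ _)
  have huc : Continuous u := by
    have := continuous_infDist_pt Q
    fun_prop
  have hulip (x y) : |u x - u y| ≤ L * ‖x - y‖ := by
    have h1 : |infDist x Q - infDist y Q| ≤ ‖x - y‖ := by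
      have := (lipschitz_infDist_pt Q).dist_le_mul x y
      simpa [Real.dist_eq, dist_eq_norm] using this
    calc |u x - u y| ≤ |min 1 (L * (b - r - infDist x Q)) - min 1 (L * (b - r - infDist y Q))| := by
          have := abs_max_sub_max_le_max (0 : ℝ) (min 1 (L * (b - r - infDist x Q))) 0
            (min 1 (L * (b - r - infDist y Q)))
          simpa using this
      _ ≤ |L * (b - r - infDist x Q) - L * (b - r - infDist y Q)| := by
          have := abs_min_sub_min_le_max (1 : ℝ) (L * (b - r - infDist x Q)) 1
            (L * (b - r - infDist y Q))
          simpa using this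
      _ = L * |infDist x Q - infDist y Q| := by
          rw [← mul_sub, abs_mul, abs_of_pos hL0, abs_sub_comm]
          congr 2; ring
      _ ≤ _ := by gcongr
  have hnear {x y : EuclideanSpace ℝ (Fin n)} (h : y ∈ ball x r) :
      infDist y Q ≤ infDist x Q + r ∧ infDist x Q ≤ infDist y Q + r := by
    have h1 := mem_ball.1 h
    exact ⟨(infDist_le_infDist_add_dist).trans (by linarith),
      (infDist_le_infDist_add_dist).trans (by rw [dist_comm]; linarith)⟩
  have hone (x) (h : infDist x Q ≤ a + r) : u x = 1 := by
    have : 1 ≤ L * (b - r - infDist x Q) := by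
      rw [hL, div_mul_eq_mul_div, le_div_iff₀ hpos]; linarith
    simp [hu, this]
  have hzero (x) (h : b - r ≤ infDist x Q) : u x = 0 := by
    have : L * (b - r - infDist x Q) ≤ 0 := mul_nonpos_of_nonneg_of_nonpos hL0.le (by linarith)
    exact max_eq_left ((min_le_right _ _).trans this)
  let ρ : ContDiffBump (0 : EuclideanSpace ℝ (Fin n)) := ⟨r / 2, r, by linarith, by linarith⟩
  let μ : MeasureTheory.Measure (EuclideanSpace ℝ (Fin n)) := MeasureTheory.volume
  have hint (x) : MeasureTheory.Integrable (fun t => ρ.normed μ t * u (x - t)) μ := by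
    refine ρ.integrable_normed.mul_bdd (c := 1) (by fun_prop) (.of_forall fun t => ?_)
    rw [Real.norm_eq_abs, abs_of_nonneg (hu0 _)]
    exact hu1 _
  have hconv (x) : MeasureTheory.convolution (ρ.normed μ) u (ContinuousLinearMap.lsmul ℝ ℝ) μ x
      = ∫ t, ρ.normed μ t * u (x - t) ∂μ := by
    simp [MeasureTheory.convolution]
  have hmass := ρ.integral_normed (μ := μ)
  refine ⟨MeasureTheory.convolution (ρ.normed μ) u (ContinuousLinearMap.lsmul ℝ ℝ) μ,
    ?_, fun x => ⟨?_, ?_⟩, fun x hx => ?_, fun x hx => ?_, fun x y => ?_⟩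
  · exact ρ.hasCompactSupport_normed.contDiff_convolution_left _ ρ.contDiff_normed
      huc.locallyIntegrable
  · rw [hconv]
    exact MeasureTheory.integral_nonneg fun t => mul_nonneg (ρ.nonneg_normed t) (hu0 _)
  · rw [hconv, ← hmass]
    exact MeasureTheory.integral_mono (hint x) ρ.integrable_normed fun t =>
      mul_le_of_le_one_right (ρ.nonneg_normed t) (hu1 _)
  · rw [ρ.normed_convolution_eq_right, hone x (by linarith)]
    intro y hy
    rw [hone x (by linarith), hone y (by linarith [(hnear hy).1])]
  · rw [ρ.normed_convolution_eq_right, hzero x (by linarith)]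
    intro y hy
    rw [hzero x (by linarith), hzero y (by linarith [(hnear hy).2])]
  · rw [hconv, hconv, ← MeasureTheory.integral_sub (hint x) (hint y)]
    calc |∫ t, (ρ.normed μ t * u (x - t) - ρ.normed μ t * u (y - t)) ∂μ|
        ≤ ∫ t, ρ.normed μ t * (L * ‖x - y‖) ∂μ := by
          rw [← Real.norm_eq_abs]
          refine MeasureTheory.norm_integral_le_of_norm_le (ρ.integrable_normed.mul_const _)
            (.of_forall fun t => ?_)
          rw [← mul_sub, norm_mul, Real.norm_of_nonneg (ρ.nonneg_normed t), Real.norm_eq_abs]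
          refine mul_le_mul_of_nonneg_left ?_ (ρ.nonneg_normed t)
          simpa using hulip (x - t) (y - t)
      _ = L * ‖x - y‖ := by rw [MeasureTheory.integral_mul_const, hmass, one_mul]

theorem EuclideanSpace.norm_le_mul_norm_of_abs_le {ι : Type*} [Fintype ι]
    {c : ℝ} (hc : 0 ≤ c) {x y : EuclideanSpace ℝ ι} (h : ∀ j, |x j| ≤ c * |y j|) :
    ‖x‖ ≤ c * ‖y‖ := by
  rw [EuclideanSpace.norm_eq, EuclideanSpace.norm_eq]
  refine Real.sqrt_le_iff.2 ⟨by positivity, ?_⟩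
  rw [mul_pow, Real.sq_sqrt (by positivity), Finset.mul_sum]
  refine Finset.sum_le_sum fun j _ => ?_
  rw [← mul_pow]
  exact pow_le_pow_left₀ (norm_nonneg _) (h j) 2

theorem EuclideanSpace.norm_le_sqrt_card_mul {n : ℕ} {c : ℝ} (hc : 0 ≤ c)
    {x : EuclideanSpace ℝ (Fin n)} (h : ∀ j, |x j| ≤ c) : ‖x‖ ≤ √n * c := by
  rw [EuclideanSpace.norm_eq]
  refine Real.sqrt_le_iff.2 ⟨by positivity, ?_⟩
  rw [mul_pow, Real.sq_sqrt (by positivity)]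
  calc ∑ j, ‖x j‖ ^ 2 ≤ ∑ _j : Fin n, c ^ 2 :=
        Finset.sum_le_sum fun j _ => pow_le_pow_left₀ (norm_nonneg _) (h j) 2
    _ = n * c ^ 2 := by simp

theorem EuclideanSpace.interior_setOf_forall_abs_le (n : ℕ) :
    interior {x : EuclideanSpace ℝ (Fin n) | ∀ j, |x j| ≤ 1} = {x | ∀ j, |x j| < 1} := by
  refine Subset.antisymm (fun x hx j => ?_) (interior_maximal (fun x hx j => (hx j).le) ?_)
  · have hopen : IsOpenMap (EuclideanSpace.proj j : EuclideanSpace ℝ (Fin n) →L[ℝ] ℝ) :=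
      ContinuousLinearMap.isOpenMap _ fun t => ⟨EuclideanSpace.single j t, by simp⟩
    have hsub : {x : EuclideanSpace ℝ (Fin n) | ∀ j, |x j| ≤ 1} ⊆
        (EuclideanSpace.proj j : EuclideanSpace ℝ (Fin n) →L[ℝ] ℝ) ⁻¹' Icc (-1) 1 :=
      fun y hy => abs_le.1 (hy j)
    have := interior_mono hsub hx
    rw [← hopen.preimage_interior_eq_interior_preimage (by fun_prop), interior_Icc] at this
    exact abs_lt.2 this
  · simp only [ofPred_forall]
    exact isOpen_iInter_of_finite fun j => isOpen_lt (by fun_prop) continuous_const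

theorem EuclideanSpace.norm_sub_clamp_le_infDist {n : ℕ} (x : EuclideanSpace ℝ (Fin n)) :
    ‖x - WithLp.toLp 2 (fun j => max (-1) (min 1 (x j)))‖ ≤
      infDist x {y : EuclideanSpace ℝ (Fin n) | ∀ j, |y j| ≤ 1} := by
  refine (le_infDist ⟨0, by simp⟩).2 fun y hy => ?_
  rw [dist_eq_norm, ← one_mul ‖x - y‖]
  refine EuclideanSpace.norm_le_mul_norm_of_abs_le zero_le_one fun j => ?_
  have h := abs_le.1 (hy j)
  simp only [PiLp.sub_apply, one_mul]
  rcases le_total (x j) 1 with h1 | h1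
  · rw [min_eq_right h1]
    rcases le_total (x j) (-1) with h2 | h2
    · rw [max_eq_left h2, abs_of_nonpos (by linarith), abs_of_nonpos (by linarith)]
      linarith
    · simp [max_eq_right h2]
  · rw [min_eq_left h1, max_eq_right (by norm_num), abs_of_nonneg (by linarith),
      abs_of_nonneg (by linarith)]
    linarith

theorem exists_abs_le_lt_of_isCompact {n : ℕ} {K : Set (EuclideanSpace ℝ (Fin n))}
    (hK : IsCompact K) (h : ∀ x ∈ K, ∀ j, |x j| < 1) :
    ∃ r < 1, ∀ x ∈ K, ∀ j, |x j| ≤ r := by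
  rcases K.eq_empty_or_nonempty with rfl | hne
  · exact ⟨0, one_pos, by simp⟩
  obtain ⟨z, hz, hmax⟩ := hK.exists_isMaxOn hne
    (f := fun x : EuclideanSpace ℝ (Fin n) => ‖x.ofLp‖) (by fun_prop)
  refine ⟨‖z.ofLp‖, (pi_norm_lt_iff one_pos).2 fun j => h z hz j, fun x hx j => ?_⟩
  exact (norm_le_pi_norm x.ofLp j).trans (hmax hx)

theorem smooth_almost_retraction_onto_cube (n : ℕ) (hn : 0 < n)
    (ε : ℝ) (hε0 : 0 < ε) (hε1 : ε < 1)
    (Q : Set (EuclideanSpace ℝ (Fin n)))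
    (hQ : Q = {x : EuclideanSpace ℝ (Fin n) | ∀ j : Fin n, |x j| ≤ 1})
    (Γ : ℝ) (hΓ : Γ = 16 * Real.sqrt n) :
    ∃ l : EuclideanSpace ℝ (Fin n) → EuclideanSpace ℝ (Fin n),
      ContDiff ℝ (⊤ : ℕ∞) l ∧
      -- (a)
      (∀ x, Metric.infDist x Q > ε → l x = x) ∧
      -- (b)
      (∀ x, Metric.infDist x Q ≤ ε / Γ → l x ∈ Q) ∧
      -- (c)
      (Set.BijOn l (interior Q) (interior Q) ∧
        (∃ linv : EuclideanSpace ℝ (Fin n) → EuclideanSpace ℝ (Fin n),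
          ContDiffOn ℝ (⊤ : ℕ∞) linv (interior Q) ∧
          Set.InvOn linv l (interior Q) (interior Q)) ∧
        (∀ K : Set (EuclideanSpace ℝ (Fin n)), K ⊆ interior Q → IsCompact K →
          ∃ c : ℝ, 0 ≤ c ∧ c < 1 ∧ ∀ x ∈ K, ∀ y ∈ K,
            ‖(l x - x) - (l y - y)‖ ≤ c * ‖x - y‖)) ∧
      -- (d)
      (∀ x ∈ Q, ∀ y ∈ Q, ‖(l x - x) - (l y - y)‖ ≤ ‖x - y‖ ∧
        ‖l x - l y‖ ≤ (1 + ε) * ‖x - y‖) ∧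
      -- (e)
      (∃ c : ℝ, 0 ≤ c ∧ c < Γ ∧ ∀ x y, ‖l x - l y‖ ≤ c * ‖x - y‖) ∧
      -- (f)
      (∀ x, ‖l x - x‖ ≤ ε) ∧
      -- (g)
      (∀ x, Metric.infDist (l x) Q ≤ Metric.infDist x Q) := by
  have hn1 : (1 : ℝ) ≤ √n := Real.one_le_sqrt.2 (by exact_mod_cast hn)
  set δ := ε / Γ with hδ
  have hΓ0 : 16 ≤ Γ := by linarith
  have hδ0 : 0 < δ := by positivity
  have hδε : 16 * δ ≤ ε := by
    have : δ * Γ = ε := by rw [hδ]; field_simp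
    nlinarith
  set η := δ / (2 * √n) with hη
  have hη0 : 0 < η := by positivity
  have hηδ : √n * (2 * η) = δ := by rw [hη]; field_simp
  have hηε : η ≤ ε := by nlinarith
  obtain ⟨f, hf, hf1, hfm1, hfd, hfl, hfc⟩ := exists_smooth_clamp hη0
  obtain ⟨g, hg, hfm, hgm, hinv⟩ :=
    exists_contDiffOn_inverse hf (hf1 1 le_rfl) (hfm1 (-1) le_rfl) hfd
  obtain ⟨φ, hφ, hφ01, hφ1, hφ0, hφl⟩ :=
    exists_smooth_lipschitz_cutoff (Q := Q) (a := δ) (b := ε - δ) hδ0 (by linarith)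
  have hfabs (t : ℝ) : |f t| ≤ 1 := by
    rcases le_total t 1 with h1 | h1
    · rcases le_total t (-1) with h2 | h2
      · simp [hfm1 t h2]
      · have h3 := (hfl t 1 h1).1
        have h4 := (hfl (-1) t h2).1
        rw [hf1 1 le_rfl] at h3
        rw [hfm1 (-1) le_rfl] at h4
        exact abs_le.2 ⟨by linarith, by linarith⟩
    · simp [hf1 t h1]
  have hfclamp (t : ℝ) : |f t - max (-1) (min 1 t)| ≤ 2 * η := by
    rcases le_total t 1 with h1 | h1
    · rw [min_eq_right h1]
      rcases le_total t (-1) with h2 | h2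
      · simp [hfm1 t h2, max_eq_left h2, hη0.le]
      · rw [max_eq_right h2]
        have h3 := (hfl t 1 h1).2
        have h4 := (hfl (-1) t h2).2
        rw [hf1 1 le_rfl] at h3
        rw [hfm1 (-1) le_rfl] at h4
        exact abs_le.2 ⟨by nlinarith, by nlinarith⟩
    · simp [hf1 t h1, min_eq_left h1, hη0.le]
  have hflip (s t : ℝ) : |f s - f t| ≤ (1 + ε) * |s - t| ∧ |(f s - s) - (f t - t)| ≤ |s - t| := by
    wlog h : t ≤ s generalizing s t
    · have := this t s (le_of_not_ge h)
      rw [abs_sub_comm (f s), abs_sub_comm s, abs_sub_comm (f s - s)]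
      exact this
    have := hfl t s h
    rw [abs_of_nonneg this.1, abs_of_nonneg (sub_nonneg.2 h)]
    exact ⟨by nlinarith, abs_le.2 ⟨by linarith, by nlinarith⟩⟩
  set F : EuclideanSpace ℝ (Fin n) → EuclideanSpace ℝ (Fin n) :=
    fun x => WithLp.toLp 2 fun j => f (x j)
  have hFs : ContDiff ℝ (⊤ : ℕ∞) F :=
    contDiff_euclidean.2 fun j => hf.comp (by fun_prop)
  have hFQ (x) : F x ∈ Q := by
    rw [hQ]; exact fun j => hfabs (x j)
  have hFlip (x y) : ‖F x - F y‖ ≤ (1 + ε) * ‖x - y‖ :=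
    EuclideanSpace.norm_le_mul_norm_of_abs_le (by linarith) fun j => (hflip (x j) (y j)).1
  have hFsub (x y) : ‖(F x - x) - (F y - y)‖ ≤ ‖x - y‖ := by
    rw [← one_mul ‖x - y‖]
    refine EuclideanSpace.norm_le_mul_norm_of_abs_le zero_le_one fun j => ?_
    rw [one_mul]
    exact (hflip (x j) (y j)).2
  set p : EuclideanSpace ℝ (Fin n) → EuclideanSpace ℝ (Fin n) :=
    fun x => WithLp.toLp 2 fun j => max (-1) (min 1 (x j))
  have hpQ (x) : p x ∈ Q := by
    rw [hQ]
    exact fun j => abs_le.2 ⟨le_max_left _ _, max_le (by norm_num) (min_le_left _ _)⟩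
  have hpd (x) : ‖x - p x‖ ≤ infDist x Q := by
    rw [hQ]; exact EuclideanSpace.norm_sub_clamp_le_infDist x
  have hFp (x) : ‖F x - p x‖ ≤ δ := by
    rw [← hηδ]
    exact EuclideanSpace.norm_le_sqrt_card_mul (by positivity) fun j => hfclamp (x j)
  have hFx (x) : ‖F x - x‖ ≤ δ + infDist x Q := by
    calc ‖F x - x‖ = ‖(F x - p x) - (x - p x)‖ := by congr 1; abel
      _ ≤ _ := (norm_sub_le _ _).trans (add_le_add (hFp x) (hpd x))
  have hQconv : Convex ℝ Q := by
    rw [hQ]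
    intro x hx y hy a b ha hb hab j
    have h1 := abs_le.1 (hx j)
    have h2 := abs_le.1 (hy j)
    simp only [PiLp.add_apply, PiLp.smul_apply, smul_eq_mul]
    exact abs_le.2 ⟨by nlinarith, by nlinarith⟩
  have hint : interior Q = {x | ∀ j, |x j| < 1} := by
    rw [hQ]; exact EuclideanSpace.interior_setOf_forall_abs_le n
  set l : EuclideanSpace ℝ (Fin n) → EuclideanSpace ℝ (Fin n) :=
    fun x => x + φ x • (F x - x) with hl
  have hlF (x) (hx : infDist x Q ≤ δ) : l x = F x := by simp [hl, hφ1 x hx]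
  have hlQ (x) (hx : x ∈ Q) : l x = F x := hlF x (by rw [infDist_zero_of_mem hx]; exact hδ0.le)
  have hlid (x) (hx : ε - δ ≤ infDist x Q) : l x = x := by simp [hl, hφ0 x hx]
  refine ⟨l, contDiff_id.add (hφ.smul (hFs.sub contDiff_id)), fun x hx => hlid x (by linarith),
    fun x hx => hlF x hx ▸ hFQ x, ⟨?_, ?_, ?_⟩, fun x hx y hy => ?_, ?_, fun x => ?_, fun x => ?_⟩
  · refine BijOn.congr (f₁ := F) ?_ fun x hx => (hlQ x (interior_subset hx)).symm
    rw [hint]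
    refine BijOn.mk (fun x hx j => abs_lt.2 (hfm (abs_lt.1 (hx j)))) (fun x hx y hy h => ?_)
      fun y hy => ⟨WithLp.toLp 2 fun j => g (y j),
        fun j => abs_lt.2 (hgm (abs_lt.1 (hy j))), ?_⟩
    · ext j
      have h1 := congrArg (fun z : EuclideanSpace ℝ (Fin n) => g (z j)) h
      have hx' := hinv.1 (abs_lt.1 (hx j))
      have hy' := hinv.1 (abs_lt.1 (hy j))
      rw [← hx', ← hy']
      exact h1
    · ext j
      exact hinv.2 (abs_lt.1 (hy j))
  · refine ⟨fun y => WithLp.toLp 2 fun j => g (y j), ?_, fun x hx => ?_, fun y hy => ?_⟩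
    · rw [contDiffOn_euclidean, hint]
      exact fun j => hg.comp (t := Ioo (-1) 1) (g := g)
        (f := fun y : EuclideanSpace ℝ (Fin n) => y j)
        (by fun_prop) fun y hy => abs_lt.1 (hy j)
    · rw [hlQ x (interior_subset hx)]
      rw [hint] at hx
      ext j
      exact hinv.1 (abs_lt.1 (hx j))
    · rw [hint] at hy
      rw [hlQ _ (by rw [hQ]; exact fun j => (abs_lt.2 (hgm (abs_lt.1 (hy j)))).le)]
      ext j
      exact hinv.2 (abs_lt.1 (hy j))
  · intro K hKQ hK
    obtain ⟨r, hr, hKr⟩ := exists_abs_le_lt_of_isCompact hK fun x hx j => by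
      have := hKQ hx
      rw [hint] at this
      exact this j
    obtain ⟨m, hm0, hm1, hm⟩ := hfc r hr
    refine ⟨max η (1 - m), by positivity, max_lt (by linarith) (by linarith), fun x hx y hy => ?_⟩
    rw [hlQ x (interior_subset (hKQ hx)), hlQ y (interior_subset (hKQ hy))]
    refine EuclideanSpace.norm_le_mul_norm_of_abs_le (by positivity) fun j => ?_
    change |(f (x j) - x j) - (f (y j) - y j)| ≤ max η (1 - m) * |x j - y j|
    have hxj := hKr x hx j
    have hyj := hKr y hy j
    generalize x j = s at hxj ⊢
    generalize y j = t at hyj ⊢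
    have h1 := le_max_left η (1 - m)
    have h2 := le_max_right η (1 - m)
    wlog h : t ≤ s generalizing s t
    · have := this t hyj s hxj (le_of_not_ge h)
      rwa [abs_sub_comm s, abs_sub_comm (f s - s)]
    have h3 := hfl t s h
    have h4 := hm t s h hyj hxj
    rw [abs_of_nonneg (sub_nonneg.2 h)]
    exact abs_le.2 ⟨by nlinarith, by nlinarith⟩
  · rw [hlQ x hx, hlQ y hy]
    exact ⟨hFsub x y, hFlip x y⟩
  · refine ⟨4, by norm_num, by linarith, fun x y => ?_⟩
    have hnear (x y) (hy : infDist y Q ≤ ε - δ) : ‖l x - l y‖ ≤ 4 * ‖x - y‖ := by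
      have h1 : l x - l y = (x - y) + φ x • ((F x - x) - (F y - y)) +
          (φ x - φ y) • (F y - y) := by
        simp only [hl]; module
      have h2 : ‖φ x • ((F x - x) - (F y - y))‖ ≤ ‖x - y‖ := by
        rw [norm_smul, Real.norm_of_nonneg (hφ01 x).1]
        exact (mul_le_of_le_one_left (norm_nonneg _) (hφ01 x).2).trans (hFsub x y)
      have h3 : ‖(φ x - φ y) • (F y - y)‖ ≤ 2 * ‖x - y‖ := by
        rw [norm_smul, Real.norm_eq_abs]
        calc |φ x - φ y| * ‖F y - y‖
            ≤ 1 / (ε - δ - δ - 2 * δ) * ‖x - y‖ * ε :=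
              mul_le_mul (hφl x y) ((hFx y).trans (by linarith)) (norm_nonneg _)
                ((abs_nonneg _).trans (hφl x y))
          _ = ε / (ε - δ - δ - 2 * δ) * ‖x - y‖ := by ring
          _ ≤ 2 * ‖x - y‖ := by
              gcongr
              rw [div_le_iff₀ (by linarith)]
              linarith
      rw [h1]
      linarith [norm_add₃_le (a := x - y) (b := φ x • ((F x - x) - (F y - y)))
        (c := (φ x - φ y) • (F y - y))]
    rcases le_total (infDist y Q) (ε - δ) with hy | hy
    · exact hnear x y hy
    rcases le_total (infDist x Q) (ε - δ) with hx | hx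
    · rw [norm_sub_rev, norm_sub_rev x]
      exact hnear y x hx
    · rw [hlid x hx, hlid y hy]
      linarith [norm_nonneg (x - y)]
  · rcases le_total (infDist x Q) (ε - δ) with hx | hx
    · have h1 : l x - x = φ x • (F x - x) := by simp [hl]
      rw [h1, norm_smul, Real.norm_of_nonneg (hφ01 x).1]
      exact (mul_le_of_le_one_left (norm_nonneg _) (hφ01 x).2).trans ((hFx x).trans (by linarith))
    · rw [hlid x hx]
      simpa using hε0.le
  · have hmem : (1 - φ x) • p x + φ x • F x ∈ Q :=
      hQconv (hpQ x) (hFQ x) (by linarith [(hφ01 x).2]) (hφ01 x).1 (by ring)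
    refine (infDist_le_dist_of_mem hmem).trans ?_
    have h1 : l x - ((1 - φ x) • p x + φ x • F x) = (1 - φ x) • (x - p x) := by
      simp only [hl]; module
    rw [dist_eq_norm, h1, norm_smul, Real.norm_of_nonneg (by linarith [(hφ01 x).2])]
    exact (mul_le_of_le_one_left (norm_nonneg _) (by linarith [(hφ01 x).1])).trans (hpd x)
end
end

section
/- Let n be a positive integer, Q = [−1,1]ⁿ ⊆ ℝⁿ, and ε ∈ (0,1/4). There exists a constant Γ ∈ (0,∞) depending only on n such that for every a ∈ Int Q there exists a map φ : ℝⁿ∖{a} → ℝⁿ of class C^∞ with the following properties: (1) φ(x) = x for every x with dist(x,Q) ≥ ε; (2) |φ(x) − x| ≤ ε for every x ∈ ℝⁿ∖Q; (3) φ[Q∖{a}] = ∂Q; (4) ‖Dφ(x)‖ ≤ Γ/(2·|x−a|·dist(a, ℝⁿ∖Q)) for every x ∈ Int Q∖{a}; (5) ‖Dφ(x)‖ ≤ Γ and |φ(x) − x| ≤ Γ·(dist(x,∂Q) + ε) for every x ∈ ℝⁿ with dist(x, ∂Q) ≤ min(½·dist(a, ℝⁿ∖Q), ¼); (6) if 0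 < δ < min(½·dist(a, ℝⁿ∖Q), ¼) and x ∈ ℝⁿ satisfies dist(x,∂Q) ≤ δ, then the segment joining x and φ(x) is contained in {z ∈ ℝⁿ : dist(z, ∂Q) ≤ δ}; and (7) dist(φ(x), ∂Q) ≤ dist(x, ∂Q) for every x ∈ ℝⁿ∖{a}. -/
open Metric Set

noncomputable section

/-- `f` is differentiable at `x`, with derivative of operator norm at most `C`. -/
def HasFDerivBoundAt {E F : Type*} [NormedAddCommGroup E] [NormedSpace ℝ E]
    [NormedAddCommGroup F] [NormedSpace ℝ F] (f : E → F) (x : E) (C : ℝ) : Prop :=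
  DifferentiableAt ℝ f x ∧ ‖fderiv ℝ f x‖ ≤ C

namespace HasFDerivBoundAt

variable {E F G : Type*} [NormedAddCommGroup E] [NormedSpace ℝ E]
  [NormedAddCommGroup F] [NormedSpace ℝ F] [NormedAddCommGroup G] [NormedSpace ℝ G]

theorem mono {f : E → F} {x : E} {A B : ℝ} (h : HasFDerivBoundAt f x A) (hAB : A ≤ B) :
    HasFDerivBoundAt f x B := ⟨h.1, h.2.trans hAB⟩

theorem congr {f g : E → F} {x : E} {A : ℝ} (h : HasFDerivBoundAt f x A)
    (hfg : g =ᶠ[nhds x] f) : HasFDerivBoundAt g x A :=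
  ⟨h.1.congr_of_eventuallyEq hfg, by rw [hfg.fderiv_eq]; exact h.2⟩

theorem id (x : E) : HasFDerivBoundAt (fun y : E => y) x 1 :=
  ⟨differentiableAt_id, by
    rw [show (fun y : E => y) = _root_.id from rfl, fderiv_id]
    exact ContinuousLinearMap.norm_id_le⟩

theorem const (c : F) (x : E) : HasFDerivBoundAt (fun _ : E => c) x 0 :=
  ⟨differentiableAt_const c, by simp⟩

theorem add {f g : E → F} {x : E} {A B : ℝ} (hf : HasFDerivBoundAt f x A)
    (hg : HasFDerivBoundAt g x B) : HasFDerivBoundAt (fun y => f y + g y) x (A + B) :=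
  ⟨hf.1.fun_add hg.1, by
    rw [fderiv_fun_add hf.1 hg.1]
    exact (norm_add_le _ _).trans (add_le_add hf.2 hg.2)⟩

theorem sub {f g : E → F} {x : E} {A B : ℝ} (hf : HasFDerivBoundAt f x A)
    (hg : HasFDerivBoundAt g x B) : HasFDerivBoundAt (fun y => f y - g y) x (A + B) :=
  ⟨hf.1.fun_sub hg.1, by
    rw [fderiv_fun_sub hf.1 hg.1]
    exact (norm_sub_le _ _).trans (add_le_add hf.2 hg.2)⟩

theorem smul {c : E → ℝ} {f : E → F} {x : E} {A B : ℝ} (hc : HasFDerivBoundAt c x A)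
    (hf : HasFDerivBoundAt f x B) :
    HasFDerivBoundAt (fun y => c y • f y) x (|c x| * B + A * ‖f x‖) :=
  ⟨hc.1.fun_smul hf.1, by
    rw [fderiv_fun_smul hc.1 hf.1]
    refine (norm_add_le _ _).trans (add_le_add ?_ ?_)
    · rw [norm_smul, Real.norm_eq_abs]
      exact mul_le_mul_of_nonneg_left hf.2 (abs_nonneg _)
    · rw [ContinuousLinearMap.norm_smulRight_apply]
      exact mul_le_mul_of_nonneg_right hc.2 (norm_nonneg _)⟩

theorem comp {g : F → G} {f : E → F} {x : E} {A B : ℝ} (hg : HasFDerivBoundAt g (f x) B)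
    (hf : HasFDerivBoundAt f x A) : HasFDerivBoundAt (fun y => g (f y)) x (B * A) :=
  ⟨hg.1.fun_comp' x hf.1, by
    rw [show (fun y => g (f y)) = g ∘ f from rfl, fderiv_comp x hg.1 hf.1]
    exact (ContinuousLinearMap.opNorm_comp_le _ _).trans
      (mul_le_mul hg.2 hf.2 (norm_nonneg _) ((norm_nonneg _).trans hg.2))⟩

theorem of_deriv {f : ℝ → ℝ} {t C : ℝ} (hf : DifferentiableAt ℝ f t) (h : |deriv f t| ≤ C) :
    HasFDerivBoundAt f t C :=
  ⟨hf, by rwa [← norm_deriv_eq_norm_fderiv, Real.norm_eq_abs]⟩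

theorem of_lipschitz {f : E → F} {x : E} {C : ℝ} (hC : 0 ≤ C) (hf : DifferentiableAt ℝ f x)
    (h : ∀ y z, ‖f y - f z‖ ≤ C * ‖y - z‖) : HasFDerivBoundAt f x C :=
  ⟨hf, norm_fderiv_le_of_lip' ℝ hC (Filter.Eventually.of_forall fun y => h y x)⟩

/-- The radial retraction `y ↦ y / ν y` attached to a Lipschitz gauge `ν`. -/
theorem inv_smul_self {ν : E → ℝ} {x : E} {C : ℝ} (hν : HasFDerivBoundAt ν x C)
    (hpos : 0 < ν x) :
    HasFDerivBoundAt (fun y => (ν y)⁻¹ • y) x ((ν x)⁻¹ * (1 + C * (‖x‖ / ν x))) := by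
  have hinv : HasFDerivBoundAt (fun t : ℝ => t⁻¹) (ν x) ((ν x ^ 2)⁻¹) :=
    of_deriv (differentiableAt_inv hpos.ne') (by
      rw [deriv_inv, abs_neg, abs_of_pos (by positivity)])
  refine ((hinv.comp hν).smul (id x)).mono (le_of_eq ?_)
  rw [abs_of_pos (by positivity)]
  field_simp

end HasFDerivBoundAt

/-- A seminorm squeezed between the supremum norm and `1 + η` times the supremum norm, and smooth
away from the origin. -/
structure IsSmoothSupNorm {n : ℕ} (η : ℝ) (N : Seminorm ℝ (EuclideanSpace ℝ (Fin n))) : Prop where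
  sup_le : ∀ x, ‖x.ofLp‖ ≤ N x
  le_sup : ∀ x, N x ≤ (1 + η) * ‖x.ofLp‖
  contDiffAt : ∀ x, x ≠ 0 → ContDiffAt ℝ (⊤ : ℕ∞) N x

theorem exists_isSmoothSupNorm (n : ℕ) {η : ℝ} (hη : 0 < η) :
    ∃ N : Seminorm ℝ (EuclideanSpace ℝ (Fin n)), IsSmoothSupNorm η N := by
  obtain ⟨m, hm⟩ := exists_nat_gt (n / η)
  set p : ℕ := 2 * (m + 1) with hp
  have hp0 : p ≠ 0 := by omega
  have hp1 : (1 : ℝ) ≤ p := by exact_mod_cast Nat.one_le_iff_ne_zero.2 hp0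
  have hpe : Even p := ⟨m + 1, by omega⟩
  have hbern : (n : ℝ) ≤ (1 + η) ^ p := by
    have h1 := one_add_mul_le_pow (a := η) (by linarith) p
    have h2 : (n : ℝ) < m * η := by rwa [div_lt_iff₀ hη] at hm
    have h3 : (m : ℝ) * η ≤ p * η := by
      gcongr
      omega
    linarith
  have habs : ∀ (x : EuclideanSpace ℝ (Fin n)) i, |x i| ^ (p : ℝ) = x i ^ p := fun x i => by
    rw [Real.rpow_natCast, hpe.pow_abs]
  have hsum0 : ∀ x : EuclideanSpace ℝ (Fin n), 0 ≤ ∑ i, |x i| ^ (p : ℝ) := fun x =>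
    Finset.sum_nonneg fun i _ => by positivity
  let N : Seminorm ℝ (EuclideanSpace ℝ (Fin n)) :=
    Seminorm.of (fun x => (∑ i, |x i| ^ (p : ℝ)) ^ (1 / (p : ℝ)))
      (fun x y => Real.Lp_add_le Finset.univ (fun i => x i) (fun i => y i) hp1)
      (fun c x => by
        have : ∀ i, |(c • x) i| ^ (p : ℝ) = |c| ^ (p : ℝ) * |x i| ^ (p : ℝ) := fun i => by
          rw [PiLp.smul_apply, smul_eq_mul, abs_mul, Real.mul_rpow (abs_nonneg _) (abs_nonneg _)]
        simp_rw [this]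
        rw [← Finset.mul_sum, Real.mul_rpow (by positivity) (hsum0 x),
          ← Real.rpow_mul (abs_nonneg _), mul_one_div_cancel (by positivity),
          Real.rpow_one, Real.norm_eq_abs])
  have hN : ∀ x, N x = (∑ i, |x i| ^ (p : ℝ)) ^ (1 / (p : ℝ)) := fun x => rfl
  have hroot : ∀ t : ℝ, 0 ≤ t → (t ^ p) ^ (1 / (p : ℝ)) = t := fun t ht => by
    rw [one_div, Real.pow_rpow_inv_natCast ht hp0]
  refine ⟨N, fun x => ?_, fun x => ?_, fun x hx => ?_⟩
  · refine (pi_norm_le_iff_of_nonneg (apply_nonneg N x)).2 fun i => ?_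
    rw [hN, Real.norm_eq_abs, ← hroot |x i| (abs_nonneg _)]
    refine Real.rpow_le_rpow (by positivity) ?_ (by positivity)
    rw [← Real.rpow_natCast]
    exact Finset.single_le_sum (f := fun i => |x i| ^ (p : ℝ)) (fun i _ => by positivity)
      (Finset.mem_univ i)
  · rw [hN, ← hroot ((1 + η) * ‖x.ofLp‖) (by positivity)]
    refine Real.rpow_le_rpow (hsum0 x) ?_ (by positivity)
    calc ∑ i, |x i| ^ (p : ℝ) ≤ ∑ _i : Fin n, ‖x.ofLp‖ ^ p := by
          refine Finset.sum_le_sum fun i _ => ?_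
          rw [Real.rpow_natCast]
          exact pow_le_pow_left₀ (abs_nonneg _) (norm_le_pi_norm x.ofLp i) p
      _ = n * ‖x.ofLp‖ ^ p := by simp
      _ ≤ (1 + η) ^ p * ‖x.ofLp‖ ^ p := by gcongr
      _ = _ := (mul_pow _ _ _).symm
  · have hfun : (N : EuclideanSpace ℝ (Fin n) → ℝ) = fun x => (∑ i, x i ^ p) ^ (1 / (p : ℝ)) := by
      funext y
      rw [hN]
      simp_rw [habs]
    rw [hfun]
    refine ContDiffAt.rpow_const_of_ne ?_ ?_
    · fun_prop
    · intro h
      refine hx (PiLp.ext fun i => ?_)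
      have := (Finset.sum_eq_zero_iff_of_nonneg fun i _ => hpe.pow_nonneg (x i)).1 h i
        (Finset.mem_univ i)
      simpa using pow_eq_zero_iff hp0 |>.1 this

namespace IsSmoothSupNorm

variable {n : ℕ} {η : ℝ} {N : Seminorm ℝ (EuclideanSpace ℝ (Fin n))}

theorem pos (hN : IsSmoothSupNorm η N) {x : EuclideanSpace ℝ (Fin n)} (hx : x ≠ 0) : 0 < N x := by
  refine lt_of_lt_of_le (norm_pos_iff.2 fun h => hx ?_) (hN.sup_le x)
  exact PiLp.ext fun i => congrFun h i

theorem abs_apply_le (hN : IsSmoothSupNorm η N) (x : EuclideanSpace ℝ (Fin n)) (i : Fin n) :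
    |x i| ≤ N x := (norm_le_pi_norm x.ofLp i).trans (hN.sup_le x)

end IsSmoothSupNorm

theorem EuclideanSpace.norm_ofLp_le {n : ℕ} (x : EuclideanSpace ℝ (Fin n)) : ‖x.ofLp‖ ≤ ‖x‖ :=
  (pi_norm_le_iff_of_nonneg (norm_nonneg x)).2 fun i => PiLp.norm_apply_le x i

theorem EuclideanSpace.norm_le_card_mul {n : ℕ} {x : EuclideanSpace ℝ (Fin n)} {r : ℝ}
    (hr : 0 ≤ r) (h : ∀ i, |x i| ≤ r) : ‖x‖ ≤ n * r := by
  rw [EuclideanSpace.norm_eq]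
  refine Real.sqrt_le_iff.2 ⟨by positivity, ?_⟩
  calc ∑ i, ‖x i‖ ^ 2 ≤ ∑ _i : Fin n, r ^ 2 :=
        Finset.sum_le_sum fun i _ => pow_le_pow_left₀ (norm_nonneg _) (h i) 2
    _ = n * r ^ 2 := by simp
    _ ≤ (n * r) ^ 2 := by
      rw [mul_pow]
      gcongr
      exact_mod_cast Nat.le_self_pow two_ne_zero n

namespace IsSmoothSupNorm

variable {n : ℕ} {η : ℝ} {N : Seminorm ℝ (EuclideanSpace ℝ (Fin n))}

theorem norm_le (hN : IsSmoothSupNorm η N) (x : EuclideanSpace ℝ (Fin n)) : ‖x‖ ≤ n * N x :=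
  EuclideanSpace.norm_le_card_mul (apply_nonneg N x) (hN.abs_apply_le x)

theorem le_two_mul_norm (hN : IsSmoothSupNorm η N) (hη : η ≤ 1) (x : EuclideanSpace ℝ (Fin n)) :
    N x ≤ 2 * ‖x‖ :=
  (hN.le_sup x).trans (mul_le_mul (by linarith) (EuclideanSpace.norm_ofLp_le x) (norm_nonneg _)
    zero_le_two)

theorem abs_sub_le (hN : IsSmoothSupNorm η N) (hη : η ≤ 1) (x y : EuclideanSpace ℝ (Fin n)) :
    |N x - N y| ≤ 2 * ‖x - y‖ :=
  (abs_sub_map_le_sub N x y).trans (hN.le_two_mul_norm hη _)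

theorem hasFDerivBoundAt (hN : IsSmoothSupNorm η N) (hη : η ≤ 1) {x : EuclideanSpace ℝ (Fin n)}
    (hx : x ≠ 0) : HasFDerivBoundAt N x 2 :=
  .of_lipschitz zero_le_two ((hN.contDiffAt x hx).differentiableAt (by simp))
    fun y z => hN.abs_sub_le hη y z

theorem continuous (hN : IsSmoothSupNorm η N) (hη : η ≤ 1) : Continuous N :=
  (LipschitzWith.of_dist_le_mul (K := 2) fun x y => by
    rw [Real.dist_eq, dist_eq_norm]
    exact hN.abs_sub_le hη x y).continuous

end IsSmoothSupNorm

theorem Real.smoothTransition.deriv_of_nonpos {u : ℝ} (hu : u ≤ 0) :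
    deriv Real.smoothTransition u = 0 :=
  IsLocalMin.deriv_eq_zero <| Filter.Eventually.of_forall fun v => by
    rw [Real.smoothTransition.zero_of_nonpos hu]
    exact Real.smoothTransition.nonneg v

theorem Real.smoothTransition.deriv_of_one_le {u : ℝ} (hu : 1 ≤ u) :
    deriv Real.smoothTransition u = 0 :=
  IsLocalMax.deriv_eq_zero <| Filter.Eventually.of_forall fun v => by
    rw [Real.smoothTransition.one_of_one_le hu]
    exact Real.smoothTransition.le_one v

theorem Real.smoothTransition.exists_abs_deriv_le :
    ∃ L : ℝ, 0 < L ∧ ∀ u, |deriv Real.smoothTransition u| ≤ L := by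
  have hc : Continuous (deriv Real.smoothTransition) :=
    (Real.smoothTransition.contDiff (n := 1)).continuous_deriv_one
  obtain ⟨C, hC⟩ := (isCompact_Icc (a := (0 : ℝ)) (b := 1)).exists_bound_of_continuousOn
    hc.continuousOn
  refine ⟨max C 1, by positivity, fun u => ?_⟩
  rcases le_total u 0 with hu | hu
  · rw [Real.smoothTransition.deriv_of_nonpos hu, abs_zero]
    positivity
  rcases le_total u 1 with hu' | hu'
  · exact (hC u ⟨hu, hu'⟩).trans (le_max_left _ _)
  · rw [Real.smoothTransition.deriv_of_one_le hu', abs_zero]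
    positivity

/-- Smooth increment which raises every `t ∈ [1 - η, 1]` to `1` and vanishes for
`t ≤ 1 - 2 * η`. -/
def edgeLift (η t : ℝ) : ℝ := Real.smoothTransition ((t - (1 - 2 * η)) / η) * (1 - t)

/-- Smooth odd function, `2 * η`-close to the identity on `[-1, 1]`, which is equal to `1` on
`[1 - η, ∞)`. -/
def edgeSnap (η t : ℝ) : ℝ := t + edgeLift η t - edgeLift η (-t)

section edgeSnap

variable {η t : ℝ}

theorem edgeLift_of_le (hη : 0 < η) (ht : t ≤ 1 - 2 * η) : edgeLift η t = 0 := by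
  rw [edgeLift, Real.smoothTransition.zero_of_nonpos, zero_mul]
  exact div_nonpos_of_nonpos_of_nonneg (by linarith) hη.le

theorem edgeLift_of_ge (hη : 0 < η) (ht : 1 - η ≤ t) : edgeLift η t = 1 - t := by
  rw [edgeLift, Real.smoothTransition.one_of_one_le, one_mul]
  rw [le_div_iff₀ hη]
  linarith

theorem edgeLift_nonneg (ht : t ≤ 1) : 0 ≤ edgeLift η t :=
  mul_nonneg (Real.smoothTransition.nonneg _) (by linarith)

theorem edgeLift_le (ht : t ≤ 1) : edgeLift η t ≤ 1 - t :=
  mul_le_of_le_one_left (by linarith) (Real.smoothTransition.le_one _)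

theorem edgeLift_le_two_mul (hη : 0 < η) (ht : t ≤ 1) : edgeLift η t ≤ 2 * η := by
  rcases le_total t (1 - 2 * η) with h | h
  · rw [edgeLift_of_le hη h]
    positivity
  · exact (edgeLift_le ht).trans (by linarith)

theorem contDiff_edgeLift : ContDiff ℝ (⊤ : ℕ∞) (edgeLift η) := by
  have : ContDiff ℝ (⊤ : ℕ∞) (fun t : ℝ => (t - (1 - 2 * η)) / η) := by fun_prop
  exact (Real.smoothTransition.contDiff.comp this).mul (by fun_prop)

theorem contDiff_edgeSnap : ContDiff ℝ (⊤ : ℕ∞) (edgeSnap η) :=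
  (contDiff_id.add contDiff_edgeLift).sub (contDiff_edgeLift.comp contDiff_neg)

theorem abs_deriv_edgeLift_le {L : ℝ} (hL : ∀ u, |deriv Real.smoothTransition u| ≤ L)
    (hη : 0 < η) (t : ℝ) : |deriv (edgeLift η) t| ≤ 2 * L + 1 := by
  set u := (t - (1 - 2 * η)) / η with hu
  have hθ : HasDerivAt Real.smoothTransition (deriv Real.smoothTransition u) u :=
    ((Real.smoothTransition.contDiff (n := 1)).differentiable (by simp) u).hasDerivAt
  have haff : HasDerivAt (fun t : ℝ => (t - (1 - 2 * η)) / η) (1 / η) t :=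
    ((hasDerivAt_id t).sub_const _).div_const η
  have h : HasDerivAt (edgeLift η) (deriv Real.smoothTransition u * (1 / η) * (1 - t) +
      Real.smoothTransition u * -1) t :=
    HasDerivAt.mul (c := fun t => Real.smoothTransition ((t - (1 - 2 * η)) / η))
      (HasDerivAt.comp t (h₂ := Real.smoothTransition) hθ haff) ((hasDerivAt_id t).const_sub 1)
  have h1t : 1 / η * (1 - t) = 2 - u := by
    rw [hu]
    field_simp
    ring
  have hbound : |deriv Real.smoothTransition u * (2 - u)| ≤ 2 * L := by
    rcases le_total u 0 with h0 | h0
    · rw [Real.smoothTransition.deriv_of_nonpos h0]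
      simpa using (abs_nonneg _).trans (hL 0)
    rcases le_total u 1 with h1 | h1
    · rw [abs_mul, mul_comm, abs_of_nonneg (by linarith : 0 ≤ 2 - u)]
      exact mul_le_mul (by linarith) (hL u) (abs_nonneg _) zero_le_two
    · rw [Real.smoothTransition.deriv_of_one_le h1]
      simpa using (abs_nonneg _).trans (hL 0)
  rw [h.deriv]
  calc _ = |deriv Real.smoothTransition u * (2 - u) - Real.smoothTransition u| := by
        congr 1
        rw [← h1t]
        ring
    _ ≤ |deriv Real.smoothTransition u * (2 - u)| + |Real.smoothTransition u| := abs_sub _ _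
    _ ≤ _ := by
      refine add_le_add hbound ?_
      rw [abs_of_nonneg (Real.smoothTransition.nonneg _)]
      exact Real.smoothTransition.le_one _

theorem abs_edgeSnap_sub_le {L : ℝ} (hL : ∀ u, |deriv Real.smoothTransition u| ≤ L)
    (hη : 0 < η) (t u : ℝ) : |edgeSnap η t - edgeSnap η u| ≤ (4 * L + 3) * |t - u| := by
  have hd : Differentiable ℝ (edgeLift η) := contDiff_edgeLift.differentiable (by simp)
  have hlip : ∀ t u, |edgeLift η t - edgeLift η u| ≤ (2 * L + 1) * |t - u| := fun t u =>
    convex_univ.norm_image_sub_le_of_norm_deriv_le (fun x _ => hd x)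
      (fun x _ => abs_deriv_edgeLift_le hL hη x) (mem_univ u) (mem_univ t)
  have h1 := hlip t u
  have h2 := hlip (-t) (-u)
  rw [show -t - -u = -(t - u) by ring, abs_neg] at h2
  have : edgeSnap η t - edgeSnap η u = (t - u) + (edgeLift η t - edgeLift η u)
      - (edgeLift η (-t) - edgeLift η (-u)) := by
    simp only [edgeSnap]
    ring
  rw [this]
  refine (abs_sub _ _).trans ?_
  have := abs_add_le (t - u) (edgeLift η t - edgeLift η u)
  linarith

theorem edgeSnap_neg (η t : ℝ) : edgeSnap η (-t) = -edgeSnap η t := by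
  simp only [edgeSnap, neg_neg]
  ring

theorem edgeSnap_of_ge (hη : 0 < η) (hη' : η ≤ 1 / 4) (ht : 1 - η ≤ t) : edgeSnap η t = 1 := by
  rw [edgeSnap, edgeLift_of_ge hη ht, edgeLift_of_le hη (by linarith)]
  ring

theorem abs_edgeSnap_le (hη : 0 < η) (hη' : η ≤ 1 / 4) (ht : |t| ≤ 1) : |edgeSnap η t| ≤ 1 := by
  wlog h : 0 ≤ t generalizing t
  · rw [← abs_neg, ← edgeSnap_neg]
    exact this (by rwa [abs_neg]) (by linarith)
  have h1 := abs_le.1 ht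
  rw [edgeSnap, edgeLift_of_le (t := -t) hη (by linarith), sub_zero, abs_le]
  have := edgeLift_nonneg (η := η) h1.2
  have := edgeLift_le (η := η) h1.2
  constructor <;> linarith

theorem abs_edgeSnap_sub_self_le (hη : 0 < η) (hη' : η ≤ 1 / 4) (ht : |t| ≤ 1) :
    |edgeSnap η t - t| ≤ 2 * η := by
  wlog h : 0 ≤ t generalizing t
  · rw [← abs_neg, neg_sub', ← edgeSnap_neg]
    exact this (by rwa [abs_neg]) (by linarith)
  have h1 := abs_le.1 ht
  rw [edgeSnap, edgeLift_of_le (t := -t) hη (by linarith), sub_zero, add_sub_cancel_left,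
    abs_of_nonneg (edgeLift_nonneg h1.2)]
  exact edgeLift_le_two_mul hη h1.2

theorem exists_edgeSnap_eq (hη : 0 < η) (hη' : η ≤ 1 / 4) {y : ℝ} (hy : |y| ≤ 1) :
    ∃ t, |t| ≤ 1 ∧ edgeSnap η t = y := by
  have h1 : edgeSnap η 1 = 1 := edgeSnap_of_ge hη hη' (by linarith)
  have h2 : edgeSnap η (-1) = -1 := by rw [edgeSnap_neg, h1]
  have := intermediate_value_Icc (by norm_num : (-1 : ℝ) ≤ 1)
    (contDiff_edgeSnap (η := η)).continuous.continuousOn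
  rw [h1, h2] at this
  obtain ⟨t, ht, hty⟩ := this (abs_le.1 hy)
  exact ⟨t, abs_le.2 ht, hty⟩

theorem abs_edgeSnap_eq_one (hη : 0 < η) (hη' : η ≤ 1 / 4) (ht : 1 - η ≤ |t|) :
    |edgeSnap η t| = 1 := by
  rcases abs_choice t with h | h
  · rw [edgeSnap_of_ge hη hη' (h ▸ ht), abs_one]
  · rw [← abs_neg, ← edgeSnap_neg, edgeSnap_of_ge hη hη' (h ▸ ht), abs_one]

end edgeSnap

/-- Radial rescaling onto the unit sphere of `N`, followed by `edgeSnap` in every coordinate. -/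
def snapRadial {n : ℕ} (η : ℝ) (N : Seminorm ℝ (EuclideanSpace ℝ (Fin n)))
    (y : EuclideanSpace ℝ (Fin n)) : EuclideanSpace ℝ (Fin n) :=
  WithLp.toLp 2 fun i => edgeSnap η (((N y)⁻¹ • y) i)

theorem snapRadial_apply {n : ℕ} (η : ℝ) (N : Seminorm ℝ (EuclideanSpace ℝ (Fin n)))
    (y : EuclideanSpace ℝ (Fin n)) (i : Fin n) :
    snapRadial η N y i = edgeSnap η ((N y)⁻¹ * y i) := rfl

theorem EuclideanSpace.norm_sub_le_of_abs_le {n : ℕ} {x y u v : EuclideanSpace ℝ (Fin n)} {c : ℝ}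
    (hc : 0 ≤ c) (h : ∀ i, |x i - y i| ≤ c * |u i - v i|) : ‖x - y‖ ≤ c * ‖u - v‖ := by
  rw [EuclideanSpace.norm_eq, EuclideanSpace.norm_eq]
  refine Real.sqrt_le_iff.2 ⟨by positivity, ?_⟩
  rw [mul_pow, Real.sq_sqrt (Finset.sum_nonneg fun i _ => by positivity), Finset.mul_sum]
  refine Finset.sum_le_sum fun i _ => ?_
  rw [← mul_pow]
  exact pow_le_pow_left₀ (norm_nonneg _) (h i) 2

namespace IsSmoothSupNorm

variable {n : ℕ} {η : ℝ} {N : Seminorm ℝ (EuclideanSpace ℝ (Fin n))}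

theorem abs_inv_mul_apply_le (hN : IsSmoothSupNorm η N) (y : EuclideanSpace ℝ (Fin n))
    (i : Fin n) : |(N y)⁻¹ * y i| ≤ 1 := by
  rw [abs_mul, abs_inv, abs_of_nonneg (apply_nonneg N y), inv_mul_eq_div]
  exact div_le_one_of_le₀ (hN.abs_apply_le y i) (apply_nonneg N y)

theorem abs_snapRadial_le (hN : IsSmoothSupNorm η N) (hη : 0 < η) (hη' : η ≤ 1 / 4)
    (y : EuclideanSpace ℝ (Fin n)) (i : Fin n) : |snapRadial η N y i| ≤ 1 :=
  abs_edgeSnap_le hη hη' (hN.abs_inv_mul_apply_le y i)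

/-- A coordinate of maximal modulus is sent to its sign. -/
theorem exists_snapRadial_eq_sign (hN : IsSmoothSupNorm η N) (hη : 0 < η) (hη' : η ≤ 1 / 4)
    {y : EuclideanSpace ℝ (Fin n)} (hy : y ≠ 0) :
    ∃ j, |y j| = ‖y.ofLp‖ ∧ snapRadial η N y j = SignType.sign (y j) := by
  have hNy := hN.pos hy
  have hne : Nonempty (Fin n) := by
    by_contra h
    rw [not_nonempty_iff] at h
    exact hy (Subsingleton.elim _ _)
  obtain ⟨j, hj⟩ := Finite.exists_max fun i => |y i|
  have hjy : |y j| = ‖y.ofLp‖ := le_antisymm (norm_le_pi_norm y.ofLp j)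
    ((pi_norm_le_iff_of_nonneg (abs_nonneg _)).2 hj)
  have hle : 1 - η ≤ (N y)⁻¹ * |y j| := by
    rw [hjy, inv_mul_eq_div, le_div_iff₀ hNy]
    have h1 := hN.le_sup y
    have h2 := norm_nonneg y.ofLp
    nlinarith [mul_le_mul_of_nonneg_left h1 (by linarith : 0 ≤ 1 - η), mul_nonneg hη.le h2,
      mul_nonneg (mul_nonneg hη.le hη.le) h2]
  refine ⟨j, hjy, ?_⟩
  rw [snapRadial_apply]
  rcases lt_trichotomy (y j) 0 with h | h | h
  · rw [sign_neg h, ← neg_neg ((N y)⁻¹ * y j), edgeSnap_neg, edgeSnap_of_ge hη hη']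
    · simp
    · rwa [abs_of_neg h, mul_neg] at hle
  · rw [h, abs_zero, mul_zero] at hle
    linarith
  · rw [sign_pos h, edgeSnap_of_ge hη hη']
    · simp
    · rwa [abs_of_pos h] at hle

theorem contDiffAt_snapRadial (hN : IsSmoothSupNorm η N) {y : EuclideanSpace ℝ (Fin n)}
    (hy : y ≠ 0) : ContDiffAt ℝ (⊤ : ℕ∞) (snapRadial η N) y := by
  refine contDiffAt_euclidean.2 fun i => ?_
  have h1 : ContDiffAt ℝ (⊤ : ℕ∞) (fun y => (N y)⁻¹ * y i) y :=
    ((hN.contDiffAt y hy).inv (hN.pos hy).ne').mul (by fun_prop)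
  exact contDiff_edgeSnap.contDiffAt.comp y h1

theorem hasFDerivBoundAt_snapRadial (hN : IsSmoothSupNorm η N) (hη : 0 < η) (hη' : η ≤ 1 / 4)
    {L : ℝ} (hL : ∀ u, |deriv Real.smoothTransition u| ≤ L) {y : EuclideanSpace ℝ (Fin n)}
    (hy : y ≠ 0) :
    HasFDerivBoundAt (snapRadial η N) y ((4 * L + 3) * ((N y)⁻¹ * (1 + 2 * n))) := by
  have hL0 : 0 ≤ L := (abs_nonneg _).trans (hL 0)
  have hpos := hN.pos hy
  have hS : HasFDerivBoundAt (fun z : EuclideanSpace ℝ (Fin n) =>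
      (WithLp.toLp 2 fun i => edgeSnap η (z i) : EuclideanSpace ℝ (Fin n)))
      ((N y)⁻¹ • y) (4 * L + 3) := by
    refine .of_lipschitz (by positivity) ?_ fun u v =>
      EuclideanSpace.norm_sub_le_of_abs_le (by positivity) fun i => abs_edgeSnap_sub_le hL hη _ _
    refine ContDiffAt.differentiableAt (n := (⊤ : ℕ∞)) (contDiffAt_euclidean.2 fun i => ?_)
      (by simp)
    exact contDiff_edgeSnap.contDiffAt.comp (g := edgeSnap η) _ (by fun_prop)
  refine (hS.comp (f := fun y => (N y)⁻¹ • y)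
    ((hN.hasFDerivBoundAt (by linarith) hy).inv_smul_self hpos)).mono ?_
  gcongr
  rw [div_le_iff₀ hpos]
  exact hN.norm_le y

theorem norm_snapRadial_sub_le (hN : IsSmoothSupNorm η N) (hη : 0 < η) (hη' : η ≤ 1 / 4)
    {y : EuclideanSpace ℝ (Fin n)} (hy : y ≠ 0) :
    ‖snapRadial η N y - y‖ ≤ n * (2 * η + |1 - N y|) := by
  have hpos := hN.pos hy
  refine EuclideanSpace.norm_le_card_mul (by positivity) fun i => ?_
  have h1 := abs_edgeSnap_sub_self_le hη hη' (hN.abs_inv_mul_apply_le y i)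
  have h2 : |(N y)⁻¹ * y i - y i| ≤ |1 - N y| := by
    have : (N y)⁻¹ * y i - y i = ((N y)⁻¹ * y i) * (1 - N y) := by
      field_simp
    rw [this, abs_mul]
    exact mul_le_of_le_one_left (abs_nonneg _) (hN.abs_inv_mul_apply_le y i)
  exact (_root_.abs_sub_le _ ((N y)⁻¹ * y i) _).trans (add_le_add h1 h2)

end IsSmoothSupNorm

/-- The cube `[-1, 1]ⁿ` in Euclidean space. -/
def euclideanCube (n : ℕ) : Set (EuclideanSpace ℝ (Fin n)) := {x | ∀ j, |x j| ≤ 1}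

section euclideanCube

variable {n : ℕ} {x z : EuclideanSpace ℝ (Fin n)}

theorem mem_euclideanCube : x ∈ euclideanCube n ↔ ‖x.ofLp‖ ≤ 1 :=
  (pi_norm_le_iff_of_nonneg (x := x.ofLp) zero_le_one).symm

theorem euclideanCube_eq_preimage :
    euclideanCube n = PiLp.homeomorph 2 (fun _ : Fin n => ℝ) ⁻¹' closedBall 0 1 := by
  ext x
  rw [mem_euclideanCube, mem_preimage, mem_closedBall_zero_iff]
  rfl

theorem mem_interior_euclideanCube : x ∈ interior (euclideanCube n) ↔ ‖x.ofLp‖ < 1 := by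
  rw [euclideanCube_eq_preimage, ← Homeomorph.preimage_interior,
    interior_closedBall _ one_ne_zero, mem_preimage, mem_ball_zero_iff]
  rfl

theorem mem_frontier_euclideanCube : x ∈ frontier (euclideanCube n) ↔ ‖x.ofLp‖ = 1 := by
  rw [euclideanCube_eq_preimage, ← Homeomorph.preimage_frontier,
    frontier_closedBall _ one_ne_zero, mem_preimage, mem_sphere_zero_iff_norm]
  rfl

theorem exists_abs_eq_norm_ofLp (hn : 0 < n) (x : EuclideanSpace ℝ (Fin n)) :
    ∃ j, |x j| = ‖x.ofLp‖ := by
  have : Nonempty (Fin n) := ⟨⟨0, hn⟩⟩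
  obtain ⟨j, hj⟩ := Finite.exists_max fun i => |x i|
  exact ⟨j, le_antisymm (norm_le_pi_norm x.ofLp j)
    ((pi_norm_le_iff_of_nonneg (abs_nonneg _)).2 hj)⟩

theorem exists_mem_frontier_norm_sub_le (hn : 0 < n) (hx : ‖x.ofLp‖ ≤ 1) :
    ∃ y ∈ frontier (euclideanCube n), ‖x - y‖ ≤ 1 - ‖x.ofLp‖ := by
  obtain ⟨j, hj⟩ := exists_abs_eq_norm_ofLp hn x
  obtain ⟨σ, hσ, hσx⟩ : ∃ σ : ℝ, |σ| = 1 ∧ |σ - x j| = 1 - |x j| := by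
    rcases le_total 0 (x j) with h | h
    · refine ⟨1, abs_one, ?_⟩
      rw [abs_of_nonneg h] at hj ⊢
      exact abs_of_nonneg (by linarith)
    · refine ⟨-1, by simp, ?_⟩
      rw [abs_of_nonpos h] at hj ⊢
      rw [abs_of_nonpos (by linarith)]
      ring
  refine ⟨x + EuclideanSpace.single j (σ - x j), ?_, ?_⟩
  · rw [mem_frontier_euclideanCube]
    refine le_antisymm ((pi_norm_le_iff_of_nonneg zero_le_one).2 fun i => ?_) ?_
    · by_cases h : i = j
      · subst h
        simp [hσ]
      · simpa [h] using (norm_le_pi_norm x.ofLp i).trans hx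
    · refine le_of_eq_of_le ?_ (norm_le_pi_norm _ j)
      simp [hσ]
  · rw [sub_add_cancel_left, norm_neg, PiLp.norm_single, Real.norm_eq_abs, hσx, hj]

theorem frontier_euclideanCube_nonempty (hn : 0 < n) : (frontier (euclideanCube n)).Nonempty :=
  (exists_mem_frontier_norm_sub_le hn (x := 0) (by simp)).imp fun _ h => h.1

theorem infDist_frontier_le (hn : 0 < n) (hx : ‖x.ofLp‖ ≤ 1) :
    infDist x (frontier (euclideanCube n)) ≤ 1 - ‖x.ofLp‖ := by
  obtain ⟨y, hy, hxy⟩ := exists_mem_frontier_norm_sub_le hn hx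
  exact (infDist_le_dist_of_mem hy).trans ((dist_eq_norm x y).trans_le hxy)

theorem one_sub_norm_le_infDist_frontier (hn : 0 < n) (x : EuclideanSpace ℝ (Fin n)) :
    1 - ‖x.ofLp‖ ≤ infDist x (frontier (euclideanCube n)) := by
  refine (le_infDist (frontier_euclideanCube_nonempty hn)).2 fun y hy => ?_
  rw [mem_frontier_euclideanCube] at hy
  have h1 := EuclideanSpace.norm_ofLp_le (y - x)
  have h2 := norm_sub_norm_le y.ofLp x.ofLp
  rw [dist_comm, dist_eq_norm]
  rw [WithLp.ofLp_sub] at h1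
  linarith

theorem infDist_compl_euclideanCube_le (hn : 0 < n) (hx : ‖x.ofLp‖ ≤ 1) :
    infDist x (euclideanCube n)ᶜ ≤ 1 - ‖x.ofLp‖ := by
  rw [← infDist_closure]
  refine (infDist_le_infDist_of_subset ?_ (frontier_euclideanCube_nonempty hn)).trans
    (infDist_frontier_le hn hx)
  rw [frontier_eq_closure_inter_closure]
  exact inter_subset_right

theorem infDist_compl_euclideanCube_pos (hn : 0 < n) (hx : x ∈ interior (euclideanCube n)) :
    0 < infDist x (euclideanCube n)ᶜ := by
  have hne : (euclideanCube n)ᶜ.Nonempty := by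
    rw [← closure_nonempty_iff]
    refine (frontier_euclideanCube_nonempty hn).mono ?_
    rw [frontier_eq_closure_inter_closure]
    exact inter_subset_right
  refine lt_of_le_of_ne infDist_nonneg fun h => ?_
  have := (mem_closure_iff_infDist_zero hne).2 h.symm
  rw [closure_compl] at this
  exact this hx

theorem infDist_frontier_le_infDist (hz : 1 ≤ ‖z.ofLp‖) :
    infDist z (frontier (euclideanCube n)) ≤ infDist z (euclideanCube n) := by
  rcases hz.eq_or_lt with h | h
  · rw [infDist_zero_of_mem (mem_frontier_euclideanCube.2 h.symm)]
    exact infDist_nonneg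
  · have hne : (euclideanCube n)ᶜ ≠ univ := by
      rw [Ne, compl_univ_iff]
      exact Set.Nonempty.ne_empty ⟨0, mem_euclideanCube.2 (by simp)⟩
    obtain ⟨y, hy, hzy⟩ := exists_mem_frontier_infDist_compl_eq_dist
      (show z ∈ (euclideanCube n)ᶜ from fun hz' => h.not_ge (mem_euclideanCube.1 hz')) hne
    rw [compl_compl] at hzy
    rw [frontier_compl] at hy
    exact (infDist_le_dist_of_mem hy).trans hzy.ge

/-- Moving from `x` towards a point `y` of the cube, without entering its interior, does not
increase the distance to the boundary. -/
theorem infDist_frontier_convexCombination_le (hn : 0 < n) {y : EuclideanSpace ℝ (Fin n)} {s : ℝ}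
    (hs0 : 0 ≤ s) (hs1 : s ≤ 1) (hy : ‖y.ofLp‖ ≤ 1) (hz : 1 ≤ ‖(x + s • (y - x)).ofLp‖) :
    infDist (x + s • (y - x)) (frontier (euclideanCube n)) ≤
      infDist x (frontier (euclideanCube n)) := by
  refine (infDist_frontier_le_infDist hz).trans
    ((le_infDist (frontier_euclideanCube_nonempty hn)).2 fun w hw => ?_)
  rw [mem_frontier_euclideanCube] at hw
  have hmem : w + s • (y - w) ∈ euclideanCube n := by
    rw [mem_euclideanCube, show w + s • (y - w) = (1 - s) • w + s • y by module,
      WithLp.ofLp_add, WithLp.ofLp_smul, WithLp.ofLp_smul]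
    refine (norm_add_le _ _).trans ?_
    rw [norm_smul, norm_smul, Real.norm_of_nonneg hs0, Real.norm_of_nonneg (by linarith), hw]
    nlinarith
  refine (infDist_le_dist_of_mem hmem).trans ?_
  rw [dist_eq_norm, dist_eq_norm,
    show x + s • (y - x) - (w + s • (y - w)) = (1 - s) • (x - w) by module, norm_smul,
    Real.norm_of_nonneg (by linarith)]
  exact mul_le_of_le_one_left (norm_nonneg _) (by linarith)

end euclideanCube

/-- Smooth cutoff which is `1` where `N x ≤ b - w` and `0` where `b ≤ N x`. -/
def radialCutoff {E : Type*} (N : E → ℝ) (b w : ℝ) (x : E) : ℝ :=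
  Real.smoothTransition ((b - N x) / w)

section radialCutoff

variable {E : Type*} {N : E → ℝ} {b w : ℝ} {x : E}

theorem radialCutoff_nonneg : 0 ≤ radialCutoff N b w x := Real.smoothTransition.nonneg _

theorem radialCutoff_le_one : radialCutoff N b w x ≤ 1 := Real.smoothTransition.le_one _

theorem abs_radialCutoff_le_one : |radialCutoff N b w x| ≤ 1 := by
  rw [abs_of_nonneg radialCutoff_nonneg]
  exact radialCutoff_le_one

theorem radialCutoff_of_ge (hw : 0 < w) (hx : b ≤ N x) : radialCutoff N b w x = 0 :=
  Real.smoothTransition.zero_of_nonpos (div_nonpos_of_nonpos_of_nonneg (by linarith) hw.le)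

theorem radialCutoff_of_le (hw : 0 < w) (hx : N x ≤ b - w) : radialCutoff N b w x = 1 :=
  Real.smoothTransition.one_of_one_le ((le_div_iff₀ hw).2 (by linarith))

end radialCutoff

namespace IsSmoothSupNorm

variable {n : ℕ} {η : ℝ} {N : Seminorm ℝ (EuclideanSpace ℝ (Fin n))}

theorem contDiffAt_radialCutoff (hN : IsSmoothSupNorm η N) (hη : η ≤ 1) {b w : ℝ} (hw : 0 < w)
    (hwb : w < b) (x : EuclideanSpace ℝ (Fin n)) :
    ContDiffAt ℝ (⊤ : ℕ∞) (radialCutoff N b w) x := by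
  by_cases hx : x = 0
  · subst hx
    refine (contDiffAt_const (c := (1 : ℝ))).congr_of_eventuallyEq ?_
    have : ∀ᶠ y in nhds (0 : EuclideanSpace ℝ (Fin n)), N y < b - w :=
      (hN.continuous hη).continuousAt.eventually_lt_const (by rw [map_zero]; linarith)
    filter_upwards [this] with y hy
    exact radialCutoff_of_le hw hy.le
  · have h1 : ContDiffAt ℝ (⊤ : ℕ∞) (fun y => (b - N y) / w) x :=
      (contDiffAt_const.sub (hN.contDiffAt x hx)).div_const w
    exact Real.smoothTransition.contDiffAt.comp x h1

theorem hasFDerivBoundAt_radialCutoff (hN : IsSmoothSupNorm η N) (hη : η ≤ 1) {L : ℝ}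
    (hL : ∀ u, |deriv Real.smoothTransition u| ≤ L) {b w : ℝ} (hw : 0 < w)
    (hwb : w < b) (x : EuclideanSpace ℝ (Fin n)) :
    HasFDerivBoundAt (radialCutoff N b w) x (2 * L / w) := by
  have hL0 : 0 ≤ L := (abs_nonneg _).trans (hL 0)
  refine .of_lipschitz (by positivity)
    ((hN.contDiffAt_radialCutoff hη hw hwb x).differentiableAt (by simp)) fun y z => ?_
  have hd : Differentiable ℝ Real.smoothTransition :=
    (Real.smoothTransition.contDiff (n := 1)).differentiable (by simp)
  have h1 : |radialCutoff N b w y - radialCutoff N b w z| ≤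
      L * |(b - N y) / w - (b - N z) / w| :=
    convex_univ.norm_image_sub_le_of_norm_deriv_le (fun x _ => hd x) (fun x _ => hL x)
      (mem_univ _) (mem_univ _)
  refine h1.trans ?_
  rw [← sub_div, abs_div, abs_of_pos hw, show b - N y - (b - N z) = -(N y - N z) by ring, abs_neg]
  calc L * (|N y - N z| / w) ≤ L * (2 * ‖y - z‖ / w) := by
        gcongr
        exact hN.abs_sub_le hη y z
    _ = _ := by ring

end IsSmoothSupNorm

/-- Pushes every point `x` away from `a`, by the distance `3 * n` if `x` lies well inside the unit
ball of `N`, and not at all if `x` is `N`-close to the unit sphere. -/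
def repulse {n : ℕ} (N : Seminorm ℝ (EuclideanSpace ℝ (Fin n))) (d : ℝ)
    (a x : EuclideanSpace ℝ (Fin n)) : EuclideanSpace ℝ (Fin n) :=
  x + radialCutoff N (1 - 3 / 5 * d) (d / 10) x • ((3 * n : ℝ) • (‖x - a‖⁻¹ • (x - a)))

theorem repulse_of_ge {n : ℕ} {N : Seminorm ℝ (EuclideanSpace ℝ (Fin n))} {d : ℝ}
    {a x : EuclideanSpace ℝ (Fin n)} (hd : 0 < d) (hx : 1 - 3 / 5 * d ≤ N x) :
    repulse N d a x = x := by
  rw [repulse, radialCutoff_of_ge (by positivity) hx, zero_smul, add_zero]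

namespace IsSmoothSupNorm

variable {n : ℕ} {η : ℝ} {N : Seminorm ℝ (EuclideanSpace ℝ (Fin n))}

theorem le_apply_repulse (hN : IsSmoothSupNorm η N) (hn : 0 < n) {d : ℝ}
    {a x : EuclideanSpace ℝ (Fin n)} (hd : 0 < d) (hd1 : d ≤ 1) (ha : N a ≤ 1 - 9 / 10 * d)
    (hxa : x ≠ a) : 3 / 10 ≤ N (repulse N d a x) := by
  have hr : 0 < ‖x - a‖ := norm_pos_iff.2 (sub_ne_zero.2 hxa)
  have hn' : (0 : ℝ) < n := by exact_mod_cast hn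
  set χ := radialCutoff N (1 - 3 / 5 * d) (d / 10) x with hχ
  set l := 1 + χ * (3 * n * ‖x - a‖⁻¹) with hl
  have hχ0 : 0 ≤ χ := radialCutoff_nonneg
  have hl1 : 1 ≤ l := le_add_of_nonneg_right (by positivity)
  have hrep : repulse N d a x = a + l • (x - a) := by
    rw [repulse, ← hχ, hl]
    module
  rcases le_or_gt (N x) (1 - 7 / 10 * d) with h | h
  · have hχ1 : χ = 1 := radialCutoff_of_le (by positivity) (by linarith)
    have h1 : ‖l • (x - a)‖ = ‖x - a‖ + 3 * n := by
      rw [norm_smul, Real.norm_of_nonneg (by linarith), hl, hχ1]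
      field_simp
    have h2 := hN.norm_le (l • (x - a))
    have h3 : 3 ≤ N (l • (x - a)) := by
      by_contra! hlt
      nlinarith
    have h4 : N (l • (x - a)) ≤ N (repulse N d a x) + N a := by
      rw [show l • (x - a) = repulse N d a x - a by rw [hrep]; abel]
      exact map_sub_le_add N _ _
    linarith
  · have h1 : l * N x ≤ (l - 1) * N a + N (repulse N d a x) := by
      calc l * N x = N (l • x) := by
            rw [map_smul_eq_mul, Real.norm_of_nonneg (by linarith)]
        _ = N ((l - 1) • a + repulse N d a x) := by
            rw [hrep]
            congr 1
            module
        _ ≤ N ((l - 1) • a) + N (repulse N d a x) := map_add_le_add N _ _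
        _ = _ := by
            rw [map_smul_eq_mul, Real.norm_of_nonneg (by linarith)]
    nlinarith

theorem repulse_ne_zero (hN : IsSmoothSupNorm η N) (hn : 0 < n) {d : ℝ}
    {a x : EuclideanSpace ℝ (Fin n)} (hd : 0 < d) (hd1 : d ≤ 1) (ha : N a ≤ 1 - 9 / 10 * d)
    (hxa : x ≠ a) : repulse N d a x ≠ 0 := fun h => by
  have := hN.le_apply_repulse hn hd hd1 ha hxa
  rw [h, map_zero] at this
  norm_num at this

theorem contDiffAt_repulse (hN : IsSmoothSupNorm η N) (hη : η ≤ 1) {d : ℝ}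
    {a x : EuclideanSpace ℝ (Fin n)} (hd : 0 < d) (hd1 : d ≤ 1) (hxa : x ≠ a) :
    ContDiffAt ℝ (⊤ : ℕ∞) (repulse N d a) x := by
  have hr : x - a ≠ 0 := sub_ne_zero.2 hxa
  have hsub : ContDiffAt ℝ (⊤ : ℕ∞) (fun y => y - a) x := contDiffAt_id.sub contDiffAt_const
  have hinv : ContDiffAt ℝ (⊤ : ℕ∞) (fun y => ‖y - a‖⁻¹) x :=
    (hsub.norm ℝ hr).inv (norm_ne_zero_iff.2 hr)
  exact contDiffAt_id.add ((hN.contDiffAt_radialCutoff hη (by positivity) (by linarith) x).smul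
    ((hinv.smul hsub).const_smul (3 * n : ℝ)))

theorem hasFDerivBoundAt_repulse (hN : IsSmoothSupNorm η N) (hη : η ≤ 1) {L : ℝ}
    (hL : ∀ u, |deriv Real.smoothTransition u| ≤ L) {d : ℝ}
    {a x : EuclideanSpace ℝ (Fin n)} (hd : 0 < d) (hd1 : d ≤ 1) (hxa : x ≠ a) :
    HasFDerivBoundAt (repulse N d a) x (1 + (6 * n * ‖x - a‖⁻¹ + 60 * n * L * d⁻¹)) := by
  have hr : 0 < ‖x - a‖ := norm_pos_iff.2 (sub_ne_zero.2 hxa)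
  have hL0 : 0 ≤ L := (abs_nonneg _).trans (hL 0)
  have hnorm : HasFDerivBoundAt (fun y : EuclideanSpace ℝ (Fin n) => ‖y‖) (x - a) 1 :=
    .of_lipschitz zero_le_one
      ((contDiffAt_norm ℝ (n := 1) (norm_pos_iff.1 hr)).differentiableAt (by simp))
      fun y z => by
        rw [one_mul]
        exact abs_norm_sub_norm_le y z
  have hsub : HasFDerivBoundAt (fun y => y - a) x 1 :=
    ((HasFDerivBoundAt.id x).sub (.const a x)).mono (by norm_num)
  have hunit : HasFDerivBoundAt (fun y => ‖y - a‖⁻¹ • (y - a)) x (2 * ‖x - a‖⁻¹) :=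
    ((hnorm.inv_smul_self hr).comp (f := fun y => y - a) hsub).mono (by
      rw [div_self hr.ne']
      linarith)
  have hχ := hN.hasFDerivBoundAt_radialCutoff hη hL (b := 1 - 3 / 5 * d) (w := d / 10)
    (by positivity) (by linarith) x
  refine ((HasFDerivBoundAt.id x).add
    (hχ.smul ((HasFDerivBoundAt.const (3 * n : ℝ) x).smul hunit))).mono ?_
  refine add_le_add le_rfl (add_le_add ?_ ?_)
  · rw [zero_mul, add_zero, abs_of_nonneg (by positivity : (0 : ℝ) ≤ 3 * n)]
    refine (mul_le_of_le_one_left (by positivity) abs_radialCutoff_le_one).trans (le_of_eq ?_)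
    ring
  · rw [norm_smul, norm_smul, norm_inv, norm_norm, inv_mul_cancel₀ hr.ne',
      Real.norm_of_nonneg (by positivity : (0 : ℝ) ≤ 3 * n)]
    apply le_of_eq
    field_simp
    ring

end IsSmoothSupNorm

theorem ne_zero_of_norm_ofLp_pos {n : ℕ} {x : EuclideanSpace ℝ (Fin n)}
    (hx : 0 < ‖x.ofLp‖) : x ≠ 0 := by
  rintro rfl
  simp at hx

theorem exists_eq_add_smul_of_mem_segment {E : Type*} [AddCommGroup E] [Module ℝ E]
    {x y z : E} {r : ℝ} (hr0 : 0 ≤ r) (hr1 : r ≤ 1) (hz : z ∈ segment ℝ x (x + r • (y - x))) :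
    ∃ s : ℝ, 0 ≤ s ∧ s ≤ 1 ∧ z = x + s • (y - x) := by
  rw [segment_eq_image'] at hz
  obtain ⟨t, ⟨ht0, ht1⟩, rfl⟩ := hz
  refine ⟨t * r, by positivity, mul_le_one₀ ht1 hr0 hr1, ?_⟩
  module

/-- The smoothed projection of the cube from the point `a` onto the boundary of the cube. -/
def cubeProjection {n : ℕ} (η : ℝ) (N : Seminorm ℝ (EuclideanSpace ℝ (Fin n))) (d : ℝ)
    (a x : EuclideanSpace ℝ (Fin n)) : EuclideanSpace ℝ (Fin n) :=
  x + radialCutoff N (1 + 2 * η) η x • (snapRadial η N (repulse N d a x) - x)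

theorem cubeProjection_of_le {n : ℕ} {N : Seminorm ℝ (EuclideanSpace ℝ (Fin n))} {η d : ℝ}
    {a x : EuclideanSpace ℝ (Fin n)} (hη : 0 < η) (hx : N x ≤ 1 + η) :
    cubeProjection η N d a x = snapRadial η N (repulse N d a x) := by
  rw [cubeProjection, radialCutoff_of_le hη (by linarith), one_smul, add_sub_cancel]

theorem cubeProjection_of_ge {n : ℕ} {N : Seminorm ℝ (EuclideanSpace ℝ (Fin n))} {η d : ℝ}
    {a x : EuclideanSpace ℝ (Fin n)} (hη : 0 < η) (hx : 1 + 2 * η ≤ N x) :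
    cubeProjection η N d a x = x := by
  rw [cubeProjection, radialCutoff_of_ge hη hx, zero_smul, add_zero]

namespace IsSmoothSupNorm

variable {n : ℕ} {η : ℝ} {N : Seminorm ℝ (EuclideanSpace ℝ (Fin n))} {d : ℝ}
  {a x : EuclideanSpace ℝ (Fin n)}

theorem apply_le_of_norm_ofLp_le_one (hN : IsSmoothSupNorm η N) (hη : 0 < η)
    (hx : ‖x.ofLp‖ ≤ 1) : N x ≤ 1 + η :=
  (hN.le_sup x).trans (mul_le_of_le_one_right (by linarith) hx)

theorem contDiffAt_cubeProjection (hN : IsSmoothSupNorm η N) (hn : 0 < n) (hη : 0 < η)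
    (hη' : η ≤ 1 / 4) (hd : 0 < d) (hd1 : d ≤ 1) (ha : N a ≤ 1 - 9 / 10 * d) (hxa : x ≠ a) :
    ContDiffAt ℝ (⊤ : ℕ∞) (cubeProjection η N d a) x := by
  have h1 := hN.contDiffAt_repulse (by linarith) hd hd1 hxa
  have h2 := (hN.contDiffAt_snapRadial (hN.repulse_ne_zero hn hd hd1 ha hxa)).comp x h1
  exact contDiffAt_id.add
    ((hN.contDiffAt_radialCutoff (by linarith) hη (by linarith) x).smul (h2.sub contDiffAt_id))

theorem norm_ofLp_snapRadial_le (hN : IsSmoothSupNorm η N) (hη : 0 < η) (hη' : η ≤ 1 / 4)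
    (y : EuclideanSpace ℝ (Fin n)) : ‖(snapRadial η N y).ofLp‖ ≤ 1 :=
  (pi_norm_le_iff_of_nonneg zero_le_one).2 (hN.abs_snapRadial_le hη hη' y)

theorem snapRadial_mem_frontier (hN : IsSmoothSupNorm η N) (hη : 0 < η) (hη' : η ≤ 1 / 4)
    {y : EuclideanSpace ℝ (Fin n)} (hy : y ≠ 0) :
    snapRadial η N y ∈ frontier (euclideanCube n) := by
  rw [mem_frontier_euclideanCube]
  refine le_antisymm (hN.norm_ofLp_snapRadial_le hη hη' y) ?_
  obtain ⟨j, hj, hjs⟩ := hN.exists_snapRadial_eq_sign hη hη' hy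
  have hyj : y j ≠ 0 := fun h => hy (by
    rw [h, abs_zero] at hj
    exact PiLp.ext fun i => congrFun (norm_eq_zero.1 hj.symm) i)
  refine le_of_eq_of_le ?_ (norm_le_pi_norm (snapRadial η N y).ofLp j)
  rw [hjs, Real.norm_eq_abs]
  rcases hyj.lt_or_gt with h | h <;> simp [h]

/-- Moving from `x` towards `snapRadial η N x` increases the largest coordinate. -/
theorem le_norm_ofLp_add_smul (hN : IsSmoothSupNorm η N) (hη : 0 < η) (hη' : η ≤ 1 / 4)
    (hx : x ≠ 0) {s : ℝ} (hs0 : 0 ≤ s) (hs1 : s ≤ 1) :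
    (1 - s) * ‖x.ofLp‖ + s ≤ ‖(x + s • (snapRadial η N x - x)).ofLp‖ := by
  obtain ⟨j, hj, hjs⟩ := hN.exists_snapRadial_eq_sign hη hη' hx
  have hxj : x j ≠ 0 := fun h => hx (by
    rw [h, abs_zero] at hj
    exact PiLp.ext fun i => congrFun (norm_eq_zero.1 hj.symm) i)
  refine le_of_eq_of_le ?_ (norm_le_pi_norm (x + s • (snapRadial η N x - x)).ofLp j)
  rw [Real.norm_eq_abs, ← hj]
  simp only [PiLp.add_apply, PiLp.smul_apply, PiLp.sub_apply, smul_eq_mul, hjs]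
  rcases hxj.lt_or_gt with h | h
  · rw [sign_neg h, abs_of_neg h, SignType.coe_neg_one, abs_of_nonpos]
    · ring
    · nlinarith
  · rw [sign_pos h, abs_of_pos h, SignType.coe_one, abs_of_nonneg]
    · ring
    · nlinarith

theorem exists_snapRadial_eq (hN : IsSmoothSupNorm η N) (hn : 0 < n) (hη : 0 < η)
    (hη' : η ≤ 1 / 4) {y : EuclideanSpace ℝ (Fin n)} (hy : y ∈ frontier (euclideanCube n)) :
    ∃ x ∈ frontier (euclideanCube n), snapRadial η N x = y := by
  rw [mem_frontier_euclideanCube] at hy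
  have hyi : ∀ i, |y i| ≤ 1 := fun i => (norm_le_pi_norm y.ofLp i).trans hy.le
  choose t ht hty using fun i => exists_edgeSnap_eq hη hη' (hyi i)
  let w : ℝ → EuclideanSpace ℝ (Fin n) := fun r =>
    WithLp.toLp 2 fun i => if |y i| = 1 then r * y i else t i
  have hw : Continuous w := by
    refine (PiLp.continuous_toLp 2 _).comp (continuous_pi fun i => ?_)
    split_ifs <;> fun_prop
  have hwi : ∀ r i, w r i = if |y i| = 1 then r * y i else t i := fun r i => rfl
  have hle : ∀ r, 1 - η ≤ r → r ≤ 1 → ‖(w r).ofLp‖ ≤ r := fun r hr hr1 => by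
    refine (pi_norm_le_iff_of_nonneg (by linarith)).2 fun i => ?_
    rw [hwi, Real.norm_eq_abs]
    split_ifs with h
    · rw [abs_mul, h, mul_one, abs_of_nonneg (by linarith)]
    · by_contra! hlt
      exact h (by rw [← hty i]; exact abs_edgeSnap_eq_one hη hη' (by linarith))
  obtain ⟨j, hj⟩ := exists_abs_eq_norm_ofLp hn y
  rw [hy] at hj
  have hge : ∀ r, 0 ≤ r → r ≤ ‖(w r).ofLp‖ := fun r hr => by
    refine le_of_eq_of_le ?_ (norm_le_pi_norm (w r).ofLp j)
    rw [hwi, if_pos hj, Real.norm_eq_abs, abs_mul, hj, mul_one, abs_of_nonneg hr]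
  have hivt := intermediate_value_Icc (by linarith : 1 - η ≤ 1)
    ((hN.continuous (by linarith)).comp hw).continuousOn
  obtain ⟨r, ⟨hr, hr1⟩, hNr⟩ := hivt (show (1 : ℝ) ∈ _ by
    constructor
    · refine (hN.le_sup _).trans ?_
      have := hle (1 - η) le_rfl (by linarith)
      nlinarith
    · exact (hge 1 zero_le_one).trans (hN.sup_le _))
  have hrpos : 0 < r := by linarith
  have hnorm : ‖(w r).ofLp‖ = r := le_antisymm (hle r hr hr1) (hge r hrpos.le)
  refine ⟨r⁻¹ • w r, ?_, PiLp.ext fun i => ?_⟩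
  · rw [mem_frontier_euclideanCube, WithLp.ofLp_smul, norm_smul, hnorm,
      Real.norm_of_nonneg (by positivity), inv_mul_cancel₀ hrpos.ne']
  · have hNr' : N (r⁻¹ • w r) = r⁻¹ := by
      rw [map_smul_eq_mul, Real.norm_of_nonneg (by positivity), show N (w r) = 1 from hNr, mul_one]
    rw [snapRadial_apply, hNr', PiLp.smul_apply, smul_eq_mul, inv_inv,
      mul_inv_cancel_left₀ hrpos.ne',
      hwi]
    split_ifs with h
    · rcases abs_choice (y i) with h' | h'
      · rw [← h', h, edgeSnap_of_ge hη hη' (by linarith)]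
      · rw [h] at h'
        rw [show y i = -1 by linarith, mul_neg_one, edgeSnap_neg,
          edgeSnap_of_ge hη hη' (by linarith)]
    · exact hty i

end IsSmoothSupNorm

namespace IsSmoothSupNorm

variable {n : ℕ} {η : ℝ} {N : Seminorm ℝ (EuclideanSpace ℝ (Fin n))} {d L : ℝ}
  {a x : EuclideanSpace ℝ (Fin n)}

theorem hasFDerivBoundAt_snapRadial_of_ge (hN : IsSmoothSupNorm η N) (hη : 0 < η)
    (hη' : η ≤ 1 / 4) (hL : ∀ u, |deriv Real.smoothTransition u| ≤ L) (hx : 3 / 10 ≤ N x) :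
    HasFDerivBoundAt (snapRadial η N) x ((4 * L + 3) * (4 * (1 + 2 * n))) := by
  have hL0 : 0 ≤ L := (abs_nonneg _).trans (hL 0)
  have hx0 : x ≠ 0 := by
    rintro rfl
    norm_num [map_zero] at hx
  refine (hN.hasFDerivBoundAt_snapRadial hη hη' hL hx0).mono ?_
  gcongr
  refine inv_le_of_inv_le₀ (by norm_num) ?_
  linarith

/-- The derivative bound away from the boundary, singular at the centre of projection. -/
theorem hasFDerivBoundAt_cubeProjection_of_lt (hN : IsSmoothSupNorm η N) (hn : 0 < n) (hη : 0 < η)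
    (hη' : η ≤ 1 / 4) (hL : ∀ u, |deriv Real.smoothTransition u| ≤ L) (hd : 0 < d) (hd1 : d ≤ 1)
    (ha : N a ≤ 1 - 9 / 10 * d) (hxa : x ≠ a) (hx : N x < 1 + η) :
    HasFDerivBoundAt (cubeProjection η N d a) x ((4 * L + 3) * (4 * (1 + 2 * n)) *
      (1 + (6 * n * ‖x - a‖⁻¹ + 60 * n * L * d⁻¹))) := by
  refine ((hN.hasFDerivBoundAt_snapRadial_of_ge hη hη' hL
    (hN.le_apply_repulse hn hd hd1 ha hxa)).comp
    (hN.hasFDerivBoundAt_repulse (by linarith) hL hd hd1 hxa)).congr ?_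
  have : ∀ᶠ y in nhds x, N y < 1 + η :=
    (hN.continuous (by linarith)).continuousAt.eventually_lt_const hx
  filter_upwards [this] with y hy
  exact cubeProjection_of_le hη hy.le

theorem norm_snapRadial_sub_le_of_mem_Icc (hN : IsSmoothSupNorm η N) (hη : 0 < η)
    (hη' : η ≤ 1 / 4) (hx : 1 ≤ N x) (hx' : N x ≤ 1 + 2 * η) :
    ‖snapRadial η N x - x‖ ≤ 4 * n * η := by
  have hx0 : x ≠ 0 := by
    rintro rfl
    norm_num [map_zero] at hx
  refine (hN.norm_snapRadial_sub_le hη hη' hx0).trans ?_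
  rw [abs_of_nonpos (by linarith)]
  calc (n : ℝ) * (2 * η + -(1 - N x)) ≤ n * (2 * η + 2 * η) := by
        gcongr
        linarith
    _ = _ := by ring

/-- The derivative bound near the boundary and outside of the cube. -/
theorem hasFDerivBoundAt_cubeProjection_of_gt (hN : IsSmoothSupNorm η N) (hη : 0 < η)
    (hη' : η ≤ 1 / 4) (hL : ∀ u, |deriv Real.smoothTransition u| ≤ L) (hd : 0 < d) (hd1 : d ≤ 1)
    (hx : 1 - 3 / 5 * d < N x) :
    HasFDerivBoundAt (cubeProjection η N d a) x
      ((4 * L + 3) * (4 * (1 + 2 * n)) + 2 + 8 * n * L) := by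
  have hL0 : 0 ≤ L := (abs_nonneg _).trans (hL 0)
  have hcont : ContinuousAt N x := (hN.continuous (by linarith)).continuousAt
  have hS := hN.hasFDerivBoundAt_snapRadial_of_ge hη hη' hL (x := x) (by linarith)
  have hloc : ∀ᶠ y in nhds x, repulse N d a y = y := by
    filter_upwards [hcont.eventually_const_lt hx] with y hy
    exact repulse_of_ge hd hy.le
  rcases lt_or_ge (N x) (1 + η) with h1 | h1
  · refine (hS.congr ?_).mono ?_
    · filter_upwards [hloc, hcont.eventually_lt_const h1] with y hy hy'
      rw [cubeProjection_of_le hη hy'.le, hy]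
    · have : 0 ≤ 8 * n * L := by positivity
      linarith
  rcases lt_or_ge (1 + 2 * η) (N x) with h2 | h2
  · refine ((HasFDerivBoundAt.id x).congr ?_).mono ?_
    · filter_upwards [hcont.eventually_const_lt h2] with y hy
      exact cubeProjection_of_ge hη hy.le
    · have : 0 ≤ (4 * L + 3) * (4 * (1 + 2 * n)) := by positivity
      have : 0 ≤ 8 * n * L := by positivity
      linarith
  · have hρ := hN.hasFDerivBoundAt_radialCutoff (by linarith) hL hη
      (by linarith : η < 1 + 2 * η) x
    refine (((HasFDerivBoundAt.id x).add
      (hρ.smul (hS.sub (HasFDerivBoundAt.id x)))).congr ?_).mono ?_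
    · filter_upwards [hloc] with y hy
      rw [cubeProjection, hy]
    · have e1 : |radialCutoff N (1 + 2 * η) η x| * ((4 * L + 3) * (4 * (1 + 2 * n)) + 1) ≤
          (4 * L + 3) * (4 * (1 + 2 * n)) + 1 :=
        mul_le_of_le_one_left (by positivity) abs_radialCutoff_le_one
      have e2 : 2 * L / η * ‖snapRadial η N x - x‖ ≤ 8 * n * L := by
        calc 2 * L / η * ‖snapRadial η N x - x‖ ≤ 2 * L / η * (4 * n * η) := by
              gcongr
              exact hN.norm_snapRadial_sub_le_of_mem_Icc hη hη' (by linarith) h2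
          _ = _ := by
              field_simp
              ring
      linarith

theorem norm_cubeProjection_sub_le (hN : IsSmoothSupNorm η N) (hη : 0 < η) (hη' : η ≤ 1 / 4)
    (hd : 0 < d) (hx : 1 ≤ N x) : ‖cubeProjection η N d a x - x‖ ≤ 4 * n * η := by
  rcases le_total (1 + 2 * η) (N x) with h | h
  · rw [cubeProjection_of_ge hη h, sub_self, norm_zero]
    positivity
  · rw [cubeProjection, repulse_of_ge hd (by linarith), add_sub_cancel_left, norm_smul,
      Real.norm_of_nonneg radialCutoff_nonneg]
    exact (mul_le_of_le_one_left (norm_nonneg _) radialCutoff_le_one).trans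
      (hN.norm_snapRadial_sub_le_of_mem_Icc hη hη' hx h)

theorem segment_cubeProjection_subset (hN : IsSmoothSupNorm η N) (hn : 0 < n) (hη : 0 < η)
    (hη' : η ≤ 1 / 4) (hd : 0 < d) {δ : ℝ} (hδd : δ ≤ 3 / 5 * d) (hδ1 : δ < 1)
    (hx : infDist x (frontier (euclideanCube n)) ≤ δ) :
    segment ℝ x (cubeProjection η N d a x) ⊆
      {z | infDist z (frontier (euclideanCube n)) ≤ δ} := by
  intro z hz
  have hxsup := one_sub_norm_le_infDist_frontier hn x
  have hNx := hN.sup_le x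
  have hx0 : x ≠ 0 := ne_zero_of_norm_ofLp_pos (by linarith)
  rw [cubeProjection, repulse_of_ge hd (by linarith)] at hz
  obtain ⟨s, hs0, hs1, rfl⟩ :=
    exists_eq_add_smul_of_mem_segment radialCutoff_nonneg radialCutoff_le_one hz
  have hge := hN.le_norm_ofLp_add_smul hη hη' hx0 hs0 hs1
  have hsnap := hN.norm_ofLp_snapRadial_le hη hη' x
  rcases le_total 1 ‖x.ofLp‖ with h | h
  · exact (infDist_frontier_convexCombination_le hn hs0 hs1 hsnap (by nlinarith)).trans hx
  · have hle : ‖(x + s • (snapRadial η N x - x)).ofLp‖ ≤ 1 := by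
      rw [show x + s • (snapRadial η N x - x) = (1 - s) • x + s • snapRadial η N x by module,
        WithLp.ofLp_add, WithLp.ofLp_smul, WithLp.ofLp_smul]
      refine (norm_add_le _ _).trans ?_
      rw [norm_smul, norm_smul, Real.norm_of_nonneg hs0, Real.norm_of_nonneg (by linarith)]
      nlinarith
    exact (infDist_frontier_le hn hle).trans (by nlinarith)

theorem infDist_cubeProjection_le (hN : IsSmoothSupNorm η N) (hn : 0 < n) (hη : 0 < η)
    (hη' : η ≤ 1 / 4) (hd : 0 < d) (hd1 : d ≤ 1) (ha : N a ≤ 1 - 9 / 10 * d) (hxa : x ≠ a) :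
    infDist (cubeProjection η N d a x) (frontier (euclideanCube n)) ≤
      infDist x (frontier (euclideanCube n)) := by
  rcases le_total ‖x.ofLp‖ 1 with h | h
  · rw [cubeProjection_of_le hη (hN.apply_le_of_norm_ofLp_le_one hη h), infDist_zero_of_mem
      (hN.snapRadial_mem_frontier hη hη' (hN.repulse_ne_zero hn hd hd1 ha hxa))]
    exact infDist_nonneg
  · have hx0 : x ≠ 0 := ne_zero_of_norm_ofLp_pos (by linarith)
    have hNx := hN.sup_le x
    rw [cubeProjection, repulse_of_ge hd (by linarith)]
    have hs0 : 0 ≤ radialCutoff N (1 + 2 * η) η x := radialCutoff_nonneg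
    have hs1 : radialCutoff N (1 + 2 * η) η x ≤ 1 := radialCutoff_le_one
    have hge := hN.le_norm_ofLp_add_smul hη hη' hx0 hs0 hs1
    exact infDist_frontier_convexCombination_le hn hs0 hs1 (hN.norm_ofLp_snapRadial_le hη hη' x)
      (by nlinarith)

theorem image_cubeProjection (hN : IsSmoothSupNorm η N) (hn : 0 < n) (hη : 0 < η)
    (hη' : η ≤ 1 / 4) (hd : 0 < d) (hd1 : d ≤ 1) (ha : N a ≤ 1 - 9 / 10 * d) :
    cubeProjection η N d a '' (euclideanCube n \ {a}) = frontier (euclideanCube n) := by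
  have heq : ∀ x, ‖x.ofLp‖ ≤ 1 → cubeProjection η N d a x = snapRadial η N (repulse N d a x) :=
    fun x hx => cubeProjection_of_le hη (hN.apply_le_of_norm_ofLp_le_one hη hx)
  refine Subset.antisymm ?_ fun y hy => ?_
  · rintro _ ⟨x, ⟨hx, hxa⟩, rfl⟩
    rw [heq x (mem_euclideanCube.1 hx)]
    exact hN.snapRadial_mem_frontier hη hη' (hN.repulse_ne_zero hn hd hd1 ha hxa)
  · obtain ⟨x, hx, rfl⟩ := hN.exists_snapRadial_eq hn hη hη' hy
    rw [mem_frontier_euclideanCube] at hx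
    have hNx := hN.sup_le x
    refine ⟨x, ⟨mem_euclideanCube.2 hx.le, ?_⟩, ?_⟩
    · rintro rfl
      linarith
    · rw [heq x hx.le, repulse_of_ge hd (by linarith)]

end IsSmoothSupNorm

theorem infDist_euclideanCube_le {n : ℕ} {x : EuclideanSpace ℝ (Fin n)} {t : ℝ} (ht : 0 ≤ t)
    (hx : ‖x.ofLp‖ ≤ 1 + t) : infDist x (euclideanCube n) ≤ n * t := by
  have hmem : (1 + t)⁻¹ • x ∈ euclideanCube n := by
    rw [mem_euclideanCube, WithLp.ofLp_smul, norm_smul, Real.norm_of_nonneg (by positivity),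
      inv_mul_le_one₀ (by positivity)]
    exact hx
  refine (infDist_le_dist_of_mem hmem).trans ?_
  rw [dist_eq_norm, show x - (1 + t)⁻¹ • x = t • (1 + t)⁻¹ • x by
    have h : t * (1 + t)⁻¹ = 1 - (1 + t)⁻¹ := by
      field_simp
      ring
    rw [smul_smul, h, sub_smul, one_smul], norm_smul, Real.norm_of_nonneg ht, mul_comm]
  exact mul_le_mul_of_nonneg_right
    ((EuclideanSpace.norm_le_card_mul zero_le_one hmem).trans_eq (mul_one _)) ht

theorem smooth_pointed_cube_projection (n : ℕ) (hn : 0 < n)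
    (Q : Set (EuclideanSpace ℝ (Fin n)))
    (hQ : Q = {x : EuclideanSpace ℝ (Fin n) | ∀ j : Fin n, |x j| ≤ 1}) :
    ∃ Γ : ℝ, 0 < Γ ∧
      ∀ ε : ℝ, 0 < ε → ε < 1 / 4 →
      ∀ a ∈ interior Q,
        ∃ φ : EuclideanSpace ℝ (Fin n) → EuclideanSpace ℝ (Fin n),
          ContDiffOn ℝ (⊤ : ℕ∞) φ {a}ᶜ ∧
          -- (1)
          (∀ x, ε ≤ Metric.infDist x Q → φ x = x) ∧
          -- (2)
          (∀ x ∉ Q, ‖φ x - x‖ ≤ ε) ∧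
          -- (3)
          φ '' (Q \ {a}) = frontier Q ∧
          -- (4)
          (∀ x ∈ interior Q \ {a},
            ‖fderiv ℝ φ x‖ ≤ Γ / (2 * ‖x - a‖ * Metric.infDist a Qᶜ)) ∧
          -- (5)
          (∀ x : EuclideanSpace ℝ (Fin n),
            Metric.infDist x (frontier Q) ≤ min (Metric.infDist a Qᶜ / 2) (1 / 4) →
              ‖fderiv ℝ φ x‖ ≤ Γ ∧
              ‖φ x - x‖ ≤ Γ * (Metric.infDist x (frontier Q) + ε)) ∧
          -- (6)
          (∀ (x : EuclideanSpace ℝ (Fin n)) (δ : ℝ), 0 < δ →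
            δ < min (Metric.infDist a Qᶜ / 2) (1 / 4) →
            Metric.infDist x (frontier Q) ≤ δ →
            segment ℝ x (φ x) ⊆
              {z : EuclideanSpace ℝ (Fin n) | Metric.infDist z (frontier Q) ≤ δ}) ∧
          -- (7)
          (∀ x : EuclideanSpace ℝ (Fin n), x ≠ a →
            Metric.infDist (φ x) (frontier Q) ≤ Metric.infDist x (frontier Q)) := by
  obtain rfl : Q = euclideanCube n := hQ
  obtain ⟨L, hLpos, hL⟩ := Real.smoothTransition.exists_abs_deriv_le
  have hn1 : (1 : ℝ) ≤ n := by exact_mod_cast hn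
  set C : ℝ := (4 * L + 3) * (4 * (1 + 2 * n)) with hC
  have hCpos : 0 < C := by positivity
  set Γ : ℝ := 2 * C * (8 * n + 120 * n ^ 2 * L) + (C + 2 + 8 * n * L) + n with hΓ
  have hΓ4 : 2 * C * (8 * n + 120 * n ^ 2 * L) ≤ Γ := by
    have : 0 ≤ C + 2 + 8 * n * L := by positivity
    linarith
  have hΓ5 : C + 2 + 8 * n * L ≤ Γ := by
    have : 0 ≤ 2 * C * (8 * n + 120 * n ^ 2 * L) := by positivity
    linarith
  have hΓn : (n : ℝ) ≤ Γ := by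
    have : 0 ≤ 2 * C * (8 * n + 120 * n ^ 2 * L) := by positivity
    have : 0 ≤ C + 2 + 8 * n * L := by positivity
    linarith
  refine ⟨Γ, by positivity, fun ε hε hε4 a ha => ?_⟩
  have ha1 : ‖a.ofLp‖ < 1 := mem_interior_euclideanCube.1 ha
  have had := infDist_compl_euclideanCube_le hn ha1.le
  have hd := infDist_compl_euclideanCube_pos hn ha
  set d := infDist a (euclideanCube n)ᶜ
  have hd1 : d ≤ 1 := by linarith [norm_nonneg a.ofLp]
  obtain ⟨η, hη, hηε, hηd⟩ : ∃ η : ℝ, 0 < η ∧ 4 * n * η ≤ ε ∧ η ≤ d / 10 := by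
    refine ⟨min (ε / (4 * n)) (d / 10), by positivity, ?_, min_le_right _ _⟩
    rw [← le_div_iff₀' (by positivity)]
    exact min_le_left _ _
  have hη' : η ≤ 1 / 4 := by linarith
  have hηε' : 4 * η ≤ ε := by nlinarith
  obtain ⟨N, hN⟩ := exists_isSmoothSupNorm n hη
  have haN : N a ≤ 1 - 9 / 10 * d := by
    have := hN.le_sup a
    nlinarith
  have hout : ∀ x, 1 ≤ ‖x.ofLp‖ → ‖cubeProjection η N d a x - x‖ ≤ ε := fun x hx =>
    (hN.norm_cubeProjection_sub_le hη hη' hd (hx.trans (hN.sup_le x))).trans hηε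
  refine ⟨cubeProjection η N d a, ?_, ?_, ?_, hN.image_cubeProjection hn hη hη' hd hd1 haN,
    ?_, ?_, ?_, ?_⟩
  · exact fun x hx =>
      (hN.contDiffAt_cubeProjection hn hη hη' hd hd1 haN hx).contDiffWithinAt
  · intro x hx
    refine cubeProjection_of_ge hη (le_trans ?_ (hN.sup_le x))
    by_contra! hlt
    have := infDist_euclideanCube_le (by positivity) hlt.le
    linarith
  · intro x hx
    rw [mem_euclideanCube, not_le] at hx
    exact hout x hx.le
  · rintro x ⟨hx, hxa⟩
    have hx1 : ‖x.ofLp‖ < 1 := mem_interior_euclideanCube.1 hx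
    have hr : 0 < ‖x - a‖ := norm_pos_iff.2 (sub_ne_zero.2 hxa)
    have hr2 : ‖x - a‖ ≤ n * 2 := EuclideanSpace.norm_le_card_mul zero_le_two fun i => by
      have h1 := (norm_le_pi_norm x.ofLp i).trans hx1.le
      have h2 := (norm_le_pi_norm a.ofLp i).trans ha1.le
      rw [Real.norm_eq_abs] at h1 h2
      have h3 : |x i - a i| ≤ |x i| + |a i| := abs_sub _ _
      exact h3.trans (by linarith)
    refine (hN.hasFDerivBoundAt_cubeProjection_of_lt hn hη hη' hL hd hd1 haN hxa
      ((hN.le_sup x).trans_lt (by nlinarith))).2.trans ?_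
    rw [le_div_iff₀ (by positivity), ← hC]
    refine le_trans ?_ hΓ4
    have e : C * (1 + (6 * n * ‖x - a‖⁻¹ + 60 * n * L * d⁻¹)) * (2 * ‖x - a‖ * d) =
        2 * C * (‖x - a‖ * d + 6 * n * d + 60 * n * L * ‖x - a‖) := by
      field_simp
      ring
    rw [e]
    gcongr 2 * C * ?_
    have e1 : ‖x - a‖ * d ≤ n * 2 := by nlinarith
    have e2 : 6 * n * d ≤ 6 * n := mul_le_of_le_one_right (by positivity) hd1
    have e3 : 60 * n * L * ‖x - a‖ ≤ 60 * n * L * (n * 2) := by gcongr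
    linarith
  · intro x hx
    have hxd := hx.trans (min_le_left _ _)
    have hx4 := hx.trans (min_le_right _ _)
    have hsup := one_sub_norm_le_infDist_frontier hn x
    have hNx := hN.sup_le x
    set t := infDist x (frontier (euclideanCube n))
    have ht : 0 ≤ t := infDist_nonneg
    refine ⟨(hN.hasFDerivBoundAt_cubeProjection_of_gt hη hη' hL hd hd1 (by linarith)).2.trans hΓ5,
      le_trans ?_ (mul_le_mul_of_nonneg_right hΓn (by positivity))⟩
    rcases le_total 1 ‖x.ofLp‖ with h | h
    · exact (hout x h).trans (by nlinarith)
    · have hN1 := hN.apply_le_of_norm_ofLp_le_one hη h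
      rw [cubeProjection_of_le hη hN1, repulse_of_ge hd (by linarith)]
      refine (hN.norm_snapRadial_sub_le hη hη' (ne_zero_of_norm_ofLp_pos (by linarith))).trans ?_
      refine mul_le_mul_of_nonneg_left ?_ (by positivity)
      have : |1 - N x| ≤ t + η := abs_le.2 ⟨by linarith, by linarith⟩
      linarith
  · intro x δ _ hδ hx
    have h1 := hδ.trans_le (min_le_left _ _)
    have h2 := hδ.trans_le (min_le_right _ _)
    exact hN.segment_cubeProjection_subset hn hη hη' hd (by linarith) (by linarith) hx
  · exact fun x hxa => hN.infDist_cubeProjection_le hn hη hη' hd hd1 haN hxa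
end
end

section
/- Let m, n, N be positive integers, let S ⊆ ℝⁿ be a countable union of compact sets with ℋ^m(S ∩ K) < ∞ for every compact K ⊆ ℝⁿ, let g : ℝⁿ → ℝ^N be of class C¹, and let f : ℝ^N → [0,∞) be a Borel function. Then ∫ f d(ℋ^m ⌞ g[S]) ≤ ∫_S f(g(x))·‖Dg(x)‖^m dℋ^m(x), where ℋ^m denotes the m-dimensional Hausdorff measure (on ℝ^N on the left and on ℝⁿ on the right) and ℋ^m ⌞ A denotes its restriction to the set A. -/
open Metric Set MeasureTheory

noncomputable section

open scoped ENNReal NNReal Topology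

/-- An outer measure that is locally dominated by a measure on measurable sets is dominated by it
on all measurable sets. -/
theorem outerMeasure_le_measure_of_locally_le {X : Type*} [TopologicalSpace X]
    [SecondCountableTopology X] [MeasurableSpace X] [OpensMeasurableSpace X]
    (θ : OuterMeasure X) (ν : Measure X)
    (h : ∀ x, ∃ U ∈ 𝓝 x, ∀ A ⊆ U, MeasurableSet A → θ A ≤ ν A)
    {A : Set X} (hA : MeasurableSet A) : θ A ≤ ν A := by
  rcases isEmpty_or_nonempty X with hX | hX
  · simp [Set.eq_empty_of_isEmpty A]
  choose U hU hUle using h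
  obtain ⟨s, hs, hcover⟩ :=
    TopologicalSpace.countable_cover_nhds (f := fun x => interior (U x))
      fun x => interior_mem_nhds.2 (hU x)
  have hne : s.Nonempty := by
    rcases s.eq_empty_or_nonempty with rfl | hne
    · rw [biUnion_empty] at hcover
      exact absurd hcover empty_ne_univ
    · exact hne
  obtain ⟨e, rfl⟩ := hs.exists_eq_range hne
  set V : ℕ → Set X := fun i => interior (U (e i)) with hV
  have hVcover : ⋃ i, V i = univ := by simpa [hV, biUnion_range] using hcover
  have hVmeas : ∀ i, MeasurableSet (disjointed V i) :=
    MeasurableSet.disjointed fun i => isOpen_interior.measurableSet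
  have hAeq : A = ⋃ i, A ∩ disjointed V i := by
    rw [← inter_iUnion, iUnion_disjointed, hVcover, inter_univ]
  calc θ A = θ (⋃ i, A ∩ disjointed V i) := by rw [← hAeq]
    _ ≤ ∑' i, θ (A ∩ disjointed V i) := measure_iUnion_le _
    _ ≤ ∑' i, ν (A ∩ disjointed V i) := ENNReal.tsum_le_tsum fun i =>
        hUle (e i) _ (inter_subset_right.trans ((disjointed_subset V i).trans interior_subset))
          (hA.inter (hVmeas i))
    _ = ν (⋃ i, A ∩ disjointed V i) :=
        (measure_iUnion (fun i j hij => (disjoint_disjointed V hij).mono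
          inter_subset_right inter_subset_right) fun i => hA.inter (hVmeas i)).symm
    _ = ν A := by rw [← hAeq]

section

variable {E F : Type*} [NormedAddCommGroup E] [NormedSpace ℝ E] [MeasurableSpace E] [BorelSpace E]
  [SecondCountableTopology E] [NormedAddCommGroup F] [NormedSpace ℝ F] [MeasurableSpace F]
  [BorelSpace F]

theorem hausdorffMeasure_image_le_lintegral_add (m : ℕ) {g : E → F} (hg : ContDiff ℝ 1 g)
    {ε : ℝ≥0} (hε : 0 < ε) {A : Set E} (hA : MeasurableSet A) :
    μH[(m : ℝ)] (g '' A) ≤ ∫⁻ x in A, (‖fderiv ℝ g x‖ₑ + ε) ^ m ∂μH[(m : ℝ)] := by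
  have hcont : Continuous (fderiv ℝ g) := hg.continuous_fderiv one_ne_zero
  rw [← withDensity_apply _ hA]
  refine outerMeasure_le_measure_of_locally_le
    (OuterMeasure.comap g (μH[(m : ℝ)] : Measure F).toOuterMeasure) _ (fun x => ?_) hA
  have hε2 : (0 : ℝ) < ε / 2 := by positivity
  obtain ⟨r, hr, hball⟩ := Metric.continuousAt_iff.1 hcont.continuousAt (ε / 2 : ℝ) hε2
  refine ⟨ball x r, ball_mem_nhds x hr, fun B hB hBm => ?_⟩
  have hclose : ∀ y ∈ ball x r, ‖fderiv ℝ g y - fderiv ℝ g x‖ < ε / 2 := fun y hy => by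
    simpa [dist_eq_norm] using hball hy
  have hlip : LipschitzOnWith (‖fderiv ℝ g x‖₊ + ε / 2) g (ball x r) := by
    refine (convex_ball x r).lipschitzOnWith_of_nnnorm_fderiv_le
      (fun y _ => hg.differentiable one_ne_zero y) fun y hy => ?_
    rw [← NNReal.coe_le_coe]
    push_cast
    have := norm_sub_norm_le (fderiv ℝ g y) (fderiv ℝ g x)
    linarith [hclose y hy]
  rw [withDensity_apply _ hBm]
  calc μH[(m : ℝ)] (g '' B)
      ≤ ((‖fderiv ℝ g x‖₊ + ε / 2 : ℝ≥0) : ℝ≥0∞) ^ (m : ℝ) * μH[(m : ℝ)] B :=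
        (hlip.mono hB).hausdorffMeasure_image_le m.cast_nonneg
    _ = ∫⁻ _ in B, ((‖fderiv ℝ g x‖₊ + ε / 2 : ℝ≥0) : ℝ≥0∞) ^ m ∂μH[(m : ℝ)] := by
        rw [setLIntegral_const, ENNReal.rpow_natCast]
    _ ≤ ∫⁻ y in B, (‖fderiv ℝ g y‖ₑ + ε) ^ m ∂μH[(m : ℝ)] := by
        refine setLIntegral_mono' hBm fun y hy => ?_
        gcongr
        rw [enorm_eq_nnnorm, ← ENNReal.coe_add, ENNReal.coe_le_coe, ← NNReal.coe_le_coe]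
        push_cast
        have := norm_sub_norm_le (fderiv ℝ g x) (fderiv ℝ g y)
        rw [norm_sub_rev] at this
        linarith [hclose y (hB hy)]

theorem hausdorffMeasure_image_le_lintegral_of_bounded (m : ℕ) {g : E → F} (hg : ContDiff ℝ 1 g)
    {A : Set E} (hA : MeasurableSet A) (hAfin : μH[(m : ℝ)] A ≠ ∞) {C : ℝ≥0}
    (hC : ∀ x ∈ A, ‖fderiv ℝ g x‖ₑ ≤ C) :
    μH[(m : ℝ)] (g '' A) ≤ ∫⁻ x in A, ‖fderiv ℝ g x‖ₑ ^ m ∂μH[(m : ℝ)] := by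
  have hcont : Continuous (fderiv ℝ g) := hg.continuous_fderiv one_ne_zero
  obtain ⟨u, hu_anti, hu_pos, hu⟩ := exists_seq_strictAnti_tendsto (0 : ℝ≥0)
  refine ge_of_tendsto'
    (f := fun k => ∫⁻ x in A, (‖fderiv ℝ g x‖ₑ + u k) ^ m ∂μH[(m : ℝ)]) (x := Filter.atTop) ?_
    fun k => hausdorffMeasure_image_le_lintegral_add m hg (hu_pos k) hA
  refine tendsto_lintegral_of_dominated_convergence (fun _ => ((C : ℝ≥0∞) + u 0) ^ m)
    (fun k => ?_) (fun k => ?_) ?_ ?_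
  · exact ((hcont.enorm.add continuous_const).measurable.pow_const m)
  · refine (ae_restrict_iff' hA).2 (.of_forall fun x hx => ?_)
    exact pow_le_pow_left' (add_le_add (hC x hx)
      (ENNReal.coe_le_coe.2 (hu_anti.antitone k.zero_le))) m
  · rw [setLIntegral_const]
    exact ENNReal.mul_ne_top (by finiteness) hAfin
  · refine .of_forall fun x => ?_
    have := (ENNReal.continuous_pow m).continuousAt.tendsto.comp
      ((tendsto_const_nhds (x := ‖fderiv ℝ g x‖ₑ)).add (ENNReal.tendsto_coe.2 hu))
    simpa [Function.comp_def] using this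

theorem hausdorffMeasure_image_inter_le_lintegral [ProperSpace E] (m : ℕ) {g : E → F}
    (hg : ContDiff ℝ 1 g) {S : Set E} (hS : MeasurableSet S)
    (hSfin : ∀ K : Set E, IsCompact K → μH[(m : ℝ)] (S ∩ K) < ∞)
    {A : Set E} (hA : MeasurableSet A) :
    μH[(m : ℝ)] (g '' (A ∩ S)) ≤ ∫⁻ x in A ∩ S, ‖fderiv ℝ g x‖ₑ ^ m ∂μH[(m : ℝ)] := by
  have hcont : Continuous (fderiv ℝ g) := hg.continuous_fderiv one_ne_zero
  rw [← Measure.restrict_restrict hA, ← withDensity_apply _ hA]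
  refine (OuterMeasure.restrict_apply S A
    (OuterMeasure.comap g (μH[(m : ℝ)] : Measure F).toOuterMeasure)).symm.trans_le
    (outerMeasure_le_measure_of_locally_le _ _ (fun x => ?_) hA)
  obtain ⟨C, hC⟩ := (isCompact_closedBall x 1).exists_bound_of_continuousOn hcont.continuousOn
  refine ⟨closedBall x 1, closedBall_mem_nhds x one_pos, fun B hB hBm => ?_⟩
  rw [withDensity_apply _ hBm, Measure.restrict_restrict hBm, OuterMeasure.restrict_apply]
  refine hausdorffMeasure_image_le_lintegral_of_bounded m hg (hBm.inter hS) (C := C.toNNReal)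
    (ne_top_of_le_ne_top (hSfin _ (isCompact_closedBall x 1)).ne (measure_mono ?_)) fun y hy => ?_
  · exact fun y hy => ⟨hy.2, hB hy.1⟩
  · rw [← ofReal_norm]
    exact ENNReal.ofReal_le_ofReal (hC y (hB hy.1))

end

theorem image_measure_estimate (m n N : ℕ) (hm : 0 < m) (hn : 0 < n) (hN : 0 < N)
    (S : Set (EuclideanSpace ℝ (Fin n)))
    (hS : ∃ F : ℕ → Set (EuclideanSpace ℝ (Fin n)),
      (∀ i, IsCompact (F i)) ∧ S = ⋃ i, F i)
    (hSfin : ∀ K : Set (EuclideanSpace ℝ (Fin n)), IsCompact K → μH[(m : ℝ)] (S ∩ K) < ⊤)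
    (g : EuclideanSpace ℝ (Fin n) → EuclideanSpace ℝ (Fin N))
    (hg : ContDiff ℝ 1 g)
    (f : EuclideanSpace ℝ (Fin N) → ℝ) (hf : Measurable f) (hf0 : ∀ y, 0 ≤ f y) :
    ∫⁻ y, ENNReal.ofReal (f y) ∂(μH[(m : ℝ)].restrict (g '' S)) ≤
      ∫⁻ x in S, ENNReal.ofReal (f (g x) * ‖fderiv ℝ g x‖ ^ m) ∂μH[(m : ℝ)] := by
  have hSm : MeasurableSet S := by
    obtain ⟨F, hF, rfl⟩ := hS
    exact .iUnion fun i => (hF i).measurableSet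
  have hgm : Measurable g := hg.continuous.measurable
  have hdens : Measurable fun x => ‖fderiv ℝ g x‖ₑ ^ m :=
    (hg.continuous_fderiv one_ne_zero).enorm.measurable.pow_const m
  have hfm : Measurable fun y => ENNReal.ofReal (f y) := hf.ennreal_ofReal
  have hle : μH[(m : ℝ)].restrict (g '' S) ≤
      ((μH[(m : ℝ)].restrict S).withDensity fun x => ‖fderiv ℝ g x‖ₑ ^ m).map g := by
    refine Measure.le_iff.2 fun B hB => ?_
    rw [Measure.restrict_apply hB, Measure.map_apply hgm hB, withDensity_apply _ (hgm hB),
      Measure.restrict_restrict (hgm hB), inter_comm, ← image_inter_preimage, inter_comm]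
    exact hausdorffMeasure_image_inter_le_lintegral m hg hSm hSfin (hgm hB)
  refine (lintegral_mono' hle le_rfl).trans_eq ?_
  rw [lintegral_map hfm hgm, lintegral_withDensity_eq_lintegral_mul _ hdens
    (g := fun x => ENNReal.ofReal (f (g x))) (hfm.comp hgm)]
  refine lintegral_congr fun x => ?_
  rw [Pi.mul_apply, ENNReal.ofReal_mul (hf0 _), ENNReal.ofReal_pow (norm_nonneg _), ofReal_norm,
    mul_comm]
end
end

section
/- Let m, n be positive integers with m ≤ n, let μ be a Radon measure on ℝⁿ and a ∈ ℝⁿ. Suppose there exist C ∈ (0,∞) and r₀ ∈ (0,∞) such that μ(B̄(x,r)) ≥ C·r^m for every x ∈ spt(μ) ∩ B̄(a,r₀) and every r ∈ (0,r₀). Then Tan^m(μ,a) = Tan(spt(μ), a); that is, the approximate tangent cone of μ at a equals the classical tangent cone of the support of μ at a. -/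
open Metric Set MeasureTheory Filter

noncomputable section

/-- If `z` scaled by `s` is `ε / 2`-close to `v`, then so is, up to `ε`, any point whose distance
to `z` is a small multiple of `‖z‖`. -/
lemma norm_smul_sub_lt_of_norm_sub_le {V : Type*} [NormedAddCommGroup V] [NormedSpace ℝ V]
    {v z w : V} {s c ε : ℝ} (hs : 0 < s) (hc : 0 < c) (hcε : c * (‖v‖ + ε / 2) ≤ ε / 2)
    (hz : ‖s • z - v‖ < ε / 2) (hw : ‖w - z‖ ≤ c * ‖z‖) : ‖s • w - v‖ < ε := by
  have hsz : s * ‖z‖ ≤ ‖v‖ + ε / 2 := by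
    rw [← norm_smul_of_nonneg hs.le]
    linarith [norm_le_norm_add_norm_sub' (s • z) v]
  calc ‖s • w - v‖ = ‖(s • z - v) + s • (w - z)‖ := by congr 1; module
    _ ≤ ‖s • z - v‖ + ‖s • (w - z)‖ := norm_add_le _ _
    _ = ‖s • z - v‖ + s * ‖w - z‖ := by rw [norm_smul_of_nonneg hs.le]
    _ < ε / 2 + c * (‖v‖ + ε / 2) := by
        have h1 : s * ‖w - z‖ ≤ s * (c * ‖z‖) := by gcongr
        have h2 : c * (s * ‖z‖) ≤ c * (‖v‖ + ε / 2) := by gcongr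
        linarith
    _ ≤ ε := by linarith

/-- If arbitrarily small balls around `a` contain, inside `A`, a proportional ball whose measure is
bounded below by the `m`-th power of its radius, then `A` has positive upper density at `a`. -/
lemma limsup_measure_inter_closedBall_div_pos {X : Type*} [PseudoMetricSpace X]
    [MeasurableSpace X] {μ : Measure X} {A : Set X} {a : X} {m : ℕ} {C c : ℝ}
    (hC : 0 < C) (hc : 0 < c)
    (h : ∀ δ : ℝ, 0 < δ → ∃ R : ℝ, 0 < R ∧ R < δ ∧ ∃ x : X,
      Metric.closedBall x (c * R) ⊆ A ∩ Metric.closedBall a R ∧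
      ENNReal.ofReal (C * (c * R) ^ m) ≤ μ (Metric.closedBall x (c * R))) :
    0 < Filter.limsup
      (fun r : ℝ => μ (A ∩ Metric.closedBall a r) / ENNReal.ofReal (r ^ m))
      (nhdsWithin 0 (Set.Ioi 0)) := by
  have hpos : 0 < ENNReal.ofReal (C * c ^ m) := ENNReal.ofReal_pos.2 (by positivity)
  refine hpos.trans_le (Filter.le_limsup_of_frequently_le' ?_)
  rw [(nhdsGT_basis (0 : ℝ)).frequently_iff]
  intro δ hδ
  obtain ⟨R, hR, hRδ, x, hsub, hμ⟩ := h δ hδ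
  refine ⟨R, ⟨hR, hRδ⟩, ?_⟩
  have hRm : 0 < ENNReal.ofReal (R ^ m) := ENNReal.ofReal_pos.2 (by positivity)
  rw [ENNReal.le_div_iff_mul_le (Or.inl hRm.ne') (Or.inl ENNReal.ofReal_ne_top),
    ← ENNReal.ofReal_mul (by positivity), mul_assoc, ← mul_pow]
  exact hμ.trans (measure_mono hsub)

theorem approximate_tangent_cone_eq_tangent_cone (n m : ℕ) (hm : 0 < m) (hmn : m ≤ n)
    (μ : Measure (EuclideanSpace ℝ (Fin n))) (hRadon : IsFiniteMeasureOnCompacts μ)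
    (a : EuclideanSpace ℝ (Fin n))
    (spt : Set (EuclideanSpace ℝ (Fin n)))
    (hspt : spt = {x : EuclideanSpace ℝ (Fin n) |
      ∀ r : ℝ, 0 < r → 0 < μ (Metric.ball x r)})
    (Econe : EuclideanSpace ℝ (Fin n) → EuclideanSpace ℝ (Fin n) → ℝ →
      Set (EuclideanSpace ℝ (Fin n)))
    (hEcone : ∀ b v ε, Econe b v ε =
      {x : EuclideanSpace ℝ (Fin n) | ∃ r : ℝ, 0 < r ∧ ‖r • (x - b) - v‖ < ε})
    (C r₀ : ℝ) (hC : 0 < C) (hr₀ : 0 < r₀)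
    (hlow : ∀ x ∈ spt ∩ Metric.closedBall a r₀, ∀ r : ℝ, 0 < r → r < r₀ →
      ENNReal.ofReal (C * r ^ m) ≤ μ (Metric.closedBall x r)) :
    {v : EuclideanSpace ℝ (Fin n) | ∀ ε : ℝ, 0 < ε →
        0 < Filter.limsup
          (fun r : ℝ => μ (Econe a v ε ∩ Metric.closedBall a r) / ENNReal.ofReal (r ^ m))
          (nhdsWithin 0 (Set.Ioi 0))} =
      {v : EuclideanSpace ℝ (Fin n) | ∀ ε : ℝ, 0 < ε →
        (spt ∩ Econe a v ε ∩ Metric.ball a ε).Nonempty} := by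
  subst hspt
  ext v
  simp only [Set.mem_ofPred_eq]
  constructor
  · intro h ε hε
    have hfreq := Filter.frequently_lt_of_lt_limsup (by isBoundedDefault) (h ε hε)
    rw [(nhdsGT_basis (0 : ℝ)).frequently_iff] at hfreq
    obtain ⟨r, ⟨-, hrε⟩, hμ⟩ := hfreq ε hε
    obtain ⟨x, ⟨hxE, hxr⟩, hx⟩ := exists_mem_forall_mem_nhdsWithin_pos_measure
      (ENNReal.div_pos_iff.1 hμ).1
    exact ⟨x, ⟨fun ρ hρ => hx _ (mem_nhdsWithin_of_mem_nhds (Metric.ball_mem_nhds x hρ)), hxE⟩,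
      Metric.closedBall_subset_ball hrε hxr⟩
  · intro h ε hε
    rcases eq_or_ne v 0 with rfl | hv
    · refine limsup_measure_inter_closedBall_div_pos hC one_half_pos fun δ hδ => ?_
      obtain ⟨R, hR, hRlt⟩ := exists_between (lt_min hδ hr₀)
      obtain ⟨hRδ, hRr₀⟩ := lt_min_iff.1 hRlt
      obtain ⟨x, ⟨hxs, -⟩, hxa⟩ := h (R / 2) (half_pos hR)
      rw [Metric.mem_ball] at hxa
      refine ⟨R, hR, hRδ, x, fun y hy => ⟨?_, ?_⟩,
        hlow x ⟨hxs, Metric.mem_closedBall.2 (by linarith)⟩ _ (by positivity) (by linarith)⟩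
      · rw [hEcone]
        refine ⟨ε / (‖y - a‖ + 1), by positivity, ?_⟩
        rw [sub_zero, norm_smul_of_nonneg (by positivity), div_mul_eq_mul_div,
          div_lt_iff₀ (by positivity)]
        nlinarith
      · rw [Metric.mem_closedBall] at hy ⊢
        linarith [dist_triangle y x a]
    · have hv' : 0 < ‖v‖ := norm_pos_iff.2 hv
      obtain ⟨c, hc, hcε⟩ : ∃ c : ℝ, 0 < c ∧ c * (‖v‖ + ε / 2) ≤ ε / 2 :=
        ⟨ε / 2 / (‖v‖ + ε / 2), by positivity, (div_mul_cancel₀ _ (by positivity)).le⟩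
      refine limsup_measure_inter_closedBall_div_pos (c := c / (1 + c)) hC (by positivity)
        fun δ hδ => ?_
      obtain ⟨η, hη, hηlt⟩ : ∃ η : ℝ, 0 < η ∧ η < min (min (ε / 2) ‖v‖) (min δ r₀ / (1 + c)) :=
        exists_between (by positivity)
      simp only [lt_min_iff, lt_div_iff₀ (show 0 < 1 + c by positivity)] at hηlt
      obtain ⟨⟨hηε, hηv⟩, hηδ, hηr₀⟩ := hηlt
      obtain ⟨x, ⟨hxs, hxE⟩, hxa⟩ := h η hη
      rw [hEcone] at hxE
      obtain ⟨s, hs, hsx⟩ := hxE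
      rw [Metric.mem_ball, dist_eq_norm] at hxa
      have hx0 : 0 < ‖x - a‖ := by
        rw [norm_pos_iff]
        intro h0
        rw [h0, smul_zero, zero_sub, norm_neg] at hsx
        linarith
      have hrad : c / (1 + c) * ((1 + c) * ‖x - a‖) = c * ‖x - a‖ := by field_simp
      have hlt : (1 + c) * ‖x - a‖ < η * (1 + c) := by nlinarith
      refine ⟨(1 + c) * ‖x - a‖, by positivity, hlt.trans hηδ, x, ?_, ?_⟩
      · rw [hrad]
        intro y hy
        rw [Metric.mem_closedBall, dist_eq_norm] at hy
        refine ⟨?_, ?_⟩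
        · rw [hEcone]
          exact ⟨s, hs, norm_smul_sub_lt_of_norm_sub_le hs hc hcε (hsx.trans hηε)
            (by rwa [sub_sub_sub_cancel_right])⟩
        · rw [Metric.mem_closedBall, dist_eq_norm]
          linarith [norm_sub_le_norm_sub_add_norm_sub y x a]
      · rw [hrad]
        exact hlow x ⟨hxs, by rw [Metric.mem_closedBall, dist_eq_norm]; nlinarith⟩ _
          (by positivity) (by nlinarith)
end
end

section
/- Let 1 ≤ m < n be integers, let T be an m-dimensional linear subspace of ℝⁿ, let S ⊆ B̄(0,1) be closed with S ∩ ∂B̄(0,1) ⊆ R, where R = T ∩ ∂B̄(0,1), and set δ = ½·sup{ρ ∈ [0,1] : S ∩ (R + B̄(0,ρ)) ⊆ T and (S + B̄(0,ρ)) ∩ (ℝⁿ∖B°(0,1)) ∖ (R + B̄(0,ρ)) = ∅}; assume δ > 0. Suppose there exists a map f : ℝⁿ → ℝⁿ with finite Lipschitz constant such that f(x) = x for every x ∈ R and f[S] ⊆ R. Then there exist a constant Γ ∈ (0,∞), depending only on n, the Lipschitz constant of f, and δ, and a map g : ℝⁿ → ℝⁿ such that: g has Lipschitz constant strictly less than Γ;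 g[S] ⊆ R; g[B̄(0,1)] ⊆ B̄(0,1); and g(x) = x for every x ∈ ℝⁿ∖B°(0,1). Moreover, for each ε > 0 there exists a map h : ℝⁿ → ℝⁿ of class C^∞ which is an admissible deformation in B°(0,1+ε), has Lipschitz constant at most Γ, and satisfies h[S] ⊆ R. -/
open Metric Set Pointwise

noncomputable section

/-- A basic deformation in an open set `W`: a `C¹` map which equals the identity outside
some bounded convex open subset `V ⊆ W` and maps `V` into itself. -/
def IsBasicDeformation {n : ℕ} (W : Set (EuclideanSpace ℝ (Fin n)))
    (h : EuclideanSpace ℝ (Fin n) → EuclideanSpace ℝ (Fin n)) : Prop :=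
  ContDiff ℝ 1 h ∧ ∃ V : Set (EuclideanSpace ℝ (Fin n)),
    IsOpen V ∧ Convex ℝ V ∧ Bornology.IsBounded V ∧ V ⊆ W ∧
    (∀ x ∉ V, h x = x) ∧ h '' V ⊆ V

/-- An admissible deformation in `W`: a finite composition of basic deformations in `W`. -/
def IsAdmissibleDeformation {n : ℕ} (W : Set (EuclideanSpace ℝ (Fin n)))
    (h : EuclideanSpace ℝ (Fin n) → EuclideanSpace ℝ (Fin n)) : Prop :=
  ∃ L : List (EuclideanSpace ℝ (Fin n) → EuclideanSpace ℝ (Fin n)),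
    (∀ g ∈ L, IsBasicDeformation W g) ∧ h = L.foldr (· ∘ ·) id

open MeasureTheory in
/-- A Lipschitz map which is the identity away from the unit ball can be smoothed at a small scale
without losing these properties. -/
lemma exists_contDiff_approx {E : Type*} [NormedAddCommGroup E] [InnerProductSpace ℝ E]
    [FiniteDimensional ℝ E] {g : E → E} {L : ℝ} (hL : 0 ≤ L)
    (hg : ∀ x y, ‖g x - g y‖ ≤ L * ‖x - y‖) (hid : ∀ x ∉ ball (0 : E) 1, g x = x)
    {ι : ℝ} (hι : 0 < ι) :
    ∃ G : E → E, ContDiff ℝ (⊤ : ℕ∞) G ∧ (∀ x y, ‖G x - G y‖ ≤ (L + 2) * ‖x - y‖) ∧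
      (∀ x, ‖G x - g x‖ ≤ (L + 1) * ι) ∧ ∀ x, 1 + ι ≤ ‖x‖ → G x = x := by
  borelize E
  let μ : Measure E := Measure.addHaar
  let k : E → E := fun x => g x - x
  have hk : ∀ x y, ‖k x - k y‖ ≤ (L + 1) * ‖x - y‖ := by
    intro x y
    calc ‖k x - k y‖ = ‖(g x - g y) - (x - y)‖ := by congr 1; simp only [k]; abel
      _ ≤ ‖g x - g y‖ + ‖x - y‖ := norm_sub_le _ _
      _ ≤ (L + 1) * ‖x - y‖ := by linarith [hg x y]
  have hkl : LipschitzWith (L + 1).toNNReal k := LipschitzWith.of_dist_le_mul fun x y => by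
    rw [dist_eq_norm, dist_eq_norm, Real.coe_toNNReal _ (by linarith)]
    exact hk x y
  have hkc : Continuous k := hkl.continuous
  let φ : ContDiffBump (0 : E) := ⟨ι / 2, ι, by linarith, by linarith⟩
  let c : E → E := convolution (φ.normed μ) k (ContinuousLinearMap.lsmul ℝ ℝ) μ
  have hc : ∀ x, c x = ∫ t, φ.normed μ t • k (x - t) ∂μ := fun x => rfl
  have hint : ∀ x, Integrable (fun t => φ.normed μ t • k (x - t)) μ := fun x =>
    (φ.continuous_normed.smul (hkc.comp (continuous_const.sub continuous_id))).integrable_of_hasCompactSupport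
      φ.hasCompactSupport_normed.smul_right
  have hcl : ∀ x y, ‖c x - c y‖ ≤ (L + 1) * ‖x - y‖ := by
    intro x y
    rw [hc, hc, ← integral_sub (hint x) (hint y)]
    calc ‖∫ t, (φ.normed μ t • k (x - t) - φ.normed μ t • k (y - t)) ∂μ‖
        ≤ ∫ t, φ.normed μ t * ((L + 1) * ‖x - y‖) ∂μ := by
          refine norm_integral_le_of_norm_le (φ.integrable_normed.mul_const _)
            (Filter.Eventually.of_forall fun t => ?_)
          rw [← smul_sub, norm_smul, Real.norm_of_nonneg (φ.nonneg_normed t)]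
          refine mul_le_mul_of_nonneg_left ?_ (φ.nonneg_normed t)
          simpa using hk (x - t) (y - t)
      _ = (L + 1) * ‖x - y‖ := by rw [integral_mul_const, φ.integral_normed, one_mul]
  refine ⟨fun x => x + c x, ?_, ?_, ?_, ?_⟩
  · exact contDiff_id.add (φ.hasCompactSupport_normed.contDiff_convolution_left _ φ.contDiff_normed
      hkc.locallyIntegrable)
  · intro x y
    calc ‖x + c x - (y + c y)‖ = ‖(x - y) + (c x - c y)‖ := by congr 1; abel
      _ ≤ ‖x - y‖ + ‖c x - c y‖ := norm_add_le _ _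
      _ ≤ (L + 2) * ‖x - y‖ := by linarith [hcl x y]
  · intro x
    have h := φ.dist_normed_convolution_le (μ := μ) (g := k) (x₀ := x) (ε := (L + 1) * ι)
      hkc.aestronglyMeasurable fun y hy => by
        rw [dist_eq_norm]
        refine (hk y x).trans (mul_le_mul_of_nonneg_left ?_ (by linarith))
        rw [← dist_eq_norm]
        exact (mem_ball.1 hy).le
    rw [dist_eq_norm] at h
    calc ‖x + c x - g x‖ = ‖c x - k x‖ := by congr 1; simp only [k]; abel
      _ ≤ _ := h
  · intro x hx
    have hz : ∀ y ∈ ball x ι, k y = 0 := by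
      intro y hy
      have h1 : y ∉ ball (0 : E) 1 := by
        rw [mem_ball_zero_iff, not_lt]
        rw [mem_ball, dist_comm, dist_eq_norm] at hy
        linarith [norm_sub_norm_le x y]
      simp only [k, hid y h1, sub_self]
    have h := φ.normed_convolution_eq_right (μ := μ) (g := k) (x₀ := x) fun y hy => by
      rw [hz y hy, hz x (mem_ball_self hι)]
    have : c x = 0 := h.trans (hz x (mem_ball_self hι))
    simp only [this, add_zero]

lemma norm_inv_smul_sub_inv_smul_le {E : Type*} [NormedAddCommGroup E] [NormedSpace ℝ E]
    {x y : E} {a b : ℝ} (ha : 0 < a) (hb : 0 < b) (hy : ‖y‖ ≤ b) (hab : |a - b| ≤ ‖x - y‖) :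
    ‖a⁻¹ • x - b⁻¹ • y‖ ≤ 2 / a * ‖x - y‖ := by
  have h : a⁻¹ • x - b⁻¹ • y = a⁻¹ • (x - y) + (a⁻¹ - b⁻¹) • y := by
    rw [smul_sub, sub_smul]; abel
  have h2 : |a⁻¹ - b⁻¹| * ‖y‖ ≤ a⁻¹ * ‖x - y‖ := by
    have : a⁻¹ - b⁻¹ = a⁻¹ * b⁻¹ * (b - a) := by field_simp
    rw [this, abs_mul, abs_of_pos (by positivity), abs_sub_comm]
    calc a⁻¹ * b⁻¹ * |a - b| * ‖y‖ ≤ a⁻¹ * b⁻¹ * ‖x - y‖ * b := by gcongr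
      _ = a⁻¹ * ‖x - y‖ := by field_simp
  rw [h]
  calc _ ≤ ‖a⁻¹ • (x - y)‖ + ‖(a⁻¹ - b⁻¹) • y‖ := norm_add_le _ _
    _ = a⁻¹ * ‖x - y‖ + |a⁻¹ - b⁻¹| * ‖y‖ := by
      rw [norm_smul, norm_smul, Real.norm_eq_abs, Real.norm_eq_abs, abs_of_pos (inv_pos.2 ha)]
    _ ≤ 2 / a * ‖x - y‖ := by
      rw [div_eq_mul_inv]; linarith

/-- Smooth maps which project a neighbourhood of the unit sphere of a subspace onto that sphere and
only move points close to it, with a Lipschitz constant independent of the scale. -/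
lemma exists_contDiff_retraction (E : Type*) [NormedAddCommGroup E] [InnerProductSpace ℝ E]
    [FiniteDimensional ℝ E] :
    ∃ C : ℝ, 0 ≤ C ∧ ∀ (T : Submodule ℝ E) (a : ℝ), 0 < a → a ≤ 1 / 4 →
      ∃ p : E → E, ContDiff ℝ (⊤ : ℕ∞) p ∧ (∀ x y, ‖p x - p y‖ ≤ C * ‖x - y‖) ∧
        (∀ x, ∀ r ∈ (T : Set E) ∩ sphere 0 1, ‖x - r‖ ≤ a / 2 → p x ∈ (T : Set E) ∩ sphere 0 1) ∧
        (∀ x, 1 + 4 * a ≤ ‖x‖ → p x = x) ∧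
        ∀ ε : ℝ, 0 < ε → ∀ x ∈ ball (0 : E) (1 + ε), p x ∈ ball (0 : E) (1 + ε) := by
  let β : ContDiffBump (0 : E) := ⟨1, 2, by norm_num, by norm_num⟩
  let θ : ContDiffBump (0 : ℝ) := ⟨1, 2, by norm_num, by norm_num⟩
  obtain ⟨B, hB⟩ := ContDiff.lipschitzWith_of_hasCompactSupport (𝕂 := ℝ) β.hasCompactSupport
    (β.contDiff (n := 1)) one_ne_zero
  obtain ⟨D, hD⟩ := ContDiff.lipschitzWith_of_hasCompactSupport (𝕂 := ℝ) θ.hasCompactSupport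
    (θ.contDiff (n := 1)) one_ne_zero
  have hB' : ∀ x y, |β x - β y| ≤ B * ‖x - y‖ := fun x y => by
    simpa [Real.dist_eq, dist_eq_norm] using hB.dist_le_mul x y
  have hD' : ∀ x y, |θ x - θ y| ≤ D * |x - y| := fun x y => by
    simpa [Real.dist_eq] using hD.dist_le_mul x y
  refine ⟨1 + (4 * (2 * B + D) + 5), by positivity, fun T a ha ha4 => ?_⟩
  let P : E →L[ℝ] E := T.starProjection
  have hP : ∀ x, ‖P x‖ ≤ ‖x‖ := T.norm_starProjection_apply_le
  have hPsub : ∀ x y, ‖P x - P y‖ ≤ ‖x - y‖ := fun x y => by rw [← map_sub]; exact hP _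
  have hPT : ∀ x, P x ∈ T := T.starProjection_apply_mem
  let χ : E → ℝ := fun x => β (a⁻¹ • (x - P x)) * θ (a⁻¹ * (‖P x‖ - 1))
  let q : E → E := fun x => ‖P x‖⁻¹ • P x
  let F : E → E := fun x => χ x • (q x - x)
  have hχ0 : ∀ x, 0 ≤ χ x := fun x => mul_nonneg β.nonneg θ.nonneg
  have hχ1 : ∀ x, χ x ≤ 1 := fun x => mul_le_one₀ β.le_one θ.nonneg θ.le_one
  have hχβ : ∀ x, χ x ≠ 0 → ‖x - P x‖ < 2 * a := by
    intro x hx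
    by_contra! h
    apply hx
    have : β (a⁻¹ • (x - P x)) = 0 := β.zero_of_le_dist (by
      rw [dist_zero_right, norm_smul, Real.norm_of_nonneg (inv_nonneg.2 ha.le), inv_mul_eq_div,
        le_div_iff₀ ha]
      exact h)
    simp only [χ, this, zero_mul]
  have hθ : ∀ x, 2 * a ≤ |‖P x‖ - 1| → χ x = 0 := by
    intro x h
    have : θ (a⁻¹ * (‖P x‖ - 1)) = 0 := θ.zero_of_le_dist (by
      rw [dist_zero_right, norm_mul, Real.norm_of_nonneg (inv_nonneg.2 ha.le), inv_mul_eq_div,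
        le_div_iff₀ ha]
      exact h)
    simp only [χ, this, mul_zero]
  have hχθ : ∀ x, χ x ≠ 0 → |‖P x‖ - 1| < 2 * a := by
    intro x hx
    by_contra! h
    exact hx (hθ x h)
  have hPpos : ∀ x, χ x ≠ 0 → 1 / 2 ≤ ‖P x‖ := fun x hx => by
    have := (abs_lt.1 (hχθ x hx)).1
    linarith
  have hqnorm : ∀ x, 0 < ‖P x‖ → ‖q x‖ = 1 := fun x hx => by
    simp only [q]
    rw [norm_smul, norm_inv, norm_norm, inv_mul_cancel₀ hx.ne']
  have hw : ∀ x, χ x ≠ 0 → ‖q x - x‖ ≤ 4 * a := by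
    intro x hx
    have hp : 0 < ‖P x‖ := by linarith [hPpos x hx]
    have h1 : q x - P x = (‖P x‖⁻¹ * (1 - ‖P x‖)) • P x := by
      rw [mul_sub, mul_one, inv_mul_cancel₀ hp.ne', sub_smul, one_smul]
    have h2 : ‖q x - P x‖ = |‖P x‖ - 1| := by
      rw [h1, norm_smul, norm_mul, norm_inv, norm_norm, Real.norm_eq_abs, abs_sub_comm]
      field_simp
    calc ‖q x - x‖ = ‖(q x - P x) - (x - P x)‖ := by congr 1; abel
      _ ≤ ‖q x - P x‖ + ‖x - P x‖ := norm_sub_le _ _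
      _ ≤ 4 * a := by rw [h2]; linarith [hχβ x hx, hχθ x hx]
  have hχl : ∀ x y, |χ x - χ y| ≤ (2 * B + D) / a * ‖x - y‖ := by
    intro x y
    have h1 : |β (a⁻¹ • (x - P x)) - β (a⁻¹ • (y - P y))| ≤ 2 * B / a * ‖x - y‖ := by
      refine (hB' _ _).trans ?_
      rw [← smul_sub, norm_smul, Real.norm_of_nonneg (inv_nonneg.2 ha.le)]
      have : ‖x - P x - (y - P y)‖ ≤ 2 * ‖x - y‖ := by
        calc ‖x - P x - (y - P y)‖ = ‖(x - y) - (P x - P y)‖ := by congr 1; abel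
          _ ≤ ‖x - y‖ + ‖P x - P y‖ := norm_sub_le _ _
          _ ≤ 2 * ‖x - y‖ := by linarith [hPsub x y]
      calc (B : ℝ) * (a⁻¹ * ‖x - P x - (y - P y)‖) ≤ B * (a⁻¹ * (2 * ‖x - y‖)) := by gcongr
        _ = 2 * B / a * ‖x - y‖ := by field_simp
    have h2 : |θ (a⁻¹ * (‖P x‖ - 1)) - θ (a⁻¹ * (‖P y‖ - 1))| ≤ D / a * ‖x - y‖ := by
      refine (hD' _ _).trans ?_
      rw [← mul_sub, abs_mul, abs_of_pos (inv_pos.2 ha), sub_sub_sub_cancel_right]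
      calc (D : ℝ) * (a⁻¹ * |‖P x‖ - ‖P y‖|) ≤ D * (a⁻¹ * ‖x - y‖) := by
            gcongr
            exact (abs_norm_sub_norm_le _ _).trans (hPsub x y)
        _ = D / a * ‖x - y‖ := by field_simp
    have h3 : χ x - χ y = (β (a⁻¹ • (x - P x)) - β (a⁻¹ • (y - P y))) * θ (a⁻¹ * (‖P x‖ - 1))
        + β (a⁻¹ • (y - P y)) * (θ (a⁻¹ * (‖P x‖ - 1)) - θ (a⁻¹ * (‖P y‖ - 1))) := by
      simp only [χ]; ring
    rw [h3]
    refine (abs_add_le _ _).trans ?_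
    rw [abs_mul, abs_mul, abs_of_nonneg (θ.nonneg' _), abs_of_nonneg (β.nonneg' _)]
    have h4 := mul_le_of_le_one_right
      (abs_nonneg (β (a⁻¹ • (x - P x)) - β (a⁻¹ • (y - P y)))) (θ.le_one (x := a⁻¹ * (‖P x‖ - 1)))
    have h5 := mul_le_of_le_one_left
      (abs_nonneg (θ (a⁻¹ * (‖P x‖ - 1)) - θ (a⁻¹ * (‖P y‖ - 1)))) (β.le_one (x := a⁻¹ • (y - P y)))
    have h6 : (2 * B + D) / a * ‖x - y‖ = 2 * B / a * ‖x - y‖ + D / a * ‖x - y‖ := by ring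
    linarith
  have hF_one : ∀ x y, χ x ≠ 0 →
      ‖(χ x - χ y) • (q x - x)‖ ≤ 4 * (2 * B + D) * ‖x - y‖ := by
    intro x y hx
    rw [norm_smul, Real.norm_eq_abs]
    calc |χ x - χ y| * ‖q x - x‖ ≤ ((2 * B + D) / a * ‖x - y‖) * (4 * a) := by
          gcongr
          exacts [hχl x y, hw x hx]
      _ = 4 * (2 * B + D) * ‖x - y‖ := by field_simp
  have hF : ∀ x y, ‖F x - F y‖ ≤ (4 * (2 * B + D) + 5) * ‖x - y‖ := by
    have key : ∀ x y, χ x ≠ 0 → ‖F x - F y‖ ≤ (4 * (2 * B + D) + 5) * ‖x - y‖ := by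
      intro x y hx
      by_cases hy : χ y = 0
      · have : F x - F y = (χ x - χ y) • (q x - x) := by simp only [F, hy, zero_smul, sub_zero]
        rw [this]
        refine (hF_one x y hx).trans ?_
        gcongr
        linarith
      · have h1 : F x - F y = (χ x - χ y) • (q x - x) + χ y • ((q x - q y) - (x - y)) := by
          simp only [F]; module
        have hpx := hPpos x hx
        have hpy := hPpos y hy
        have h2 : ‖q x - q y‖ ≤ 4 * ‖x - y‖ := by
          have := norm_inv_smul_sub_inv_smul_le (x := P x) (y := P y) (a := ‖P x‖) (b := ‖P y‖)
            (by linarith) (by linarith) le_rfl (abs_norm_sub_norm_le _ _)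
          refine this.trans ?_
          gcongr
          · rw [div_le_iff₀ (by linarith)]; linarith
          · exact hPsub x y
        have h3 : ‖χ y • ((q x - q y) - (x - y))‖ ≤ 5 * ‖x - y‖ := by
          rw [norm_smul, Real.norm_of_nonneg (hχ0 y)]
          refine (mul_le_of_le_one_left (norm_nonneg _) (hχ1 y)).trans ?_
          linarith [norm_sub_le (q x - q y) (x - y)]
        rw [h1]
        refine (norm_add_le _ _).trans ?_
        linarith [hF_one x y hx]
    intro x y
    by_cases hx : χ x = 0
    · by_cases hy : χ y = 0
      · simp only [F, hx, hy, zero_smul, sub_zero, norm_zero]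
        positivity
      · rw [norm_sub_rev, norm_sub_rev x y]
        exact key y x hy
    · exact key x y hx
  refine ⟨fun x => x + F x, ?_, ?_, ?_, ?_, ?_⟩
  · refine contDiff_id.add (contDiff_iff_contDiffAt.2 fun x => ?_)
    by_cases hx : P x = 0
    · have hev : F =ᶠ[nhds x] fun _ => 0 := by
        have hopen : IsOpen {y | ‖P y‖ < 1 / 2} :=
          isOpen_lt (P.continuous.norm) continuous_const
        filter_upwards [hopen.mem_nhds (by simp [hx] : ‖P x‖ < 1 / 2)] with y hy
        have hy' : ‖P y‖ < 1 / 2 := hy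
        have : χ y = 0 := by
          by_contra h
          linarith [hPpos y h]
        simp only [F, this, zero_smul]
      exact contDiffAt_const.congr_of_eventuallyEq hev
    · have hPd : ContDiffAt ℝ (⊤ : ℕ∞) (fun y => P y) x := P.contDiff.contDiffAt
      have hnorm : ContDiffAt ℝ (⊤ : ℕ∞) (fun y => ‖P y‖) x := hPd.norm ℝ hx
      refine ContDiffAt.smul (ContDiffAt.mul ?_ ?_) (ContDiffAt.sub ?_ contDiffAt_id)
      · exact β.contDiffAt.comp x (contDiffAt_const.smul (contDiffAt_id.sub hPd))
      · exact θ.contDiffAt.comp x (contDiffAt_const.mul (hnorm.sub contDiffAt_const))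
      · exact (hnorm.inv (norm_ne_zero_iff.2 hx)).smul hPd
  · intro x y
    calc ‖x + F x - (y + F y)‖ = ‖(x - y) + (F x - F y)‖ := by congr 1; abel
      _ ≤ ‖x - y‖ + ‖F x - F y‖ := norm_add_le _ _
      _ ≤ (1 + (4 * (2 * B + D) + 5)) * ‖x - y‖ := by linarith [hF x y]
  · rintro x r ⟨hrT, hr⟩ hxr
    rw [mem_sphere_zero_iff_norm] at hr
    have hPr : P r = r := T.starProjection_eq_self_iff.2 hrT
    have h1 : ‖P x - r‖ ≤ a / 2 := by
      have := hPsub x r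
      rw [hPr] at this
      linarith
    have h2 : |‖P x‖ - 1| ≤ a := by
      rw [← hr]
      linarith [abs_norm_sub_norm_le (P x) r]
    have h3 : ‖x - P x‖ ≤ a := by
      calc ‖x - P x‖ = ‖(x - r) - (P x - r)‖ := by congr 1; abel
        _ ≤ ‖x - r‖ + ‖P x - r‖ := norm_sub_le _ _
        _ ≤ a := by linarith
    have hβ1 : β (a⁻¹ • (x - P x)) = 1 := β.one_of_mem_closedBall (by
      rw [mem_closedBall_zero_iff, norm_smul, Real.norm_of_nonneg (inv_nonneg.2 ha.le),
        inv_mul_eq_div, div_le_iff₀ ha, one_mul]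
      exact h3)
    have hθ1 : θ (a⁻¹ * (‖P x‖ - 1)) = 1 := θ.one_of_mem_closedBall (by
      rw [mem_closedBall_zero_iff, norm_mul, Real.norm_of_nonneg (inv_nonneg.2 ha.le),
        inv_mul_eq_div, div_le_iff₀ ha, one_mul]
      exact h2)
    have hp : 0 < ‖P x‖ := by linarith [(abs_le.1 h2).1]
    have : x + F x = q x := by
      simp only [F, χ, hβ1, hθ1, mul_one, one_smul, add_sub_cancel]
    simp only [this]
    exact ⟨T.smul_mem _ (hPT x), mem_sphere_zero_iff_norm.2 (hqnorm x hp)⟩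
  · intro x hx
    have : χ x = 0 := by
      by_contra h
      have h1 := hχβ x h
      have h2 := (abs_lt.1 (hχθ x h)).2
      linarith [norm_sub_norm_le x (P x)]
    simp only [F, this, zero_smul, add_zero]
  · intro ε hε x hx
    by_cases h : χ x = 0
    · simpa only [F, h, zero_smul, add_zero] using hx
    · have hq : q x ∈ ball (0 : E) (1 + ε) := by
        rw [mem_ball_zero_iff, hqnorm x (by linarith [hPpos x h])]
        linarith
      exact (convex_ball (0 : E) (1 + ε)).add_smul_sub_mem hx hq ⟨hχ0 x, hχ1 x⟩

/-- If the points outside the unit ball that are `ρ`-close to `S` are `ρ`-close to the unit sphere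
of `T`, and `S` is contained in `T` near that sphere, then `S` is contained in `T` near the whole
unit sphere. -/
lemma mem_of_one_sub_le_norm {E : Type*} [NormedAddCommGroup E] [InnerProductSpace ℝ E]
    {T : Submodule ℝ E} {S R : Set E} (hR : R = (T : Set E) ∩ sphere 0 1) {ρ : ℝ} (hρ0 : 0 < ρ)
    (hρ1 : ρ ≤ 1) (hT : S ∩ (R + closedBall 0 ρ) ⊆ (T : Set E))
    (hout : ((S + closedBall 0 ρ) ∩ (ball (0 : E) 1)ᶜ) \ (R + closedBall 0 ρ) = ∅)
    {s : E} (hs : s ∈ S) (hs1 : 1 - ρ / 2 ≤ ‖s‖) : s ∈ T := by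
  have ht : 0 < ‖s‖ := by linarith
  have hp : (1 + ρ / ‖s‖) • s ∈ R + closedBall (0 : E) ρ := by
    rw [sdiff_eq_empty] at hout
    refine hout ⟨?_, ?_⟩
    · rw [add_smul, one_smul]
      refine add_mem_add hs ?_
      rw [mem_closedBall_zero_iff, norm_smul, Real.norm_of_nonneg (by positivity),
        div_mul_cancel₀ _ ht.ne']
    · rw [mem_compl_iff, mem_ball_zero_iff, not_lt, norm_smul, Real.norm_of_nonneg (by positivity),
        add_mul, div_mul_cancel₀ _ ht.ne']
      linarith
  obtain ⟨r, hr, b, hb, hrb⟩ := hp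
  have hr1 : ‖r‖ = 1 := by
    rw [hR] at hr
    exact mem_sphere_zero_iff_norm.1 hr.2
  rw [mem_closedBall_zero_iff] at hb
  have hb' : b = (1 + ρ / ‖s‖) • s - r := eq_sub_of_add_eq' hrb
  have h1 : ‖(1 + ρ / ‖s‖) • s - r‖ ^ 2 ≤ ρ ^ 2 := by
    rw [← hb']
    gcongr
  rw [norm_sub_sq_real, norm_smul, Real.norm_of_nonneg (by positivity), real_inner_smul_left, hr1]
    at h1
  have h2 : ‖s - r‖ ^ 2 ≤ ρ ^ 2 := by
    rw [norm_sub_sq_real, hr1]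
    set t := ‖s‖
    set c := inner ℝ s r
    have e1 : (1 + ρ / t) * t = t + ρ := by field_simp
    have e2 : (1 + ρ / t) = (t + ρ) / t := by field_simp
    rw [e1, e2] at h1
    have h3 : t * ((t + ρ) ^ 2 + 1 - ρ ^ 2) ≤ 2 * ((t + ρ) * c) := by
      have : 2 * ((t + ρ) / t * c) * t = 2 * ((t + ρ) * c) := by field_simp
      rw [← this]
      nlinarith
    have h4 : 0 ≤ ρ * (t ^ 2 + ρ * t - 1 + ρ ^ 2) := by
      apply mul_nonneg hρ0.le
      nlinarith
    have h5 : (t + ρ) * (t ^ 2 + 1 - ρ ^ 2) ≤ (t + ρ) * (2 * c) := by nlinarith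
    have h6 := le_of_mul_le_mul_left h5 (by linarith)
    linarith
  have h3 : ‖s - r‖ ≤ ρ := abs_le_of_sq_le_sq h2 hρ0.le |> (le_abs_self _).trans
  refine hT ⟨hs, r, hr, s - r, mem_closedBall_zero_iff.2 h3, ?_⟩
  simp

/-- A map on `S` which fixes the unit sphere of `T`, extended by the identity outside the unit ball,
has a Lipschitz extension which preserves the unit ball. -/
lemma exists_lipschitz_extension (E : Type*) [NormedAddCommGroup E] [InnerProductSpace ℝ E]
    [FiniteDimensional ℝ E] (Lf : NNReal) {δ : ℝ} (hδ : 0 < δ) :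
    ∃ L : ℝ, 0 ≤ L ∧ ∀ (T : Submodule ℝ E) (S R : Set E), R = (T : Set E) ∩ sphere 0 1 →
      S ⊆ closedBall 0 1 → (∀ s ∈ S, 1 - δ ≤ ‖s‖ → s ∈ T) →
      ∀ f : E → E, LipschitzWith Lf f → (∀ x ∈ R, f x = x) → f '' S ⊆ R →
      ∃ g : E → E, (∀ x y, ‖g x - g y‖ ≤ L * ‖x - y‖) ∧ g '' S ⊆ R ∧
        (∀ x ∈ closedBall (0 : E) 1, g x ∈ closedBall (0 : E) 1) ∧
        ∀ x ∉ ball (0 : E) 1, g x = x := by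
  classical
  obtain ⟨K, hK0, hKf, hKδ⟩ : ∃ K : ℝ, 0 ≤ K ∧ (Lf : ℝ) + 2 ≤ K ∧ 1 + 2 / δ ≤ K :=
    ⟨max (Lf + 2) (1 + 2 / δ), le_max_of_le_left (by positivity), le_max_left _ _, le_max_right _ _⟩
  let M : NNReal := lipschitzExtensionConstant E * K.toNNReal
  refine ⟨2 * M + 1, by positivity, fun T S R hR hS hST f hf hfR hfS => ?_⟩
  have hf' : ∀ x y, ‖f x - f y‖ ≤ Lf * ‖x - y‖ := fun x y => by
    simpa [dist_eq_norm] using hf.dist_le_mul x y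
  have hR1 : ∀ r ∈ R, ‖r‖ = 1 := fun r hr => by
    rw [hR] at hr
    exact mem_sphere_zero_iff_norm.1 hr.2
  have hmix : ∀ s ∈ S, ∀ y : E, 1 ≤ ‖y‖ → ‖f s - y‖ ≤ K * ‖s - y‖ := by
    intro s hs y hy
    have hs1 : ‖s‖ ≤ 1 := mem_closedBall_zero_iff.1 (hS hs)
    have hsy : ‖y‖ - ‖s‖ ≤ ‖s - y‖ := by
      rw [norm_sub_rev]; exact norm_sub_norm_le _ _
    rcases le_or_gt (1 - δ) ‖s‖ with h | h
    · rcases (norm_nonneg s).eq_or_lt' with h0 | h0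
      · have h1 : ‖f s‖ = 1 := hR1 _ (hfS ⟨s, hs, rfl⟩)
        calc ‖f s - y‖ ≤ ‖f s‖ + ‖y‖ := norm_sub_le _ _
          _ ≤ 2 * ‖s - y‖ := by linarith
          _ ≤ K * ‖s - y‖ := by gcongr; linarith [Lf.coe_nonneg]
      · set u : E := ‖s‖⁻¹ • s
        have hu1 : ‖u‖ = 1 := by
          rw [norm_smul, norm_inv, norm_norm, inv_mul_cancel₀ h0.ne']
        have hu : u ∈ R := by
          rw [hR]
          exact ⟨T.smul_mem _ (hST s hs h), mem_sphere_zero_iff_norm.2 hu1⟩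
        have hsu : ‖s - u‖ = 1 - ‖s‖ := by
          have : s - u = (1 - ‖s‖⁻¹) • s := by rw [sub_smul, one_smul]
          rw [this, norm_smul, Real.norm_of_nonpos (by linarith [one_le_inv_iff₀.2 ⟨h0, hs1⟩])]
          field_simp
          ring
        have h1 := hf' s u
        rw [hfR u hu] at h1
        have h2 : (Lf : ℝ) * ‖s - u‖ ≤ Lf * ‖s - y‖ := by
          gcongr; linarith
        calc ‖f s - y‖ = ‖(f s - u) - (s - u) + (s - y)‖ := by congr 1; abel
          _ ≤ ‖f s - u‖ + ‖s - u‖ + ‖s - y‖ :=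
            (norm_add_le _ _).trans (by gcongr; exact norm_sub_le _ _)
          _ ≤ (Lf + 2) * ‖s - y‖ := by linarith
          _ ≤ K * ‖s - y‖ := by gcongr
    · have h1 : ‖f s‖ = 1 := hR1 _ (hfS ⟨s, hs, rfl⟩)
      have h2 : δ ≤ ‖s - y‖ := by linarith
      have h3 : 2 ≤ 2 / δ * ‖s - y‖ := by
        rw [div_mul_eq_mul_div, le_div_iff₀ hδ]; linarith
      calc ‖f s - y‖ ≤ ‖f s‖ + ‖y‖ := norm_sub_le _ _
        _ ≤ (1 + 2 / δ) * ‖s - y‖ := by linarith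
        _ ≤ K * ‖s - y‖ := by gcongr
  let g₀ : E → E := fun x => if 1 ≤ ‖x‖ then x else f x
  have hg₀S : ∀ s ∈ S, g₀ s = f s := by
    intro s hs
    by_cases h : 1 ≤ ‖s‖
    · have h1 : ‖s‖ = 1 := le_antisymm (mem_closedBall_zero_iff.1 (hS hs)) h
      have : s ∈ R := by
        rw [hR]
        exact ⟨hST s hs (by linarith), mem_sphere_zero_iff_norm.2 h1⟩
      simp only [g₀, h, if_true, hfR s this]
    · simp only [g₀, h, if_false]
  have hg₀o : ∀ x, 1 ≤ ‖x‖ → g₀ x = x := fun x hx => if_pos hx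
  have hg₀ : LipschitzOnWith K.toNNReal g₀ (S ∪ {x | 1 ≤ ‖x‖}) := by
    refine LipschitzOnWith.of_dist_le_mul ?_
    intro x hx y hy
    rw [dist_eq_norm, dist_eq_norm, Real.coe_toNNReal _ hK0]
    rcases hx with hx | hx <;> rcases hy with hy | hy
    · rw [hg₀S x hx, hg₀S y hy]
      refine (hf' x y).trans ?_
      gcongr
      linarith
    · rw [hg₀S x hx, hg₀o y hy]
      exact hmix x hx y hy
    · rw [hg₀o x hx, hg₀S y hy, norm_sub_rev, norm_sub_rev x y]
      exact hmix y hy x hx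
    · rw [hg₀o x hx, hg₀o y hy]
      exact le_mul_of_one_le_left (norm_nonneg _) (by linarith [Lf.coe_nonneg])
  obtain ⟨e, he, heq⟩ := hg₀.extend_finite_dimension
  have he' : ∀ x y, ‖e x - e y‖ ≤ M * ‖x - y‖ := fun x y => by
    simpa only [dist_eq_norm] using he.dist_le_mul x y
  let ret : E → E := fun x => (max 1 ‖x‖)⁻¹ • x
  have hret : ∀ x y, ‖ret x - ret y‖ ≤ 2 * ‖x - y‖ := by
    intro x y
    have h1 := norm_inv_smul_sub_inv_smul_le (x := x) (y := y) (a := max 1 ‖x‖) (b := max 1 ‖y‖)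
      (by positivity) (by positivity) (le_max_right _ _)
      (by
        rw [max_comm 1, max_comm 1]
        exact (abs_max_sub_max_le_abs ‖x‖ ‖y‖ 1).trans (abs_norm_sub_norm_le _ _))
    refine h1.trans ?_
    gcongr
    exact div_le_self zero_le_two (le_max_left _ _)
  have hretid : ∀ x, ‖x‖ ≤ 1 → ret x = x := fun x hx => by
    simp only [ret, max_eq_left hx, inv_one, one_smul]
  have hret1 : ∀ x, ‖ret x‖ ≤ 1 := fun x => by
    simp only [ret]
    rw [norm_smul, norm_inv, Real.norm_of_nonneg (by positivity), inv_mul_le_iff₀ (by positivity),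
      mul_one]
    exact le_max_right _ _
  have heo : ∀ x, 1 ≤ ‖x‖ → e x = x := fun x hx => by rw [← heq (Or.inr hx), hg₀o x hx]
  let g : E → E := fun x => if 1 ≤ ‖x‖ then x else ret (e x)
  have hg_in : ∀ x, ‖x‖ ≤ 1 → g x = ret (e x) := by
    intro x hx
    by_cases h : 1 ≤ ‖x‖
    · simp only [g, h, if_true, heo x h, hretid x hx]
    · simp only [g, h, if_false]
  have hg_out : ∀ x, 1 ≤ ‖x‖ → g x = x := fun x hx => if_pos hx
  have hre : ∀ x y, ‖ret (e x) - ret (e y)‖ ≤ 2 * M * ‖x - y‖ := fun x y => by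
    linarith [hret (e x) (e y), he' x y]
  have hgmix : ∀ x y : E, ‖x‖ ≤ 1 → 1 ≤ ‖y‖ → ‖g x - g y‖ ≤ (2 * M + 1) * ‖x - y‖ := by
    intro x y hx hy
    have h1 : ‖ret y - y‖ = ‖y‖ - 1 := by
      have : ret y - y = (‖y‖⁻¹ - 1) • y := by
        simp only [ret, max_eq_right hy, sub_smul, one_smul]
      rw [this, norm_smul, Real.norm_of_nonpos (by linarith [inv_le_one_of_one_le₀ hy])]
      field_simp
      ring
    have h2 := hre x y
    rw [heo y hy] at h2
    rw [hg_in x hx, hg_out y hy]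
    calc ‖ret (e x) - y‖ ≤ ‖ret (e x) - ret y‖ + ‖ret y - y‖ := norm_sub_le_norm_sub_add_norm_sub _ _ _
      _ ≤ (2 * M + 1) * ‖x - y‖ := by
        rw [h1]
        linarith [norm_sub_norm_le y x, norm_sub_rev x y]
  refine ⟨g, ?_, ?_, ?_, ?_⟩
  · intro x y
    rcases le_total ‖x‖ 1 with hx | hx <;> rcases le_total ‖y‖ 1 with hy | hy
    · rw [hg_in x hx, hg_in y hy]
      linarith [hre x y, norm_nonneg (x - y)]
    · exact hgmix x y hx hy
    · rw [norm_sub_rev, norm_sub_rev x y]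
      exact hgmix y x hy hx
    · rw [hg_out x hx, hg_out y hy]
      exact le_mul_of_one_le_left (norm_nonneg _) (by linarith [M.coe_nonneg])
  · rintro _ ⟨s, hs, rfl⟩
    have h1 : f s ∈ R := hfS ⟨s, hs, rfl⟩
    rw [hg_in s (mem_closedBall_zero_iff.1 (hS hs)), ← heq (Or.inl hs), hg₀S s hs,
      hretid _ (hR1 _ h1).le]
    exact h1
  · intro x hx
    rw [hg_in x (mem_closedBall_zero_iff.1 hx), mem_closedBall_zero_iff]
    exact hret1 _
  · intro x hx
    exact hg_out x (by simpa using hx)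

theorem lipschitz_retraction_to_admissible (n : ℕ)
    (Lf : NNReal) (δ : ℝ) (hδ : 0 < δ) :
    ∃ Γ : ℝ, 0 < Γ ∧
      ∀ (m : ℕ), 1 ≤ m → m < n →
      ∀ (T : Submodule ℝ (EuclideanSpace ℝ (Fin n))),
        Module.finrank ℝ T = m →
      ∀ (S R : Set (EuclideanSpace ℝ (Fin n))),
        R = (T : Set (EuclideanSpace ℝ (Fin n))) ∩ Metric.sphere 0 1 →
        IsClosed S → S ⊆ Metric.closedBall 0 1 →
        S ∩ Metric.sphere 0 1 ⊆ R →
        δ = (1 / 2) * sSup {ρ : ℝ | ρ ∈ Set.Icc (0 : ℝ) 1 ∧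
          S ∩ (R + Metric.closedBall 0 ρ) ⊆ (T : Set (EuclideanSpace ℝ (Fin n))) ∧
          ((S + Metric.closedBall 0 ρ) ∩ (Metric.ball (0 : EuclideanSpace ℝ (Fin n)) 1)ᶜ)
            \ (R + Metric.closedBall 0 ρ) = ∅} →
      ∀ (f : EuclideanSpace ℝ (Fin n) → EuclideanSpace ℝ (Fin n)),
        LipschitzWith Lf f → (∀ x ∈ R, f x = x) → f '' S ⊆ R →
        (∃ g : EuclideanSpace ℝ (Fin n) → EuclideanSpace ℝ (Fin n),
          (∃ c : ℝ, 0 ≤ c ∧ c < Γ ∧ ∀ x y, ‖g x - g y‖ ≤ c * ‖x - y‖) ∧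
          g '' S ⊆ R ∧
          g '' Metric.closedBall 0 1 ⊆ Metric.closedBall 0 1 ∧
          (∀ x ∉ Metric.ball (0 : EuclideanSpace ℝ (Fin n)) 1, g x = x)) ∧
        (∀ ε : ℝ, 0 < ε →
          ∃ h : EuclideanSpace ℝ (Fin n) → EuclideanSpace ℝ (Fin n),
            ContDiff ℝ (⊤ : ℕ∞) h ∧
            IsAdmissibleDeformation (Metric.ball (0 : EuclideanSpace ℝ (Fin n)) (1 + ε)) h ∧
            (∀ x y, ‖h x - h y‖ ≤ Γ * ‖x - y‖) ∧
            h '' S ⊆ R) := by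
  obtain ⟨L, hL, hext⟩ := exists_lipschitz_extension (EuclideanSpace ℝ (Fin n)) Lf (half_pos hδ)
  obtain ⟨C, hC, hretr⟩ := exists_contDiff_retraction (EuclideanSpace ℝ (Fin n))
  refine ⟨C * (L + 2) + L + 1, by positivity, ?_⟩
  intro m _ _ T _ S R hR _ hSB _ hsup f hf hfR hfS
  obtain ⟨ρ, ⟨⟨hρ0, hρ1⟩, hT, hout⟩, hδρ⟩ := exists_lt_of_lt_csSup
    (nonempty_iff_ne_empty.2 fun h => by
      rw [h, Real.sSup_empty, mul_zero] at hsup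
      exact hδ.ne' hsup)
    (by linarith : δ < sSup {ρ : ℝ | ρ ∈ Set.Icc (0 : ℝ) 1 ∧
          S ∩ (R + Metric.closedBall 0 ρ) ⊆ (T : Set (EuclideanSpace ℝ (Fin n))) ∧
          ((S + Metric.closedBall 0 ρ) ∩ (Metric.ball (0 : EuclideanSpace ℝ (Fin n)) 1)ᶜ)
            \ (R + Metric.closedBall 0 ρ) = ∅})
  have hST : ∀ s ∈ S, 1 - δ / 2 ≤ ‖s‖ → s ∈ T := fun s hs h =>
    mem_of_one_sub_le_norm hR (hδ.trans hδρ) hρ1 hT hout hs (by linarith)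
  obtain ⟨g, hgL, hgS, hgB, hgo⟩ := hext T S R hR hSB hST f hf hfR hfS
  refine ⟨⟨g, ⟨L, hL, ?_, hgL⟩, hgS, image_subset_iff.2 hgB, hgo⟩, fun ε hε => ?_⟩
  · have : 0 ≤ C * (L + 2) := by positivity
    linarith
  obtain ⟨a, ha, ha4, haε⟩ : ∃ a : ℝ, 0 < a ∧ a ≤ 1 / 4 ∧ a ≤ ε / 8 :=
    ⟨min (1 / 4) (ε / 8), by positivity, min_le_left _ _, min_le_right _ _⟩
  obtain ⟨ι, hι, hιL⟩ : ∃ ι : ℝ, 0 < ι ∧ (L + 1) * ι = a / 2 :=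
    ⟨a / 2 / (L + 1), by positivity, by field_simp⟩
  have hιa : ι ≤ a / 2 := by nlinarith
  obtain ⟨p, hp, hpL, hpR, hpo, hpB⟩ := hretr T a ha ha4
  obtain ⟨G, hG, hGL, hGg, hGo⟩ := exists_contDiff_approx hL hgL hgo hι
  have hh : ContDiff ℝ (⊤ : ℕ∞) (p ∘ G) := hp.comp hG
  refine ⟨p ∘ G, hh, ⟨[p ∘ G], ?_, rfl⟩, ?_, ?_⟩
  · intro k hk
    rw [List.mem_singleton] at hk
    subst hk
    refine ⟨hh.of_le (by exact_mod_cast le_top), ball 0 (1 + ε), isOpen_ball, convex_ball _ _,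
      isBounded_ball, Subset.rfl, ?_, ?_⟩
    · intro x hx
      rw [mem_ball_zero_iff, not_lt] at hx
      simp only [Function.comp_apply, hGo x (by linarith), hpo x (by linarith)]
    · rintro _ ⟨x, hx, rfl⟩
      refine hpB ε hε _ ?_
      rcases le_or_gt (1 + ι) ‖x‖ with h | h
      · rwa [hGo x h]
      · have hg1 : ‖g x‖ ≤ 1 + ι := by
          by_cases hx1 : x ∈ ball (0 : EuclideanSpace ℝ (Fin n)) 1
          · linarith [mem_closedBall_zero_iff.1 (hgB x (ball_subset_closedBall hx1))]
          · rw [hgo x hx1]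
            exact h.le
        rw [mem_ball_zero_iff]
        linarith [hGg x, norm_sub_norm_le (G x) (g x)]
  · intro x y
    calc ‖p (G x) - p (G y)‖ ≤ C * ‖G x - G y‖ := hpL _ _
      _ ≤ C * ((L + 2) * ‖x - y‖) := by gcongr; exact hGL x y
      _ ≤ (C * (L + 2) + L + 1) * ‖x - y‖ := by nlinarith [norm_nonneg (x - y)]
  · rintro _ ⟨s, hs, rfl⟩
    rw [hR]
    refine hpR (G s) (g s) ?_ ((hGg s).trans hιL.le)
    rw [← hR]
    exact hgS ⟨s, hs, rfl⟩
end
end
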